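/- arXiv:1105.0140 — 3 statements merged into one kernel-verified Lean document; each statement's English description precedes it below -/
import Mathlib

section
/- Let a countable amenable group G act continuously on a compact metrizable space X, and let Σ be a sofic approximation sequence for G. Then mdim_Σ(X) ≤ mdim(X). -/
open Filter Topology TopologicalSpace
open scoped ENat
open scoped Classical Pointwise

namespace SoficMD

/-- A sofic approximation sequence for a group `G`. -/
structure SoficApprox (G : Type*) [Group G] where
  d : ℕ → ℕ
  σ : ∀ i, G → Equiv.Perm (Fin (d i))
  approx_mul : ∀ s t : G, Tendsto
    (fun i => ((Finset.univ.filter fun a : Fin (d i) => σ i s (σ i t a) = σ i (s * t) a).card : ℝ) / (d i : ℝ))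
    atTop (𝓝 1)
  approx_sep : ∀ s t : G, s ≠ t → Tendsto
    (fun i => ((Finset.univ.filter fun a : Fin (d i) => σ i s a = σ i t a).card : ℝ) / (d i : ℝ))
    atTop (𝓝 0)
  d_tendsto : Tendsto d atTop atTop

/-- A continuous pseudometric on a topological space. -/
structure ContPseudoMetric (X : Type*) [TopologicalSpace X] where
  d : X → X → ℝ
  continuous' : Continuous fun p : X × X => d p.1 p.2
  nonneg : ∀ x y, 0 ≤ d x y
  symm : ∀ x y, d x y = d y x
  refl : ∀ x, d x x = 0
  triangle : ∀ x y z, d x z ≤ d x y + d y z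

/-- A continuous pseudometric on a compact Hausdorff space is a compatible metric iff it
separates points. -/
def ContPseudoMetric.IsCompatMetric {X : Type*} [TopologicalSpace X]
    (ρ : ContPseudoMetric X) : Prop :=
  ∀ x y : X, ρ.d x y = 0 → x = y

/-- A continuous pseudometric is dynamically generating if translates separate points. -/
def DynGenerating (G : Type*) {X : Type*} [Group G] [TopologicalSpace X] [MulAction G X]
    (ρ : ContPseudoMetric X) : Prop :=
  ∀ x y : X, x ≠ y → ∃ s : G, 0 < ρ.d (s • x) (s • y)

/-- Equivariance of a map between two `G`-spaces. -/
def Equivariant (G : Type*) {A B : Type*} [SMul G A] [SMul G B] (f : A → B) : Prop :=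
  ∀ (s : G) (a : A), f (s • a) = s • f a

/-- The normalized ℓ² pseudometric on maps `[d] → X`. -/
noncomputable def rho2 {X : Type*} [TopologicalSpace X] (ρ : ContPseudoMetric X) {d : ℕ}
    (φ ψ : Fin d → X) : ℝ :=
  Real.sqrt ((1 / (d : ℝ)) * ∑ a, (ρ.d (φ a) (ψ a)) ^ 2)

/-- The ℓ^∞ pseudometric on maps `[d] → X`. -/
noncomputable def rhoInfty {X : Type*} [TopologicalSpace X] (ρ : ContPseudoMetric X) {d : ℕ}
    (φ ψ : Fin d → X) : ℝ :=
  ⨆ a : Fin d, ρ.d (φ a) (ψ a)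

/-- The space of `(ρ, F, δ)`-approximately equivariant maps `[d] → X` relative to `σ`. -/
def MapSpace {G X : Type*} [Group G] [TopologicalSpace X] [MulAction G X]
    (ρ : ContPseudoMetric X) (F : Finset G) (δ : ℝ) {d : ℕ}
    (σ : G → Equiv.Perm (Fin d)) : Set (Fin d → X) :=
  {φ | ∀ s ∈ F, rho2 ρ (fun a => φ (σ s a)) (fun a => s • φ a) ≤ δ}

/-- A finite open cover. -/
def IsFinOpenCover {Y : Type*} [TopologicalSpace Y] (𝒰 : Finset (Set Y)) : Prop :=
  (∀ U ∈ 𝒰, IsOpen U) ∧ (⋃ U ∈ 𝒰, U) = Set.univ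

/-- `𝒱` refines `𝒰`. -/
def Refines {Y : Type*} (𝒱 𝒰 : Finset (Set Y)) : Prop :=
  ∀ V ∈ 𝒱, ∃ U ∈ 𝒰, V ⊆ U

/-- `ord` of a finite family of sets: the maximal multiplicity minus one. -/
noncomputable def coverOrd {Y : Type*} (𝒰 : Finset (Set Y)) : EReal :=
  (⨆ y : Y, (((𝒰.filter fun U => y ∈ U).card : ℝ) : EReal)) - 1

/-- `D(𝒰)`: the infimum of `ord 𝒱` over finite open covers `𝒱` refining `𝒰`. -/
noncomputable def coverD {Y : Type*} [TopologicalSpace Y] (𝒰 : Finset (Set Y)) : EReal :=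
  ⨅ 𝒱 ∈ {𝒱 : Finset (Set Y) | IsFinOpenCover 𝒱 ∧ Refines 𝒱 𝒰}, coverOrd 𝒱

/-- the product cover `𝒰^d` of `Y^[d]`. -/
noncomputable def prodCover {Y : Type*} (𝒰 : Finset (Set Y)) (d : ℕ) :
    Finset (Set (Fin d → Y)) :=
  (Fintype.piFinset fun _ : Fin d => 𝒰).image fun U => {φ | ∀ a, φ a ∈ U a}

/-- restriction of a cover to a subset, viewed as a cover of the subtype. -/
noncomputable def restrictCover {Y : Type*} (𝒰 : Finset (Set Y)) (Z : Set Y) :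
    Finset (Set Z) :=
  𝒰.image fun U => (Subtype.val ⁻¹' U : Set Z)

/-- `D(𝒰, ρ, F, δ, σ)`. -/
noncomputable def coverDMap {G X : Type*} [Group G] [TopologicalSpace X] [MulAction G X]
    (𝒰 : Finset (Set X)) (ρ : ContPseudoMetric X) (F : Finset G) (δ : ℝ) {d : ℕ}
    (σ : G → Equiv.Perm (Fin d)) : EReal :=
  coverD (restrictCover (prodCover 𝒰 d) (MapSpace ρ F δ σ))

/-- `D_Σ(𝒰, ρ, F, δ)`. -/
noncomputable def DSigmaFdel {G X : Type*} [Group G] [TopologicalSpace X] [MulAction G X]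
    (Sap : SoficApprox G) (𝒰 : Finset (Set X)) (ρ : ContPseudoMetric X)
    (F : Finset G) (δ : ℝ) : EReal :=
  limsup (fun i => coverDMap 𝒰 ρ F δ (Sap.σ i) * ((Sap.d i : ℝ)⁻¹ : EReal)) atTop

/-- `D_Σ(𝒰, ρ, F)`. -/
noncomputable def DSigmaF {G X : Type*} [Group G] [TopologicalSpace X] [MulAction G X]
    (Sap : SoficApprox G) (𝒰 : Finset (Set X)) (ρ : ContPseudoMetric X)
    (F : Finset G) : EReal :=
  ⨅ δ : {δ : ℝ // 0 < δ}, DSigmaFdel Sap 𝒰 ρ F δ.1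

/-- `D_Σ(𝒰, ρ)`. -/
noncomputable def DSigmaU {G X : Type*} [Group G] [TopologicalSpace X] [MulAction G X]
    (Sap : SoficApprox G) (𝒰 : Finset (Set X)) (ρ : ContPseudoMetric X) : EReal :=
  ⨅ F : {F : Finset G // F.Nonempty}, DSigmaF Sap 𝒰 ρ F.1

/-- the sofic mean topological dimension `mdim_Σ(X, ρ)`. -/
noncomputable def mdimSigma {G X : Type*} [Group G] [TopologicalSpace X] [MulAction G X]
    (Sap : SoficApprox G) (ρ : ContPseudoMetric X) : EReal :=
  ⨆ 𝒰 ∈ {𝒰 : Finset (Set X) | IsFinOpenCover 𝒰}, DSigmaU Sap 𝒰 ρ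

/-- `N_ε(Y, ρ)`: the maximal cardinality of `ε`-separated subsets. -/
noncomputable def sepNum {Y : Type*} (ρ : Y → Y → ℝ) (ε : ℝ) : ℕ∞ :=
  ⨆ E ∈ {E : Set Y | ∀ x ∈ E, ∀ y ∈ E, x ≠ y → ε ≤ ρ x y}, E.encard

/-- The extended-real logarithm of an extended natural number. -/
noncomputable def elog (n : ℕ∞) : EReal :=
  if n = ⊤ then ⊤ else if n = 0 then ⊥ else ((Real.log n.toNat : ℝ) : EReal)

/-- `log N_ε(Map(ρ,F,δ,σ), ρ_∞)`. -/
noncomputable def hCnt {G X : Type*} [Group G] [TopologicalSpace X] [MulAction G X]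
    (ρ : ContPseudoMetric X) (F : Finset G) (δ : ℝ) {d : ℕ}
    (σ : G → Equiv.Perm (Fin d)) (ε : ℝ) : EReal :=
  elog (sepNum (fun φ ψ : MapSpace ρ F δ σ => rhoInfty ρ φ.1 ψ.1) ε)

/-- `h^ε_{Σ,∞}(ρ, F, δ)`. -/
noncomputable def hEpsFdel {G X : Type*} [Group G] [TopologicalSpace X] [MulAction G X]
    (Sap : SoficApprox G) (ρ : ContPseudoMetric X) (ε : ℝ) (F : Finset G) (δ : ℝ) : EReal :=
  limsup (fun i => hCnt ρ F δ (Sap.σ i) ε * ((Sap.d i : ℝ)⁻¹ : EReal)) atTop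

/-- `h^ε_{Σ,∞}(ρ)`. -/
noncomputable def hEps {G X : Type*} [Group G] [TopologicalSpace X] [MulAction G X]
    (Sap : SoficApprox G) (ρ : ContPseudoMetric X) (ε : ℝ) : EReal :=
  ⨅ F : {F : Finset G // F.Nonempty}, ⨅ δ : {δ : ℝ // 0 < δ}, hEpsFdel Sap ρ ε F.1 δ.1

/-- The sofic mean metric dimension `mdim_{Σ,M}(X, ρ)`. -/
noncomputable def mdimSigmaM {G X : Type*} [Group G] [TopologicalSpace X] [MulAction G X]
    (Sap : SoficApprox G) (ρ : ContPseudoMetric X) : EReal :=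
  liminf (fun ε : ℝ => hEps Sap ρ ε * ((|Real.log ε|⁻¹ : ℝ) : EReal)) (𝓝[>] (0 : ℝ))

/-- The sofic mean metric dimension `mdim_{Σ,M}(X)`. -/
noncomputable def mdimSigmaMFull {G : Type*} [Group G] (Sap : SoficApprox G)
    (X : Type*) [TopologicalSpace X] [MulAction G X] : EReal :=
  ⨅ ρ : {ρ : ContPseudoMetric X // ρ.IsCompatMetric}, mdimSigmaM Sap ρ.1

/-- Følner-type characterization of amenability of a discrete group. -/
def AmenableF (G : Type*) [Group G] : Prop :=
  ∀ (K : Finset G) (ε : ℝ), 0 < ε →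
    ∃ F : Finset G, F.Nonempty ∧ (((K * F) \ F).card : ℝ) < ε * F.card

/-- The set of `(K, ε)`-invariant nonempty finite subsets of `G`. -/
noncomputable def FolnerSets {G : Type*} [Group G] (K : Finset G) (ε : ℝ) :
    Set (Finset G) :=
  {F | F.Nonempty ∧ (((K * F) \ F).card : ℝ) < ε * F.card}

/-- The cover `𝒰^F = ⋁_{s ∈ F} s⁻¹ 𝒰`. -/
noncomputable def coverJoin {G X : Type*} [Group G] [TopologicalSpace X] [MulAction G X]
    (𝒰 : Finset (Set X)) (F : Finset G) : Finset (Set X) :=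
  (F.pi fun _ => 𝒰).image fun f => ⋂ s, ⋂ (h : s ∈ F), (fun x : X => s • x) ⁻¹' f s h

/-- `mdim(𝒰)` as an inf-sup over more and more invariant sets. -/
noncomputable def mdimCoverIS {G X : Type*} [Group G] [TopologicalSpace X] [MulAction G X]
    (𝒰 : Finset (Set X)) : EReal :=
  ⨅ K : Finset G, ⨅ ε : {ε : ℝ // 0 < ε},
    ⨆ F ∈ FolnerSets K ε.1, coverD (coverJoin 𝒰 F) * ((F.card : ℝ)⁻¹ : EReal)

/-- `mdim(𝒰)` as a sup-inf over more and more invariant sets. -/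
noncomputable def mdimCoverSI {G X : Type*} [Group G] [TopologicalSpace X] [MulAction G X]
    (𝒰 : Finset (Set X)) : EReal :=
  ⨆ K : Finset G, ⨆ ε : {ε : ℝ // 0 < ε},
    ⨅ F ∈ FolnerSets K ε.1, coverD (coverJoin 𝒰 F) * ((F.card : ℝ)⁻¹ : EReal)

/-- mean topological dimension, inf-sup form. -/
noncomputable def mdimIS (G X : Type*) [Group G] [TopologicalSpace X] [MulAction G X] :
    EReal :=
  ⨆ 𝒰 ∈ {𝒰 : Finset (Set X) | IsFinOpenCover 𝒰}, mdimCoverIS (G := G) 𝒰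

/-- mean topological dimension, sup-inf form. -/
noncomputable def mdimSI (G X : Type*) [Group G] [TopologicalSpace X] [MulAction G X] :
    EReal :=
  ⨆ 𝒰 ∈ {𝒰 : Finset (Set X) | IsFinOpenCover 𝒰}, mdimCoverSI (G := G) 𝒰

/-- the pseudometric `ρ_F(x,y) = max_{s ∈ F} ρ(sx, sy)`. -/
noncomputable def rhoF {G X : Type*} [Group G] [TopologicalSpace X] [MulAction G X]
    (ρ : ContPseudoMetric X) (F : Finset G) (x y : X) : ℝ :=
  ⨆ s : F, ρ.d ((s : G) • x) ((s : G) • y)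

/-- diameter of a set w.r.t. a pseudometric given as a function. -/
noncomputable def diamP {Y : Type*} (ρ : Y → Y → ℝ) (U : Set Y) : ℝ :=
  ⨆ x : U, ⨆ y : U, ρ x y

/-- mesh of a finite cover w.r.t. a pseudometric given as a function. -/
noncomputable def meshP {Y : Type*} (ρ : Y → Y → ℝ) (𝒰 : Finset (Set Y)) : ℝ :=
  ⨆ U : 𝒰, diamP ρ U.1

/-- minimal cardinality of a finite open cover of mesh `< ε`. -/
noncomputable def minCoverCard {Y : Type*} [TopologicalSpace Y] (ρ : Y → Y → ℝ) (ε : ℝ) : ℕ :=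
  sInf {n : ℕ | ∃ 𝒰 : Finset (Set Y), IsFinOpenCover 𝒰 ∧ meshP ρ 𝒰 < ε ∧ 𝒰.card = n}

/-- `S(X, ε, ρ)` in inf-sup form. -/
noncomputable def SamenIS {G X : Type*} [Group G] [TopologicalSpace X] [MulAction G X]
    (ρ : ContPseudoMetric X) (ε : ℝ) : EReal :=
  ⨅ K : Finset G, ⨅ δ : {δ : ℝ // 0 < δ},
    ⨆ F ∈ FolnerSets K δ.1,
      ((Real.log (minCoverCard (rhoF ρ F) ε) / F.card : ℝ) : EReal)

/-- `S(X, ε, ρ)` in sup-inf form. -/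
noncomputable def SamenSI {G X : Type*} [Group G] [TopologicalSpace X] [MulAction G X]
    (ρ : ContPseudoMetric X) (ε : ℝ) : EReal :=
  ⨆ K : Finset G, ⨆ δ : {δ : ℝ // 0 < δ},
    ⨅ F ∈ FolnerSets K δ.1,
      ((Real.log (minCoverCard (rhoF ρ F) ε) / F.card : ℝ) : EReal)

/-- mean metric dimension `mdim_M(X, ρ)`, inf-sup form. -/
noncomputable def mdimMIS {G X : Type*} [Group G] [TopologicalSpace X] [MulAction G X]
    (ρ : ContPseudoMetric X) : EReal :=
  liminf (fun ε : ℝ => SamenIS (G := G) ρ ε * ((|Real.log ε|⁻¹ : ℝ) : EReal)) (𝓝[>] (0 : ℝ))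

/-- mean metric dimension `mdim_M(X, ρ)`, sup-inf form. -/
noncomputable def mdimMSI {G X : Type*} [Group G] [TopologicalSpace X] [MulAction G X]
    (ρ : ContPseudoMetric X) : EReal :=
  liminf (fun ε : ℝ => SamenSI (G := G) ρ ε * ((|Real.log ε|⁻¹ : ℝ) : EReal)) (𝓝[>] (0 : ℝ))

/-- The covering dimension of a topological space, as an extended natural number. -/
noncomputable def covDim (Y : Type*) [TopologicalSpace Y] : ℕ∞ :=
  sInf {n : ℕ∞ | ∀ 𝒰 : Finset (Set Y), IsFinOpenCover 𝒰 →
    ∃ 𝒱 : Finset (Set Y), IsFinOpenCover 𝒱 ∧ Refines 𝒱 𝒰 ∧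
      ∀ y : Y, (((𝒱.filter fun V => y ∈ V).card : ℕ∞)) ≤ n + 1}

/-- conversion of extended naturals into extended reals. -/
noncomputable def enatToEReal (n : ℕ∞) : EReal :=
  if n = ⊤ then ⊤ else ((n.toNat : ℝ) : EReal)

/-- The action of `G` on a `G`-invariant subset. -/
def invariantSubMulAction {G X : Type*} [Group G] [MulAction G X] (Y : Set X)
    (h : ∀ (s : G), ∀ x ∈ Y, s • x ∈ Y) : MulAction G Y where
  smul s y := ⟨s • (y : X), h s y y.2⟩
  one_smul y := Subtype.ext (one_smul G (y : X))
  mul_smul s t y := Subtype.ext (mul_smul s t (y : X))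

end SoficMD


open Filter Topology TopologicalSpace
open scoped ENat
open scoped Classical Pointwise

namespace SoficMD

theorem coverOrd_le {Y : Type*} {𝒱 : Finset (Set Y)} {N : ℕ}
    (h : ∀ y, (𝒱.filter fun V => y ∈ V).card ≤ N + 1) : coverOrd 𝒱 ≤ ((N : ℝ) : EReal) := by
  have h1 : (⨆ y : Y, (((𝒱.filter fun U => y ∈ U).card : ℝ) : EReal)) ≤
      (((N : ℝ) + 1 : ℝ) : EReal) := by
    refine iSup_le fun y => ?_
    exact_mod_cast h y
  calc coverOrd 𝒱 ≤ (((N : ℝ) + 1 : ℝ) : EReal) - 1 := EReal.sub_le_sub h1 le_rfl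
    _ = ((N : ℝ) : EReal) := by
      rw [show (1 : EReal) = ((1 : ℝ) : EReal) from rfl, ← EReal.coe_sub]; simp

theorem card_filter_le_of_coverOrd_lt {Y : Type*} {𝒱 : Finset (Set Y)} {r : ℝ}
    (h : coverOrd 𝒱 < (r : EReal)) (y : Y) :
    ((𝒱.filter fun V => y ∈ V).card : ℝ) ≤ r + 1 := by
  have h1 : (((𝒱.filter fun U => y ∈ U).card : ℝ) : EReal) - 1 ≤ coverOrd 𝒱 :=
    EReal.sub_le_sub (le_iSup (fun y : Y => (((𝒱.filter fun U => y ∈ U).card : ℝ) : EReal)) y)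
      le_rfl
  have h2 := h1.trans_lt h
  rw [show (1 : EReal) = ((1 : ℝ) : EReal) from rfl, ← EReal.coe_sub, EReal.coe_lt_coe_iff] at h2
  linarith

theorem coverD_eq_bot_of_isEmpty {Y : Type*} [TopologicalSpace Y] [IsEmpty Y]
    (𝒲 : Finset (Set Y)) : coverD 𝒲 = ⊥ := by
  refine le_bot_iff.1 (iInf₂_le_of_le ∅ ⟨⟨by simp, ?_⟩, by simp [Refines]⟩ ?_)
  · ext y
    exact isEmptyElim y
  · simp [coverOrd]

/-- If finitely many continuous functions have at most `N` values strictly between `0` and `1`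
at every point, then comparing them with `N + 1` thresholds yields an open cover of order at
most `N`. -/
theorem coverD_le_of_thresholds {Y ι : Type*} [TopologicalSpace Y] [Fintype ι] (g : ι → Y → ℝ)
    (hg : ∀ i, Continuous (g i)) (N : ℕ)
    (hN : ∀ y, (Finset.univ.filter fun i => 0 < g i y ∧ g i y < 1).card ≤ N)
    (𝒲 : Finset (Set Y))
    (h : ∀ t : ℝ, 0 < t → t < 1 → ∀ y₀, (∀ i, g i y₀ ≠ t) → ∃ W ∈ 𝒲, ∀ y, (∀ i, g i y ≠ t) →
      (∀ i, t < g i y ↔ t < g i y₀) → y ∈ W) :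
    coverD 𝒲 ≤ ((N : ℝ) : EReal) := by
  set t : Fin (N + 1) → ℝ := fun j => ((j : ℝ) + 1) / (N + 2) with ht
  have hNpos : (0 : ℝ) < N + 2 := by positivity
  have t_pos : ∀ j, 0 < t j := fun j => by simp only [ht]; positivity
  have t_lt : ∀ j, t j < 1 := fun j => by
    simp only [ht]
    rw [div_lt_one hNpos]
    have : ((j : ℕ) : ℝ) < N + 1 := by exact_mod_cast j.2
    linarith
  have t_inj : Function.Injective t := fun j k hjk => by
    simp only [ht] at hjk
    rw [div_left_inj' hNpos.ne'] at hjk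
    have : ((j : ℕ) : ℝ) = (k : ℕ) := by linarith
    exact Fin.ext (by exact_mod_cast this)
  set A : Fin (N + 1) → Finset ι → Set Y := fun j S =>
    ⋂ i, {y | if i ∈ S then t j < g i y else g i y < t j} with hA
  have mem_A : ∀ j S y, y ∈ A j S ↔ ∀ i, if i ∈ S then t j < g i y else g i y < t j := by
    intro j S y; simp [hA]
  have ne_of_mem : ∀ {j S y}, y ∈ A j S → ∀ i, g i y ≠ t j := by
    intro j S y hy i
    have := (mem_A j S y).1 hy i
    split_ifs at this
    · exact this.ne'
    · exact this.ne
  have iff_of_mem : ∀ {j S y}, y ∈ A j S → ∀ i, t j < g i y ↔ i ∈ S := by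
    intro j S y hy i
    have := (mem_A j S y).1 hy i
    split_ifs at this with hi
    · simp [hi, this]
    · simp [hi, this.le]
  set 𝒱 : Finset (Set Y) := ((Finset.univ : Finset (Fin (N + 1) × Finset ι)).image
    fun p => A p.1 p.2).filter fun V => V.Nonempty with h𝒱
  refine iInf₂_le_of_le 𝒱 ⟨⟨?_, ?_⟩, ?_⟩ (coverOrd_le fun y => ?_)
  · intro U hU
    obtain ⟨⟨⟨j, S⟩, rfl⟩, -⟩ : (∃ p : Fin (N + 1) × Finset ι, A p.1 p.2 = U) ∧ U.Nonempty := by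
      simpa [h𝒱] using hU
    refine isOpen_iInter_of_finite fun i => ?_
    by_cases hi : i ∈ S
    · simpa [hi] using isOpen_lt continuous_const (hg i)
    · simpa [hi] using isOpen_lt (hg i) continuous_const
  · refine Set.eq_univ_of_forall fun y => ?_
    obtain ⟨j, hj⟩ : ∃ j, ∀ i, g i y ≠ t j := by
      by_contra! hcon
      choose f hf using hcon
      have hinj : Function.Injective f := fun j k hjk => t_inj (by rw [← hf j, ← hf k, hjk])
      have := Finset.card_le_card_of_injOn (s := Finset.univ)
        (t := Finset.univ.filter fun i => 0 < g i y ∧ g i y < 1) f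
        (fun j _ => by simp [hf j, t_pos j, t_lt j]) hinj.injOn
      have h3 := hN y
      simp only [Finset.card_univ, Fintype.card_fin] at this
      omega
    have hy : y ∈ A j (Finset.univ.filter fun i => t j < g i y) := by
      rw [mem_A]
      intro i
      by_cases hi : t j < g i y
      · simp [hi]
      · simpa [hi] using lt_of_le_of_ne (not_lt.1 hi) (hj i)
    simp only [Set.mem_iUnion]
    exact ⟨_, Finset.mem_filter.2 ⟨Finset.mem_image.2 ⟨(j, _), Finset.mem_univ _, rfl⟩, y, hy⟩, hy⟩
  · intro V hV
    obtain ⟨⟨⟨j, S⟩, rfl⟩, y₀, hy₀⟩ :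
        (∃ p : Fin (N + 1) × Finset ι, A p.1 p.2 = V) ∧ V.Nonempty := by
      simpa [h𝒱] using hV
    obtain ⟨W, hW, hsub⟩ := h (t j) (t_pos j) (t_lt j) y₀ (ne_of_mem hy₀)
    refine ⟨W, hW, fun y hy => hsub y (ne_of_mem hy) fun i => ?_⟩
    rw [iff_of_mem hy, iff_of_mem hy₀]
  · have hsub : (𝒱.filter fun V => y ∈ V) ⊆ (Finset.univ : Finset (Fin (N + 1))).image
        fun j => A j (Finset.univ.filter fun i => t j < g i y) := by
      intro V hV
      rw [Finset.mem_filter] at hV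
      obtain ⟨⟨⟨j, S⟩, rfl⟩, -⟩ :
          (∃ p : Fin (N + 1) × Finset ι, A p.1 p.2 = V) ∧ V.Nonempty := by
        simpa [h𝒱] using hV.1
      have hS : S = Finset.univ.filter fun i => t j < g i y := by
        ext i; simp [iff_of_mem hV.2 i]
      exact Finset.mem_image.2 ⟨j, Finset.mem_univ _, by rw [← hS]⟩
    calc _ ≤ _ := Finset.card_le_card hsub
      _ ≤ _ := Finset.card_image_le
      _ = N + 1 := by simp

/-- A finite open cover of a normal space admits continuous bump functions, at every point one of
which equals `1`. -/
theorem exists_bump {X : Type*} [TopologicalSpace X] [NormalSpace X] {𝒱 : Finset (Set X)}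
    (h : IsFinOpenCover 𝒱) :
    ∃ g : 𝒱 → X → ℝ, (∀ V, Continuous (g V)) ∧
      (∀ V x, 0 < g V x → x ∈ V.1) ∧ ∀ x, ∃ V, g V x = 1 := by
  obtain ⟨f, hf⟩ := BumpCovering.exists_isSubordinate_of_locallyFinite (ι := 𝒱) (s := Set.univ)
    isClosed_univ (fun V => V.1) (fun V => h.1 V.1 V.2) (locallyFinite_of_finite _) (by
      rw [← h.2, Set.iUnion_subtype])
  refine ⟨fun V => f V, fun V => (f V).continuous,
    fun V x hx => hf V (subset_tsupport _ hx.ne'), fun x => ?_⟩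
  obtain ⟨V, hV⟩ := f.eventuallyEq_one' x (Set.mem_univ x)
  exact ⟨V, hV.self_of_nhds⟩

/-- The number of bump functions taking an intermediate value is at most the order of the cover. -/
theorem card_intermediate_le {X : Type*} {𝒱 : Finset (Set X)} (g : 𝒱 → X → ℝ)
    (hsupp : ∀ V x, 0 < g V x → x ∈ V.1) (hone : ∀ x, ∃ V, g V x = 1) (x : X) :
    (Finset.univ.filter fun V => 0 < g V x ∧ g V x < 1).card + 1 ≤
      (𝒱.filter fun V => x ∈ V).card := by
  obtain ⟨V₀, hV₀⟩ := hone x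
  rw [← Finset.card_insert_of_notMem
    (s := Finset.univ.filter fun V => 0 < g V x ∧ g V x < 1) (a := V₀) (by simp [hV₀])]
  refine Finset.card_le_card_of_injOn (fun V => V.1) (fun V hV => ?_)
    Subtype.val_injective.injOn
  have : 0 < g V x := by
    rcases Finset.mem_insert.1 (Finset.mem_coe.1 hV) with rfl | hV
    · simp [hV₀]
    · exact (Finset.mem_filter.1 hV).2.1
  simpa using hsupp V x this

/-- A finite open cover is uniformly expandable into a given one. -/
theorem exists_cover_expand {X : Type*} [TopologicalSpace X] [CompactSpace X]
    (ρ : ContPseudoMetric X) (hρ : ρ.IsCompatMetric) {𝒰 : Finset (Set X)}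
    (h𝒰 : IsFinOpenCover 𝒰) :
    ∃ (𝒲 : Finset (Set X)) (τ : ℝ), IsFinOpenCover 𝒲 ∧ 0 < τ ∧
      ∀ W ∈ 𝒲, ∃ U ∈ 𝒰, ∀ x ∈ W, ∀ y, ρ.d y x < τ → y ∈ U := by
  have hcont : ∀ x, Continuous fun y => ρ.d x y := fun x =>
    ρ.continuous'.comp (continuous_const.prodMk continuous_id)
  have hloc : ∀ x, ∃ r : ℝ, 0 < r ∧ ∃ U ∈ 𝒰, ∀ y, ρ.d x y < r → y ∈ U := by
    intro x
    obtain ⟨U, hU, hxU⟩ : ∃ U ∈ 𝒰, x ∈ U := by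
      have := h𝒰.2 ▸ Set.mem_univ x
      simpa using this
    have hcomp : IsCompact Uᶜ := (h𝒰.1 U hU).isClosed_compl.isCompact
    rcases Set.eq_empty_or_nonempty Uᶜ with he | hne
    · refine ⟨1, one_pos, U, hU, fun y _ => ?_⟩
      rw [Set.compl_empty_iff] at he
      simp [he]
    · obtain ⟨z, hz, hmin⟩ := hcomp.exists_isMinOn hne (hcont x).continuousOn
      refine ⟨ρ.d x z, lt_of_le_of_ne (ρ.nonneg _ _) fun h0 => hz ?_, U, hU, fun y hy => ?_⟩
      · rwa [← hρ x z h0.symm]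
      · by_contra hyU
        exact absurd (hmin hyU) (not_le.2 hy)
  choose r hr U hU hball using hloc
  obtain ⟨s, hs⟩ := isCompact_univ.elim_finite_subcover (fun x => {y | ρ.d x y < r x / 2})
    (fun x => isOpen_lt (hcont x) continuous_const)
    (fun x _ => Set.mem_iUnion.2 ⟨x, by simpa [ρ.refl] using hr x⟩)
  obtain ⟨τ, hτ, hτs⟩ : ∃ τ : ℝ, 0 < τ ∧ ∀ x ∈ s, τ ≤ r x / 2 := by
    rcases s.eq_empty_or_nonempty with rfl | hne
    · exact ⟨1, one_pos, by simp⟩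
    · refine ⟨s.inf' hne fun x => r x / 2, ?_, fun x hx => Finset.inf'_le _ hx⟩
      rw [Finset.lt_inf'_iff]
      exact fun x _ => half_pos (hr x)
  refine ⟨s.image fun x => {y | ρ.d x y < r x / 2}, τ, ⟨?_, ?_⟩, hτ, ?_⟩
  · simp only [Finset.mem_image, forall_exists_index, and_imp, forall_apply_eq_imp_iff₂]
    exact fun x _ => isOpen_lt (hcont x) continuous_const
  · simpa using Set.univ_subset_iff.1 hs
  · simp only [Finset.mem_image, forall_exists_index, and_imp, forall_apply_eq_imp_iff₂]
    refine fun x hx => ⟨U x, hU x, fun y hy z hz => hball x z ?_⟩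
    have h1 := ρ.triangle x y z
    have h2 := ρ.symm z y
    have h3 := hτs x hx
    rw [Set.mem_ofPred_eq] at hy
    linarith

/-- The set covered by the tiles `p = (F, c)`, i.e. by the sets `σ(F) c`. -/
noncomputable def tileUnion {G V : Type*} [DecidableEq V]
    (σ : G → Equiv.Perm V) (T : Finset (Finset G × V)) :
    Finset V :=
  T.biUnion fun p => p.1.image fun s => σ s p.2

theorem tileUnion_mono {G V : Type*} [DecidableEq V]
    (σ : G → Equiv.Perm V) {T T' : Finset (Finset G × V)}
    (h : T ⊆ T') : tileUnion σ T ⊆ tileUnion σ T' :=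
  Finset.biUnion_subset_biUnion_of_subset_left _ h

theorem mem_tileUnion {G V : Type*} [DecidableEq V]
    {σ : G → Equiv.Perm V} {T : Finset (Finset G × V)} {a : V} :
    a ∈ tileUnion σ T ↔ ∃ p ∈ T, ∃ s ∈ p.1, σ s p.2 = a := by
  simp [tileUnion]

/-- Double counting: the pairs `(s, c)` with `s ∈ F`, `c ∈ A` and `σ s c ∈ B` number at most
`|F| |B|`. -/
theorem sum_card_hits_le {G V : Type*} [DecidableEq V]
    (σ : G → Equiv.Perm V) (F : Finset G) (A B : Finset V) :
    ∑ c ∈ A, (F.filter fun s => σ s c ∈ B).card ≤ F.card * B.card := by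
  simp only [Finset.card_filter]
  rw [Finset.sum_comm]
  simp only [← Finset.card_filter]
  rw [← smul_eq_mul]
  refine Finset.sum_le_card_nsmul _ _ _ fun s _ => ?_
  exact Finset.card_le_card_of_injOn (σ s) (fun c hc => by simpa using (Finset.mem_filter.1 hc).2)
    (σ s).injective.injOn

/-- A family of tiles can be enlarged by translates of `F`, keeping the total mass under control,
until every admissible translate of `F` is hit in proportion at least `ε`. -/
theorem exists_maximal_tiles {G V : Type*} [Fintype V] [DecidableEq V] (σ : G → Equiv.Perm V)
    (good : Finset V) (F : Finset G) (hF : ∀ c ∈ good, Set.InjOn (fun s => σ s c) F)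
    {ε : ℝ} (hε1 : ε < 1) (T : Finset (Finset G × V))
    (hT : (1 - ε) * ∑ p ∈ T, (p.1.card : ℝ) ≤ (tileUnion σ T).card) :
    ∃ T', T ⊆ T' ∧ (∀ p ∈ T', p ∈ T ∨ p.1 = F ∧ p.2 ∈ good) ∧
      (1 - ε) * ∑ p ∈ T', (p.1.card : ℝ) ≤ (tileUnion σ T').card ∧
      ∀ c ∈ good, ε * F.card ≤ (F.filter fun s => σ s c ∈ tileUnion σ T').card := by
  set S : Finset (Finset (Finset G × V)) := (T ∪ good.image fun c => (F, c)).powerset.filter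
    fun T' => T ⊆ T' ∧ (1 - ε) * ∑ p ∈ T', (p.1.card : ℝ) ≤ (tileUnion σ T').card with hS
  obtain ⟨T', hT'S, hmax⟩ := S.exists_max_image Finset.card
    ⟨T, Finset.mem_filter.2
      ⟨Finset.mem_powerset.2 Finset.subset_union_left, subset_rfl, hT⟩⟩
  simp only [hS, Finset.mem_filter, Finset.mem_powerset] at hT'S hmax
  obtain ⟨hsub, hTT', hmass⟩ := hT'S
  refine ⟨T', hTT', fun p hp => ?_, hmass, fun c hc => ?_⟩
  · rcases Finset.mem_union.1 (hsub hp) with h | h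
    · exact Or.inl h
    · obtain ⟨c, hc, rfl⟩ := Finset.mem_image.1 h
      exact Or.inr ⟨rfl, hc⟩
  · by_cases hmem : (F, c) ∈ T'
    · rw [Finset.filter_true_of_mem fun s hs => mem_tileUnion.2 ⟨_, hmem, s, hs, rfl⟩]
      nlinarith [(Nat.cast_nonneg F.card : (0 : ℝ) ≤ F.card)]
    · by_contra! hlt
      have hsplit := Finset.card_filter_add_card_filter_not (s := F)
        fun s => σ s c ∈ tileUnion σ T'
      have hsplitR : ((F.filter fun s => σ s c ∈ tileUnion σ T').card : ℝ) +
          (F.filter fun s => σ s c ∉ tileUnion σ T').card = F.card := by exact_mod_cast hsplit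
      have hunion : (F.filter fun s => σ s c ∉ tileUnion σ T').card + (tileUnion σ T').card ≤
          (tileUnion σ (insert (F, c) T')).card := by
        rw [← Finset.card_image_of_injOn (s := F.filter fun s => σ s c ∉ tileUnion σ T')
          (f := fun s => σ s c) ((hF c hc).mono (Finset.coe_subset.2 (Finset.filter_subset _ _))),
        ← Finset.card_union_of_disjoint]
        · refine Finset.card_le_card (Finset.union_subset ?_
            (tileUnion_mono σ (Finset.subset_insert _ _)))
          intro a ha
          obtain ⟨s, hs, rfl⟩ := Finset.mem_image.1 ha
          exact mem_tileUnion.2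
            ⟨_, Finset.mem_insert_self _ _, s, (Finset.mem_filter.1 hs).1, rfl⟩
        · rw [Finset.disjoint_left]
          intro a ha
          obtain ⟨s, hs, rfl⟩ := Finset.mem_image.1 ha
          exact (Finset.mem_filter.1 hs).2
      have hunionR : ((F.filter fun s => σ s c ∉ tileUnion σ T').card : ℝ) +
          (tileUnion σ T').card ≤ (tileUnion σ (insert (F, c) T')).card := by
        exact_mod_cast hunion
      have := hmax (insert (F, c) T') ⟨?_, hTT'.trans (Finset.subset_insert _ _), ?_⟩
      · rw [Finset.card_insert_of_notMem hmem] at this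
        omega
      · refine Finset.insert_subset (Finset.mem_union_right _ ?_) hsub
        exact Finset.mem_image_of_mem _ hc
      · rw [Finset.sum_insert hmem]
        simp only
        linarith

/-- Points whose `F`-translates avoid the tiles are almost as many as the uncovered points,
provided the tiles are almost invariant. -/
theorem card_avoiding_ge {G V : Type*} [Group G] [Fintype V] [DecidableEq V] (σ : G → Equiv.Perm V)
    (F : Finset G) (T : Finset (Finset G × V)) {ξ : ℝ}
    (hinv : ∀ p ∈ T, (((F⁻¹ * p.1) \ p.1).card : ℝ) ≤ ξ * p.1.card)
    (hmul : ∀ p ∈ T, ∀ s ∈ F, ∀ t ∈ p.1, σ s (σ (s⁻¹ * t) p.2) = σ t p.2) :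
    ((tileUnion σ T)ᶜ.card : ℝ) ≤
      (Finset.univ.filter fun c => ∀ s ∈ F, σ s c ∉ tileUnion σ T).card +
        ξ * ∑ p ∈ T, (p.1.card : ℝ) := by
  have hsub : (tileUnion σ T)ᶜ ⊆ (Finset.univ.filter fun c => ∀ s ∈ F, σ s c ∉ tileUnion σ T) ∪
      T.biUnion fun p => ((F⁻¹ * p.1) \ p.1).image fun s => σ s p.2 := by
    intro b hb
    by_cases hb' : ∀ s ∈ F, σ s b ∉ tileUnion σ T
    · exact Finset.mem_union_left _ (by simpa using hb')
    · push Not at hb'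
      obtain ⟨s, hs, hsb⟩ := hb'
      obtain ⟨p, hp, t, ht, heq⟩ := mem_tileUnion.1 hsb
      rw [← hmul p hp s hs t ht] at heq
      have hb2 := (σ s).injective heq
      refine Finset.mem_union_right _ (Finset.mem_biUnion.2 ⟨p, hp, Finset.mem_image.2
        ⟨s⁻¹ * t, Finset.mem_sdiff.2 ⟨Finset.mul_mem_mul (Finset.inv_mem_inv hs) ht, fun h => ?_⟩,
          hb2⟩⟩)
      exact (Finset.mem_compl.1 hb) (mem_tileUnion.2 ⟨p, hp, _, h, hb2⟩)
  have h1 : ((T.biUnion fun p => ((F⁻¹ * p.1) \ p.1).image fun s => σ s p.2).card : ℝ) ≤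
      ξ * ∑ p ∈ T, (p.1.card : ℝ) := by
    calc _ ≤ ((∑ p ∈ T, ((F⁻¹ * p.1) \ p.1).card : ℕ) : ℝ) := by
          exact_mod_cast Finset.card_biUnion_le.trans
            (Finset.sum_le_sum fun p _ => Finset.card_image_le)
      _ ≤ _ := by
          push_cast
          rw [Finset.mul_sum]
          exact Finset.sum_le_sum hinv
  have h2 := (Finset.card_le_card hsub).trans (Finset.card_union_le _ _)
  rify at h2
  linarith

/-- One stage of the quasi-tiling construction. -/
theorem exists_tiles_stage {G V : Type*} [Group G] [Fintype V] [DecidableEq V]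
    (σ : G → Equiv.Perm V)
    (good : Finset V) (F : Finset G) (hFne : F.Nonempty)
    (hF : ∀ c ∈ good, Set.InjOn (fun s => σ s c) F)
    {ε ξ : ℝ} (hε0 : 0 < ε) (hε1 : ε ≤ 1 / 2) (hξ : 0 ≤ ξ) (T : Finset (Finset G × V))
    (hT : (1 - ε) * ∑ p ∈ T, (p.1.card : ℝ) ≤ (tileUnion σ T).card)
    (hinv : ∀ p ∈ T, (((F⁻¹ * p.1) \ p.1).card : ℝ) ≤ ξ * p.1.card)
    (hmul : ∀ p ∈ T, ∀ s ∈ F, ∀ t ∈ p.1, σ s (σ (s⁻¹ * t) p.2) = σ t p.2) :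
    ∃ T', T ⊆ T' ∧ (∀ p ∈ T', p ∈ T ∨ p.1 = F ∧ p.2 ∈ good) ∧
      (1 - ε) * ∑ p ∈ T', (p.1.card : ℝ) ≤ (tileUnion σ T').card ∧
      ((tileUnion σ T')ᶜ.card : ℝ) ≤ (1 - ε) * (tileUnion σ T)ᶜ.card +
        ε * (2 * ξ * Fintype.card V + goodᶜ.card) := by
  obtain ⟨T', hTT', hmem, hmass, hhit⟩ :=
    exists_maximal_tiles σ good F hF (by linarith : ε < 1) T hT
  refine ⟨T', hTT', hmem, hmass, ?_⟩
  set A' : Finset V := Finset.univ.filter fun c => ∀ s ∈ F, σ s c ∉ tileUnion σ T with hA'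
  set B : Finset V := tileUnion σ T' \ tileUnion σ T with hB
  have hFpos : (0 : ℝ) < F.card := by exact_mod_cast hFne.card_pos
  have hcount : ε * (A' ∩ good).card ≤ B.card := by
    have h1 : (A' ∩ good).card • (ε * F.card) ≤
        ∑ c ∈ A' ∩ good, ((F.filter fun s => σ s c ∈ B).card : ℝ) := by
      refine Finset.card_nsmul_le_sum _ _ _ fun c hc => ?_
      obtain ⟨hcA, hcg⟩ := Finset.mem_inter.1 hc
      refine (hhit c hcg).trans (le_of_eq ?_)
      congr 2
      refine Finset.filter_congr fun s hs => ?_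
      have := (Finset.mem_filter.1 hcA).2 s hs
      simp [hB, this]
    have h2 : ∑ c ∈ A' ∩ good, ((F.filter fun s => σ s c ∈ B).card : ℝ) ≤ F.card * B.card := by
      exact_mod_cast sum_card_hits_le σ F (A' ∩ good) B
    rw [nsmul_eq_mul] at h1
    nlinarith
  have hmassd : ∑ p ∈ T, (p.1.card : ℝ) ≤ 2 * Fintype.card V := by
    have h1 : ((tileUnion σ T).card : ℝ) ≤ Fintype.card V := by
      exact_mod_cast Finset.card_le_univ _
    have h2 : (0 : ℝ) ≤ ∑ p ∈ T, (p.1.card : ℝ) := Finset.sum_nonneg fun _ _ => Nat.cast_nonneg _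
    nlinarith
  have havoid := card_avoiding_ge σ F T hinv hmul
  have hA'good : (A'.card : ℝ) ≤ (A' ∩ good).card + goodᶜ.card := by
    have : A' ⊆ (A' ∩ good) ∪ goodᶜ := fun c hc => by
      by_cases hcg : c ∈ good <;> simp [hc, hcg]
    exact_mod_cast (Finset.card_le_card this).trans (Finset.card_union_le _ _)
  have hBcard : ((tileUnion σ T')ᶜ.card : ℝ) + B.card = (tileUnion σ T)ᶜ.card := by
    have hdisj : Disjoint (tileUnion σ T')ᶜ B := by
      rw [Finset.disjoint_left]
      intro a ha hb
      exact (Finset.mem_compl.1 ha) (Finset.mem_sdiff.1 hb).1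
    have hun : (tileUnion σ T')ᶜ ∪ B = (tileUnion σ T)ᶜ := by
      ext a
      have := @tileUnion_mono _ _ _ σ _ _ hTT' a
      simp only [hB, Finset.mem_union, Finset.mem_compl, Finset.mem_sdiff]
      tauto
    rw [← hun, Finset.card_union_of_disjoint hdisj]
    push_cast
    rfl
  have hkey : ((tileUnion σ T)ᶜ.card : ℝ) ≤
      (A' ∩ good).card + goodᶜ.card + 2 * ξ * Fintype.card V := by
    have := mul_le_mul_of_nonneg_left hmassd hξ
    linarith
  have := mul_le_mul_of_nonneg_left hkey hε0.le
  linarith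

/-- Quasi-tiling: successive stages for a list of shapes, the most invariant ones first. -/
theorem exists_tiles {G V : Type*} [Group G] [Fintype V] [DecidableEq V] (σ : G → Equiv.Perm V)
    (good : Finset V) {ε ξ : ℝ} (hε0 : 0 < ε) (hε1 : ε ≤ 1 / 2) (hξ : 0 ≤ ξ)
    (l : List (Finset G)) (hne : ∀ F ∈ l, F.Nonempty)
    (hinj : ∀ F ∈ l, ∀ c ∈ good, Set.InjOn (fun s => σ s c) F)
    (hmul : ∀ F ∈ l, ∀ F' ∈ l, ∀ c ∈ good, ∀ s ∈ F, ∀ t ∈ F', σ s (σ (s⁻¹ * t) c) = σ t c)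
    (hinv : l.Pairwise fun F' F => (((F⁻¹ * F') \ F').card : ℝ) ≤ ξ * F'.card) :
    ∃ T : Finset (Finset G × V), (∀ p ∈ T, p.1 ∈ l ∧ p.2 ∈ good) ∧
      (1 - ε) * ∑ p ∈ T, (p.1.card : ℝ) ≤ (tileUnion σ T).card ∧
      ((tileUnion σ T)ᶜ.card : ℝ) ≤ (1 - ε) ^ l.length * Fintype.card V +
        (2 * ξ * Fintype.card V + goodᶜ.card) := by
  set β : ℝ := 2 * ξ * Fintype.card V + goodᶜ.card with hβ
  have hβ0 : 0 ≤ β := by positivity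
  suffices h : ∀ l' : List (Finset G), l' <:+ l → ∀ T₀ : Finset (Finset G × V),
      (∀ p ∈ T₀, p.1 ∈ l ∧ p.2 ∈ good) →
      (∀ p ∈ T₀, ∀ F ∈ l', (((F⁻¹ * p.1) \ p.1).card : ℝ) ≤ ξ * p.1.card) →
      (1 - ε) * ∑ p ∈ T₀, (p.1.card : ℝ) ≤ (tileUnion σ T₀).card →
      ∃ T : Finset (Finset G × V), (∀ p ∈ T, p.1 ∈ l ∧ p.2 ∈ good) ∧
        (1 - ε) * ∑ p ∈ T, (p.1.card : ℝ) ≤ (tileUnion σ T).card ∧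
        ((tileUnion σ T)ᶜ.card : ℝ) ≤ (1 - ε) ^ l'.length * (tileUnion σ T₀)ᶜ.card +
          (1 - (1 - ε) ^ l'.length) * β by
    obtain ⟨T, h1, h2, h3⟩ := h l (List.suffix_refl l) ∅ (by simp) (by simp) (by simp)
    refine ⟨T, h1, h2, h3.trans ?_⟩
    have hpow : 0 ≤ (1 - ε) ^ l.length := pow_nonneg (by linarith) _
    have hempty : ((tileUnion σ ∅)ᶜ.card : ℝ) = Fintype.card V := by simp [tileUnion]
    rw [hempty]
    nlinarith
  intro l'
  induction l' with
  | nil => intro _ T₀ h1 _ h3; exact ⟨T₀, h1, h3, by simp⟩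
  | cons F l' ih =>
    intro hsuf T₀ h1 h2 h3
    have hFl : F ∈ l := hsuf.subset (by simp)
    obtain ⟨T₁, -, hmem, hmass, hunc⟩ := exists_tiles_stage σ good F (hne F hFl) (hinj F hFl)
      hε0 hε1 hξ T₀ h3 (fun p hp => h2 p hp F (by simp))
      (fun p hp s hs t ht => hmul F hFl p.1 (h1 p hp).1 p.2 (h1 p hp).2 s hs t ht)
    obtain ⟨T, hT1, hT2, hT3⟩ := ih ((List.suffix_cons F l').trans hsuf) T₁
      (fun p hp => by
        rcases hmem p hp with h | ⟨h, h'⟩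
        · exact h1 p h
        · exact ⟨h ▸ hFl, h'⟩)
      (fun p hp F' hF' => by
        rcases hmem p hp with h | ⟨h, h'⟩
        · exact h2 p h F' (by simp [hF'])
        · rw [h]
          exact List.rel_of_pairwise_cons (hinv.sublist hsuf.sublist) hF')
      hmass
    refine ⟨T, hT1, hT2, hT3.trans ?_⟩
    have hpow : 0 ≤ (1 - ε) ^ l'.length := pow_nonneg (by linarith) _
    have := mul_le_mul_of_nonneg_left hunc hpow
    rw [List.length_cons, pow_succ]
    linarith

/-- Amenability provides lists of Følner sets each of which is almost invariant under the
inverses of the subsequent ones. -/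
theorem exists_folner_list {G : Type*} [Group G] (hG : AmenableF G) (K : Finset G) {ε ξ : ℝ}
    (hε : 0 < ε) (hξ : 0 < ξ) (n : ℕ) :
    ∃ l : List (Finset G), l.length = n ∧ (∀ F ∈ l, F ∈ FolnerSets K ε) ∧
      l.Pairwise fun F' F => (((F⁻¹ * F') \ F').card : ℝ) ≤ ξ * F'.card := by
  induction n with
  | zero => exact ⟨[], by simp⟩
  | succ n ih =>
    obtain ⟨l, hlen, hl, hpw⟩ := ih
    set K' : Finset G := K ∪ l.toFinset.biUnion fun F => F⁻¹ with hK'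
    obtain ⟨F', hne, hF'⟩ := hG K' (min ε ξ) (lt_min hε hξ)
    have hmono : ∀ K'' ⊆ K', (((K'' * F') \ F').card : ℝ) ≤ ((K' * F') \ F').card := fun K'' h => by
      exact_mod_cast Finset.card_le_card
        (Finset.sdiff_subset_sdiff (Finset.mul_subset_mul_right h) le_rfl)
    have hcard : (0 : ℝ) ≤ F'.card := Nat.cast_nonneg _
    refine ⟨F' :: l, by simp [hlen], ?_, List.pairwise_cons.2 ⟨fun F hF => ?_, hpw⟩⟩
    · intro F hF
      rcases List.mem_cons.1 hF with rfl | hF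
      · refine ⟨hne, (hmono K Finset.subset_union_left).trans_lt (hF'.trans_le ?_)⟩
        exact mul_le_mul_of_nonneg_right (min_le_left _ _) hcard
      · exact hl F hF
    · refine (hmono F⁻¹ ?_).trans (hF'.le.trans
        (mul_le_mul_of_nonneg_right (min_le_right _ _) hcard))
      exact (Finset.subset_biUnion_of_mem (fun F : Finset G => F⁻¹)
        (List.mem_toFinset.2 hF)).trans Finset.subset_union_right

/-- The points at which `σ` is multiplicative and free on `E`. -/
noncomputable def goodPoints {G : Type*} [Group G] (E : Finset G) {d : ℕ}
    (σ : G → Equiv.Perm (Fin d)) : Finset (Fin d) :=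
  Finset.univ.filter fun a => ∀ s ∈ E, ∀ t ∈ E,
    σ s (σ t a) = σ (s * t) a ∧ (s ≠ t → σ s a ≠ σ t a)

theorem SoficApprox.eventually_card_goodPoints_compl_le {G : Type*} [Group G]
    (Sap : SoficApprox G) (E : Finset G) {κ : ℝ} (hκ : 0 < κ) :
    ∀ᶠ i in atTop, ((goodPoints E (Sap.σ i))ᶜ.card : ℝ) ≤ κ * Sap.d i := by
  set η : ℝ := κ / (2 * ((E.card : ℝ) ^ 2 + 1)) with hη
  have hη0 : 0 < η := by positivity
  have hηκ : (E.card : ℝ) ^ 2 * (2 * η) ≤ κ := by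
    have : 2 * ((E.card : ℝ) ^ 2 + 1) * η = κ := by rw [hη]; field_simp
    nlinarith
  have hmul : ∀ᶠ i in atTop, ∀ s ∈ E, ∀ t ∈ E, (1 - η) * Sap.d i ≤
      (Finset.univ.filter fun a => Sap.σ i s (Sap.σ i t a) = Sap.σ i (s * t) a).card := by
    refine (E.eventually_all).2 fun s _ => (E.eventually_all).2 fun t _ => ?_
    filter_upwards [(Sap.approx_mul s t).eventually (lt_mem_nhds (show 1 - η < 1 by linarith)),
      Sap.d_tendsto.eventually_gt_atTop 0] with i hi hd
    have hd' : (0 : ℝ) < Sap.d i := by exact_mod_cast hd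
    exact ((lt_div_iff₀ hd').1 hi).le
  have hsep : ∀ᶠ i in atTop, ∀ s ∈ E, ∀ t ∈ E, s ≠ t →
      ((Finset.univ.filter fun a => Sap.σ i s a = Sap.σ i t a).card : ℝ) ≤ η * Sap.d i := by
    refine (E.eventually_all).2 fun s _ => (E.eventually_all).2 fun t _ => ?_
    rw [eventually_imp_distrib_left]
    intro hst
    filter_upwards [(Sap.approx_sep s t hst).eventually (gt_mem_nhds hη0),
      Sap.d_tendsto.eventually_gt_atTop 0] with i hi hd
    have hd' : (0 : ℝ) < Sap.d i := by exact_mod_cast hd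
    exact ((div_lt_iff₀ hd').1 hi).le
  filter_upwards [hmul, hsep] with i hm hs
  set P : G × G → Finset (Fin (Sap.d i)) := fun p =>
    (Finset.univ.filter fun a => ¬ Sap.σ i p.1 (Sap.σ i p.2 a) = Sap.σ i (p.1 * p.2) a) ∪
    (Finset.univ.filter fun a => p.1 ≠ p.2 ∧ Sap.σ i p.1 a = Sap.σ i p.2 a) with hP
  have hPcard : ∀ p ∈ E ×ˢ E, ((P p).card : ℝ) ≤ 2 * η * Sap.d i := by
    rintro ⟨s, t⟩ hp
    obtain ⟨hsE, htE⟩ := Finset.mem_product.1 hp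
    have h1 := hm s hsE t htE
    have h2 := Finset.card_filter_add_card_filter_not
      (s := (Finset.univ : Finset (Fin (Sap.d i))))
      fun a => Sap.σ i s (Sap.σ i t a) = Sap.σ i (s * t) a
    rw [Finset.card_univ, Fintype.card_fin] at h2
    have h3 : ((Finset.univ.filter fun a =>
        s ≠ t ∧ Sap.σ i s a = Sap.σ i t a).card : ℝ) ≤ η * Sap.d i := by
      by_cases hst : s = t
      · simp only [hst, ne_eq, not_true, false_and, Finset.filter_false, Finset.card_empty,
          Nat.cast_zero]
        positivity
      · simpa [hst] using hs s hsE t htE hst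
    have h4 := Finset.card_union_le
      (Finset.univ.filter fun a => ¬ Sap.σ i s (Sap.σ i t a) = Sap.σ i (s * t) a)
      (Finset.univ.filter fun a => s ≠ t ∧ Sap.σ i s a = Sap.σ i t a)
    rify at h2 h4
    simp only [hP]
    linarith
  have hsub : (goodPoints E (Sap.σ i))ᶜ ⊆ (E ×ˢ E).biUnion P := by
    intro a ha
    simp only [goodPoints, Finset.mem_compl, Finset.mem_filter, Finset.mem_univ, true_and,
      not_forall] at ha
    obtain ⟨s, hs, t, ht, hst⟩ := ha
    refine Finset.mem_biUnion.2 ⟨(s, t), Finset.mk_mem_product hs ht, ?_⟩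
    simp only [hP, Finset.mem_union, Finset.mem_filter, Finset.mem_univ, true_and]
    tauto
  have hcard : ((goodPoints E (Sap.σ i))ᶜ.card : ℝ) ≤ ∑ p ∈ E ×ˢ E, ((P p).card : ℝ) := by
    exact_mod_cast (Finset.card_le_card hsub).trans Finset.card_biUnion_le
  calc _ ≤ _ := hcard
    _ ≤ (E ×ˢ E).card • (2 * η * Sap.d i) := Finset.sum_le_card_nsmul _ _ _ hPcard
    _ = (E.card : ℝ) ^ 2 * (2 * η) * Sap.d i := by
      rw [nsmul_eq_mul, Finset.card_product]; push_cast; ring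
    _ ≤ κ * Sap.d i := mul_le_mul_of_nonneg_right hηκ (Nat.cast_nonneg _)

/-- Chebyshev's inequality for approximately equivariant maps. -/
theorem card_far_mul_le {G X : Type*} [Group G] [TopologicalSpace X] [MulAction G X]
    {ρ : ContPseudoMetric X} {F : Finset G} {δ : ℝ} {d : ℕ} (hd : 0 < d)
    {σ : G → Equiv.Perm (Fin d)} {φ : Fin d → X} (hφ : φ ∈ MapSpace ρ F δ σ) {s : G} (hs : s ∈ F)
    {τ : ℝ} (hτ : 0 ≤ τ) :
    ((Finset.univ.filter fun c => τ < ρ.d (φ (σ s c)) (s • φ c)).card : ℝ) * τ ^ 2 ≤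
      δ ^ 2 * d := by
  have h1 := (Real.sqrt_le_iff.1 (hφ s hs)).2
  have hd' : (0 : ℝ) < d := by exact_mod_cast hd
  rw [one_div, inv_mul_le_iff₀ hd'] at h1
  calc _ = ∑ c ∈ Finset.univ.filter fun c => τ < ρ.d (φ (σ s c)) (s • φ c), τ ^ 2 := by
        rw [Finset.sum_const, nsmul_eq_mul]
    _ ≤ ∑ c ∈ Finset.univ.filter fun c => τ < ρ.d (φ (σ s c)) (s • φ c),
        (ρ.d (φ (σ s c)) (s • φ c)) ^ 2 :=
      Finset.sum_le_sum fun c hc => pow_le_pow_left₀ hτ (Finset.mem_filter.1 hc).2.le 2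
    _ ≤ ∑ c, (ρ.d (φ (σ s c)) (s • φ c)) ^ 2 :=
      Finset.sum_le_sum_of_subset_of_nonneg (Finset.filter_subset _ _) fun _ _ _ => sq_nonneg _
    _ ≤ _ := by linarith

theorem smul_mem_of_mem_coverJoin {G X : Type*} [Group G] [TopologicalSpace X] [MulAction G X]
    {𝒲 : Finset (Set X)} {F : Finset G} {V : Set X} (hV : V ∈ coverJoin 𝒲 F) {s : G}
    (hs : s ∈ F) : ∃ W ∈ 𝒲, ∀ x ∈ V, s • x ∈ W := by
  obtain ⟨f, hf, rfl⟩ := Finset.mem_image.1 hV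
  refine ⟨f s hs, Finset.mem_pi.1 hf s hs, fun x hx => ?_⟩
  simp only [Set.mem_iInter] at hx
  exact hx s hs

/-- A continuous cutoff function measuring how far `φ` is from being equivariant at a point of a
tile; it is identically `1` at uncovered points. -/
theorem exists_badness {G X : Type*} [Group G] [TopologicalSpace X] [MulAction G X]
    [ContinuousConstSMul G X] (ρ : ContPseudoMetric X) {τ : ℝ} (hτ : 0 < τ) {d : ℕ}
    (σ : G → Equiv.Perm (Fin d)) (T : Finset (Finset G × Fin d)) (a : Fin d) :
    ∃ b : (Fin d → X) → ℝ, Continuous b ∧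
      ((a ∉ tileUnion σ T ∧ ∀ φ, b φ = 1) ∨
        ∃ p : T, ∃ s ∈ p.1.1, σ s p.1.2 = a ∧
          (∀ φ, b φ < 1 → ρ.d (φ a) (s • φ p.1.2) < τ) ∧
          ∀ φ, 0 < b φ → τ / 2 < ρ.d (φ a) (s • φ p.1.2)) := by
  by_cases ha : a ∈ tileUnion σ T
  · obtain ⟨p, hp, s, hs, hsa⟩ := mem_tileUnion.1 ha
    refine ⟨fun φ => max 0 (2 * ρ.d (φ a) (s • φ p.2) / τ - 1), ?_,
      Or.inr ⟨⟨p, hp⟩, s, hs, hsa, fun φ hφ => ?_, fun φ hφ => ?_⟩⟩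
    · have : Continuous fun φ : Fin d → X => ρ.d (φ a) (s • φ p.2) :=
        ρ.continuous'.comp (f := fun φ : Fin d → X => (φ a, s • φ p.2))
          ((continuous_apply a).prodMk ((continuous_apply p.2).const_smul s))
      fun_prop
    · have h1 := (le_max_right _ _).trans_lt hφ
      have h2 : 2 * ρ.d (φ a) (s • φ p.2) / τ < 2 := by linarith
      rw [div_lt_iff₀ hτ] at h2
      linarith
    · have h1 : 0 < 2 * ρ.d (φ a) (s • φ p.2) / τ - 1 := by
        rcases lt_max_iff.1 hφ with h | h
        · exact absurd h (lt_irrefl _)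
        · exact h
      have h2 : 1 < 2 * ρ.d (φ a) (s • φ p.2) / τ := by linarith
      rw [lt_div_iff₀ hτ] at h2
      linarith
  · exact ⟨fun _ => 1, continuous_const, Or.inl ⟨ha, fun _ => rfl⟩⟩

/-- A quasi-tiling of `[d]` bounds the dimension of the space of approximately equivariant maps
relative to the product cover. -/
theorem coverDMap_le_of_tiles {G X : Type*} [Group G] [TopologicalSpace X] [NormalSpace X]
    [MulAction G X] [ContinuousConstSMul G X] (ρ : ContPseudoMetric X)
    {𝒰 𝒲 : Finset (Set X)} (h𝒰 : IsFinOpenCover 𝒰) {τ : ℝ} (hτ : 0 < τ)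
    (hexp : ∀ W ∈ 𝒲, ∃ U ∈ 𝒰, ∀ x ∈ W, ∀ y, ρ.d y x < τ → y ∈ U)
    {d : ℕ} (hd : 0 < d) (σ : G → Equiv.Perm (Fin d)) (Q : Finset G) (δ : ℝ)
    (T : Finset (Finset G × Fin d)) (hTQ : ∀ p ∈ T, p.1 ⊆ Q) {r : ℝ}
    (hr : ∀ p ∈ T, ∃ 𝒱 : Finset (Set X), IsFinOpenCover 𝒱 ∧ Refines 𝒱 (coverJoin 𝒲 p.1) ∧
      ∀ x, ((𝒱.filter fun V => x ∈ V).card : ℝ) ≤ r * p.1.card + 1)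
    (N : ℕ) (hN : r * ∑ p ∈ T, (p.1.card : ℝ) + (𝒰.card + 1) *
      ((tileUnion σ T)ᶜ.card + Q.card * (δ ^ 2 * d / (τ / 2) ^ 2)) < N + 1) :
    coverDMap 𝒰 ρ Q δ σ ≤ ((N : ℝ) : EReal) := by
  choose 𝒱 h𝒱cov h𝒱ref h𝒱ord using fun p : T => hr p.1 p.2
  choose g hgc hgsupp hgone using fun p : T => exists_bump (h𝒱cov p)
  obtain ⟨h, hhc, hhsupp, hhone⟩ := exists_bump h𝒰
  choose b hbc hb using exists_badness ρ hτ σ T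
  set f : (Σ p : T, 𝒱 p) ⊕ (Fin d × Option 𝒰) → MapSpace ρ Q δ σ → ℝ := fun i φ =>
    match i with
    | .inl ⟨p, V⟩ => g p V (φ.1 p.1.2)
    | .inr (a, none) => b a φ.1
    | .inr (a, some U) => min (b a φ.1) (h U (φ.1 a)) with hf
  refine coverD_le_of_thresholds f ?_ N (fun φ => ?_) _ fun t ht0 ht1 φ₀ _ => ?_
  · rintro (⟨p, V⟩ | ⟨a, _ | U⟩)
    · exact (hgc p V).comp ((continuous_apply _).comp continuous_subtype_val)
    · exact (hbc a).comp continuous_subtype_val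
    · exact ((hbc a).comp continuous_subtype_val).min
        ((hhc U).comp ((continuous_apply _).comp continuous_subtype_val))
  · suffices hcard : ((Finset.univ.filter fun i => 0 < f i φ ∧ f i φ < 1).card : ℝ) < N + 1 by
      exact Nat.lt_succ_iff.1 (by exact_mod_cast hcard)
    refine lt_of_le_of_lt ?_ hN
    rw [Finset.card_filter, Fintype.sum_sum_type, Fintype.sum_sigma, Fintype.sum_prod_type]
    push_cast
    refine add_le_add ?_ ?_
    · rw [Finset.mul_sum, ← Finset.sum_coe_sort T]
      refine Finset.sum_le_sum fun p _ => ?_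
      have h1 := card_intermediate_le (g p) (hgsupp p) (hgone p) (φ.1 p.1.2)
      have h2 := h𝒱ord p (φ.1 p.1.2)
      rify at h1
      simp only [hf]
      rw [Finset.sum_boole]
      linarith
    · set B : Finset (Fin d) := Finset.univ.filter fun a => 0 < b a φ.1 with hB
      have h1 : ∀ a, ∑ o : Option 𝒰, (if 0 < f (.inr (a, o)) φ ∧ f (.inr (a, o)) φ < 1 then
          (1 : ℝ) else 0) ≤ if 0 < b a φ.1 then (𝒰.card : ℝ) + 1 else 0 := by
        intro a
        split_ifs with hba
        · calc _ ≤ ∑ _o : Option 𝒰, (1 : ℝ) :=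
                Finset.sum_le_sum fun o _ => by split_ifs <;> simp
            _ = _ := by simp
        · refine (Finset.sum_eq_zero fun o _ => if_neg fun hcon => hba ?_).le
          rcases o with _ | U
          · exact hcon.1
          · exact (lt_min_iff.1 hcon.1).1
      have h2 : B ⊆ (tileUnion σ T)ᶜ ∪ Q.biUnion fun s => (Finset.univ.filter fun c =>
          τ / 2 < ρ.d (φ.1 (σ s c)) (s • φ.1 c)).image (σ s) := by
        intro a ha
        rcases hb a with ⟨hun, -⟩ | ⟨p, s, hs, hsa, -, hfar⟩
        · exact Finset.mem_union_left _ (Finset.mem_compl.2 hun)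
        · refine Finset.mem_union_right _ (Finset.mem_biUnion.2 ⟨s, hTQ p.1 p.2 hs,
            Finset.mem_image.2 ⟨p.1.2, ?_, hsa⟩⟩)
          rw [Finset.mem_filter, hsa]
          exact ⟨Finset.mem_univ _, hfar φ.1 (Finset.mem_filter.1 ha).2⟩
      have h3 : ((Q.biUnion fun s => (Finset.univ.filter fun c =>
          τ / 2 < ρ.d (φ.1 (σ s c)) (s • φ.1 c)).image (σ s)).card : ℝ) ≤
          Q.card * (δ ^ 2 * d / (τ / 2) ^ 2) := by
        refine (Nat.cast_le.2 Finset.card_biUnion_le).trans ?_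
        push_cast
        rw [← nsmul_eq_mul]
        refine Finset.sum_le_card_nsmul _ _ _ fun s hs => ?_
        refine (Nat.cast_le.2 Finset.card_image_le).trans ?_
        rw [le_div_iff₀ (by positivity)]
        exact card_far_mul_le hd φ.2 hs (by positivity)
      have h4 := (Finset.card_le_card h2).trans (Finset.card_union_le _ _)
      rify at h4
      calc _ ≤ ∑ a, if 0 < b a φ.1 then (𝒰.card : ℝ) + 1 else 0 :=
            Finset.sum_le_sum fun a _ => h1 a
        _ = (𝒰.card + 1) * B.card := by
            rw [← Finset.sum_filter, Finset.sum_const, nsmul_eq_mul, mul_comm]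
        _ ≤ _ := mul_le_mul_of_nonneg_left (by linarith) (by positivity)
  · have hpt : ∀ a, ∃ U ∈ 𝒰, ∀ φ : MapSpace ρ Q δ σ, (∀ i, f i φ ≠ t) →
        (∀ i, t < f i φ ↔ t < f i φ₀) → φ.1 a ∈ U := by
      intro a
      by_cases hba : t < b a φ₀.1
      · obtain ⟨U, hU⟩ := hhone (φ₀.1 a)
        refine ⟨U.1, U.2, fun φ _ hφ => hhsupp U _ (ht0.trans ?_)⟩
        exact (lt_min_iff.1 ((hφ (.inr (a, some U))).2 (lt_min hba (by rw [hU]; exact ht1)))).2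
      · rcases hb a with ⟨-, hone⟩ | ⟨p, s, hs, -, hclose, -⟩
        · exact absurd ht1 (by rwa [hone] at hba)
        · obtain ⟨V, hV⟩ := hgone p (φ₀.1 p.1.2)
          obtain ⟨V', hV', hVV'⟩ := h𝒱ref p V.1 V.2
          obtain ⟨W, hW, hVW⟩ := smul_mem_of_mem_coverJoin hV' hs
          obtain ⟨U, hU, hWU⟩ := hexp W hW
          refine ⟨U, hU, fun φ _ hφ => hWU _ (hVW _ (hVV' ?_)) _ (hclose φ.1 ?_)⟩
          · refine hgsupp p V _ (ht0.trans ((hφ (.inl ⟨p, V⟩)).2 ?_))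
            simp only [hf, hV, ht1]
          · exact (not_lt.1 fun hlt => hba ((hφ (.inr (a, none))).1 hlt)).trans_lt ht1
    choose U hU hUmem using hpt
    refine ⟨_, Finset.mem_image.2 ⟨{φ | ∀ a, φ a ∈ U a}, Finset.mem_image.2
      ⟨U, Fintype.mem_piFinset.2 hU, rfl⟩, rfl⟩, fun φ h1 h2 => ?_⟩
    exact fun a => hUmem a φ h1 h2

/-- Quasi-tilings by the shapes of a list bound the dimension of the space of approximately
equivariant maps over a good sofic approximation. -/
theorem coverDMap_le_of_list {G X : Type*} [Group G] [TopologicalSpace X] [NormalSpace X]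
    [MulAction G X] [ContinuousConstSMul G X] (ρ : ContPseudoMetric X)
    {𝒰 𝒲 : Finset (Set X)} (h𝒰 : IsFinOpenCover 𝒰) {τ : ℝ} (hτ : 0 < τ)
    (hexp : ∀ W ∈ 𝒲, ∃ U ∈ 𝒰, ∀ x ∈ W, ∀ y, ρ.d y x < τ → y ∈ U)
    {d : ℕ} (hd : 0 < d) (σ : G → Equiv.Perm (Fin d)) (Q : Finset G) {r z ε κ δ : ℝ}
    (hr0 : 0 ≤ r) (hε0 : 0 < ε) (hε1 : ε ≤ 1 / 2) (hεr : 2 * r * ε ≤ (z - r) / 2) (hκ0 : 0 < κ)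
    (hAκ : 8 * (((𝒰.card : ℝ) + 1) * κ) = z - r) (l : List (Finset G))
    (hm : (1 - ε) ^ l.length < κ) (hne : ∀ F ∈ l, F.Nonempty) (hQsub : ∀ F ∈ l, F ⊆ Q)
    (hpw : l.Pairwise fun F' F => (((F⁻¹ * F') \ F').card : ℝ) ≤ κ / 2 * F'.card)
    (hcov : ∀ F ∈ l, ∃ 𝒱 : Finset (Set X), IsFinOpenCover 𝒱 ∧ Refines 𝒱 (coverJoin 𝒲 F) ∧
      ∀ x, ((𝒱.filter fun V => x ∈ V).card : ℝ) ≤ r * F.card + 1)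
    (hδ : Q.card * (δ ^ 2 / (τ / 2) ^ 2) ≤ κ)
    (hgood : ((goodPoints (Q ∪ Q⁻¹ * Q) σ)ᶜ.card : ℝ) ≤ κ * d) :
    coverDMap 𝒰 ρ Q δ σ ≤ ((z * d : ℝ) : EReal) := by
  set E : Finset G := Q ∪ Q⁻¹ * Q with hE
  set A : ℝ := 𝒰.card + 1 with hA
  have hA0 : 0 < A := by positivity
  have hd' : (0 : ℝ) < d := by exact_mod_cast hd
  have hgp : ∀ c ∈ goodPoints E σ, ∀ s ∈ E, ∀ t ∈ E,
      σ s (σ t c) = σ (s * t) c ∧ (s ≠ t → σ s c ≠ σ t c) := fun c hc =>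
    (Finset.mem_filter.1 hc).2
  obtain ⟨T, hT, hmass, hunc⟩ := exists_tiles σ (goodPoints E σ) hε0 hε1 (half_pos hκ0).le l
    (fun F hF => hne F hF)
    (fun F hF c hc s hs t ht hst => by
      by_contra hne
      exact (hgp c hc s (Finset.mem_union_left _ (hQsub F hF hs)) t
        (Finset.mem_union_left _ (hQsub F hF ht))).2 hne hst)
    (fun F hF F' hF' c hc s hs t ht => by
      have := (hgp c hc s (Finset.mem_union_left _ (hQsub F hF hs)) (s⁻¹ * t)
        (Finset.mem_union_right _ (Finset.mul_mem_mul (Finset.inv_mem_inv (hQsub F hF hs))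
          (hQsub F' hF' ht)))).1
      rwa [mul_inv_cancel_left] at this)
    hpw
  rw [Fintype.card_fin] at hunc
  set M : ℝ := ∑ p ∈ T, (p.1.card : ℝ) with hM
  have hM0 : 0 ≤ M := Finset.sum_nonneg fun _ _ => Nat.cast_nonneg _
  have hMd : M ≤ (1 + 2 * ε) * d := by
    have h1 : ((tileUnion σ T).card : ℝ) ≤ d := by
      have := Finset.card_le_univ (tileUnion σ T)
      rw [Fintype.card_fin] at this
      exact_mod_cast this
    have h2 : (1 - ε) * M ≤ d := hmass.trans h1
    have h3 : (1 + 2 * ε) * ((1 - ε) * M) ≤ (1 + 2 * ε) * d :=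
      mul_le_mul_of_nonneg_left h2 (by linarith)
    nlinarith [mul_nonneg (mul_nonneg hε0.le (by linarith : 0 ≤ 1 - 2 * ε)) hM0]
  have huncd : ((tileUnion σ T)ᶜ.card : ℝ) ≤ 3 * κ * d := by
    have := mul_le_mul_of_nonneg_right hm.le hd'.le
    linarith
  have hfar : Q.card * (δ ^ 2 * d / (τ / 2) ^ 2) ≤ κ * d := by
    calc _ = Q.card * (δ ^ 2 / (τ / 2) ^ 2) * d := by ring
      _ ≤ _ := mul_le_mul_of_nonneg_right hδ hd'.le
  set x : ℝ := r * M + A * ((tileUnion σ T)ᶜ.card + Q.card * (δ ^ 2 * d / (τ / 2) ^ 2)) with hx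
  have hx0 : 0 ≤ x := add_nonneg (mul_nonneg hr0 hM0) (mul_nonneg hA0.le
    (add_nonneg (Nat.cast_nonneg _) (mul_nonneg (Nat.cast_nonneg _) (by positivity))))
  have hxz : x ≤ z * d := by
    have h1 : r * M ≤ r * ((1 + 2 * ε) * d) := mul_le_mul_of_nonneg_left hMd hr0
    have h2 : A * ((tileUnion σ T)ᶜ.card + Q.card * (δ ^ 2 * d / (τ / 2) ^ 2)) ≤
        A * (4 * κ * d) := mul_le_mul_of_nonneg_left (by linarith) hA0.le
    have h3 := mul_le_mul_of_nonneg_right hεr hd'.le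
    have h4 : 8 * (A * κ) * d = (z - r) * d := by rw [hAκ]
    linarith
  refine le_trans (b := ((⌊x⌋₊ : ℝ) : EReal))
    (coverDMap_le_of_tiles ρ h𝒰 hτ hexp hd σ Q δ T (fun p hp => hQsub _ (hT p hp).1)
      (fun p hp => hcov p.1 (hT p hp).1) _ (Nat.lt_floor_add_one x)) ?_
  exact_mod_cast (Nat.floor_le hx0).trans hxz

theorem DSigmaU_le_of_real_bound {G : Type*} [Group G] (hG : AmenableF G) (Sap : SoficApprox G)
    {X : Type*} [TopologicalSpace X] [NormalSpace X] [Nonempty X] [MulAction G X]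
    [ContinuousConstSMul G X] (ρ : ContPseudoMetric X)
    {𝒰 𝒲 : Finset (Set X)} (h𝒰 : IsFinOpenCover 𝒰) {τ : ℝ} (hτ : 0 < τ)
    (hexp : ∀ W ∈ 𝒲, ∃ U ∈ 𝒰, ∀ x ∈ W, ∀ y, ρ.d y x < τ → y ∈ U)
    (K : Finset G) {ε₀ : ℝ} (hε₀ : 0 < ε₀) {r z : ℝ} (hrz : r < z)
    (hr : ∀ F ∈ FolnerSets K ε₀,
      coverD (coverJoin 𝒲 F) * ((F.card : ℝ)⁻¹ : EReal) < (r : EReal)) :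
    DSigmaU Sap 𝒰 ρ ≤ (z : EReal) := by
  have hcov : ∀ F ∈ FolnerSets K ε₀, ∃ 𝒱 : Finset (Set X), IsFinOpenCover 𝒱 ∧
      Refines 𝒱 (coverJoin 𝒲 F) ∧
      ∀ x, ((𝒱.filter fun V => x ∈ V).card : ℝ) ≤ r * F.card + 1 := by
    intro F hF
    have hFpos : (0 : ℝ) < F.card := by exact_mod_cast hF.1.card_pos
    have hlt : coverD (coverJoin 𝒲 F) < ((r * F.card : ℝ) : EReal) := by
      by_contra! hcon
      refine absurd (hr F hF) (not_lt.2 ?_)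
      calc (r : EReal) = ((r * F.card : ℝ) : EReal) * ((F.card : ℝ)⁻¹ : EReal) := by
            rw [← EReal.coe_inv, ← EReal.coe_mul, mul_assoc, mul_inv_cancel₀ hFpos.ne', mul_one]
        _ ≤ _ := mul_le_mul_of_nonneg_right hcon (by
            rw [← EReal.coe_inv]; exact_mod_cast (inv_pos.2 hFpos).le)
    simp only [coverD, iInf_lt_iff] at hlt
    obtain ⟨𝒱, ⟨h1, h2⟩, h3⟩ := hlt
    exact ⟨𝒱, h1, h2, fun x => card_filter_le_of_coverOrd_lt h3 x⟩
  have hr0 : 0 ≤ r := by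
    obtain ⟨F, hF⟩ := hG K ε₀ hε₀
    obtain ⟨𝒱, h1, -, h3⟩ := hcov F hF
    obtain ⟨x⟩ := ‹Nonempty X›
    have hFpos : (0 : ℝ) < F.card := by exact_mod_cast hF.1.card_pos
    obtain ⟨V, hV, hxV⟩ : ∃ V ∈ 𝒱, x ∈ V := by
      have := h1.2 ▸ Set.mem_univ x
      simpa using this
    have hone : (1 : ℝ) ≤ (𝒱.filter fun V => x ∈ V).card := by
      exact_mod_cast Finset.card_pos.2 ⟨V, Finset.mem_filter.2 ⟨hV, hxV⟩⟩
    exact nonneg_of_mul_nonneg_left (by linarith [h3 x]) hFpos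
  set A : ℝ := 𝒰.card + 1 with hA
  have hA0 : 0 < A := by positivity
  set κ : ℝ := (z - r) / (8 * A) with hκ
  have hκ0 : 0 < κ := div_pos (by linarith) (by positivity)
  have hAκ : 8 * (A * κ) = z - r := by rw [hκ]; field_simp
  obtain ⟨ε, hε0, hε1, hεr⟩ : ∃ ε : ℝ, 0 < ε ∧ ε ≤ 1 / 2 ∧ 2 * r * ε ≤ (z - r) / 2 := by
    refine ⟨min (1 / 2) ((z - r) / (4 * (r + 1))),
      lt_min (by norm_num) (div_pos (by linarith) (by positivity)), min_le_left _ _, ?_⟩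
    have h1 := min_le_right (1 / 2) ((z - r) / (4 * (r + 1)))
    rw [le_div_iff₀ (by positivity)] at h1
    have h2 : 0 < min (1 / 2) ((z - r) / (4 * (r + 1))) :=
      lt_min (by norm_num) (div_pos (by linarith) (by positivity))
    nlinarith
  obtain ⟨m, hm⟩ := exists_pow_lt_of_lt_one hκ0 (by linarith : 1 - ε < 1)
  obtain ⟨l, hlen, hl, hpw⟩ := exists_folner_list hG K hε₀ (half_pos hκ0) m
  set Q : Finset G := insert 1 (l.toFinset.biUnion id) with hQ
  have hQsub : ∀ F ∈ l, F ⊆ Q := fun F hF =>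
    (Finset.subset_biUnion_of_mem id (List.mem_toFinset.2 hF)).trans (Finset.subset_insert _ _)
  have hQpos : (0 : ℝ) < Q.card := by
    exact_mod_cast Finset.card_pos.2 ⟨1, Finset.mem_insert_self _ _⟩
  obtain ⟨δ, hδ0, hδ⟩ : ∃ δ : ℝ, 0 < δ ∧ Q.card * (δ ^ 2 / (τ / 2) ^ 2) ≤ κ := by
    refine ⟨Real.sqrt (κ * (τ / 2) ^ 2 / Q.card), Real.sqrt_pos.2 (by positivity), ?_⟩
    rw [Real.sq_sqrt (by positivity)]
    refine le_of_eq ?_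
    field_simp
  refine (iInf_le_of_le ⟨Q, ⟨1, Finset.mem_insert_self _ _⟩⟩ (iInf_le_of_le ⟨δ, hδ0⟩ ?_))
  refine limsup_le_of_le (by isBoundedDefault) ?_
  filter_upwards [Sap.eventually_card_goodPoints_compl_le (Q ∪ Q⁻¹ * Q) hκ0,
    Sap.d_tendsto.eventually_gt_atTop 0] with i hgood hd
  have hd' : (0 : ℝ) < Sap.d i := by exact_mod_cast hd
  have hbound := coverDMap_le_of_list ρ h𝒰 hτ hexp hd (Sap.σ i) Q hr0 hε0 hε1 hεr hκ0 hAκ l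
    (hlen ▸ hm) (fun F hF => (hl F hF).1) hQsub hpw (fun F hF => hcov F (hl F hF)) hδ hgood
  calc coverDMap 𝒰 ρ Q δ (Sap.σ i) * ((Sap.d i : ℝ)⁻¹ : EReal)
      ≤ ((z * Sap.d i : ℝ) : EReal) * ((Sap.d i : ℝ)⁻¹ : EReal) := by
        refine mul_le_mul_of_nonneg_right hbound ?_
        rw [← EReal.coe_inv]
        exact_mod_cast (inv_pos.2 hd').le
    _ = (z : EReal) := by
        rw [← EReal.coe_inv, ← EReal.coe_mul, mul_assoc, mul_inv_cancel₀ hd'.ne', mul_one]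

theorem DSigmaU_eq_bot_of_isEmpty {G : Type*} [Group G] (Sap : SoficApprox G)
    {X : Type*} [TopologicalSpace X] [IsEmpty X] [MulAction G X] (ρ : ContPseudoMetric X)
    (𝒰 : Finset (Set X)) : DSigmaU Sap 𝒰 ρ = ⊥ := by
  refine le_bot_iff.1 (iInf_le_of_le ⟨{1}, Finset.singleton_nonempty _⟩
    (iInf_le_of_le ⟨1, one_pos⟩ (limsup_le_of_le (by isBoundedDefault) ?_)))
  filter_upwards [Sap.d_tendsto.eventually_gt_atTop 0] with i hd
  have : Nonempty (Fin (Sap.d i)) := ⟨⟨0, hd⟩⟩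
  have hd' : (0 : ℝ) < Sap.d i := by exact_mod_cast hd
  rw [coverDMap, coverD_eq_bot_of_isEmpty, ← EReal.coe_inv,
    EReal.bot_mul_coe_of_pos (inv_pos.2 hd')]

/-- For a continuous action of a countable amenable group on a compact metrizable
space, `mdim_Σ(X) ≤ mdim(X)`. -/
theorem mdimSigma_le_mdim {G : Type*} [Group G] [Countable G]
    (hG : AmenableF G) (Sap : SoficApprox G)
    {X : Type*} [TopologicalSpace X] [CompactSpace X] [MetrizableSpace X]
    [MulAction G X] [ContinuousConstSMul G X]
    (ρ : ContPseudoMetric X) (hρ : ρ.IsCompatMetric) :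
    mdimSigma Sap ρ ≤ mdimIS G X := by
  refine iSup₂_le fun 𝒰 h𝒰 => ?_
  rcases isEmpty_or_nonempty X with hX | hX
  · rw [DSigmaU_eq_bot_of_isEmpty]
    exact bot_le
  obtain ⟨𝒲, τ, h𝒲, hτ, hexp⟩ := exists_cover_expand ρ hρ h𝒰
  refine le_iSup₂_of_le 𝒲 h𝒲 (le_iInf fun K => le_iInf fun ε₀ => ?_)
  refine EReal.le_of_forall_lt_iff_le.1 fun z hz => ?_
  obtain ⟨r, hr, hrz⟩ := EReal.lt_iff_exists_real_btwn.1 hz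
  refine DSigmaU_le_of_real_bound hG Sap ρ h𝒰 hτ hexp K ε₀.2 (EReal.coe_lt_coe_iff.1 hrz)
    fun F hF => lt_of_le_of_lt ?_ hr
  exact le_iSup₂_of_le F hF le_rfl

end SoficMD
end

section
/- Let a finite group G act continuously on a compact metrizable space X of finite covering dimension, and let Σ be a sofic approximation sequence for G. Then mdim_Σ(X) ≤ (1/|G|)·inf_{m∈ℕ} dim(X^m)/m, where X^m is the m-fold product of X. -/
open Filter Topology TopologicalSpace
open scoped ENat
open scoped Classical Pointwise

open Filter Topology TopologicalSpace
open scoped ENat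
open scoped Classical Pointwise

namespace SoficMD

universe u

/-- There is a colouring of order `f` inside `𝒮`: `k` colours, each of them a finite disjoint
family of open sets belonging to `𝒮`, such that every point `y` is missed by at most `f y` colours. -/
def HasColoringOf {Y : Type u} [TopologicalSpace Y] (𝒮 : Set (Set Y)) (f : Y → ℕ) (k : ℕ) : Prop :=
  ∃ (ι : Type u) (_ : Finite ι) (V : Fin k → ι → Set Y),
    (∀ j i, IsOpen (V j i)) ∧ (∀ j i, V j i ∈ 𝒮) ∧
    (∀ j i i' y, y ∈ V j i → y ∈ V j i' → i = i') ∧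
    ∀ y, (Finset.univ.filter fun j => ∀ i, y ∉ V j i).card ≤ f y

/-- Colourings of order `f` inside `𝒮` exist for every number of colours. -/
def HasColoring {Y : Type u} [TopologicalSpace Y] (𝒮 : Set (Set Y)) (f : Y → ℕ) : Prop :=
  ∀ k, HasColoringOf 𝒮 f k

/-- The sets contained in some member of `𝒰`. -/
def subordinateSets {Y : Type*} (𝒰 : Set (Set Y)) : Set (Set Y) :=
  {V | ∃ U ∈ 𝒰, V ⊆ U}

lemma isLowerSet_subordinateSets {Y : Type*} (𝒰 : Set (Set Y)) :
    IsLowerSet (subordinateSets 𝒰) := by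
  rintro V W hWV ⟨U, hU, hVU⟩
  exact ⟨U, hU, hWV.trans hVU⟩

lemma HasColoring.mono {Y : Type u} [TopologicalSpace Y] {𝒮 𝒯 : Set (Set Y)} {f g : Y → ℕ}
    (h : HasColoring 𝒮 f) (h𝒮 : 𝒮 ⊆ 𝒯) (hfg : ∀ y, f y ≤ g y) : HasColoring 𝒯 g := by
  intro k
  obtain ⟨ι, hι, V, ho, hs, hd, hc⟩ := h k
  exact ⟨ι, hι, V, ho, fun j i => h𝒮 (hs j i), hd, fun y => (hc y).trans (hfg y)⟩

lemma hasColoring_univ {Y : Type u} [TopologicalSpace Y] :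
    HasColoring (Set.univ : Set (Set Y)) (fun _ => 0) := by
  intro k
  refine ⟨PUnit, inferInstance, fun _ _ => Set.univ, fun _ _ => isOpen_univ,
    fun _ _ => Set.mem_univ _, fun _ _ _ _ _ _ => rfl, fun y => ?_⟩
  simp

lemma HasColoring.inter {Y : Type u} [TopologicalSpace Y] {𝒮 𝒯 : Set (Set Y)} {f g : Y → ℕ}
    (h : HasColoring 𝒮 f) (h' : HasColoring 𝒯 g) (h𝒮 : IsLowerSet 𝒮) (h𝒯 : IsLowerSet 𝒯) :
    HasColoring (𝒮 ∩ 𝒯) (fun y => f y + g y) := by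
  intro k
  obtain ⟨ι, hι, V, ho, hs, hd, hc⟩ := h k
  obtain ⟨κ, hκ, W, ho', hs', hd', hc'⟩ := h' k
  refine ⟨ι × κ, inferInstance, fun j p => V j p.1 ∩ W j p.2, fun j p => (ho _ _).inter (ho' _ _),
    fun j p => ⟨h𝒮 Set.inter_subset_left (hs j p.1), h𝒯 Set.inter_subset_right (hs' j p.2)⟩,
    fun j p q y hp hq => Prod.ext (hd _ _ _ _ hp.1 hq.1) (hd' _ _ _ _ hp.2 hq.2), fun y => ?_⟩
  refine le_trans (Finset.card_le_card ?_)
    ((Finset.card_union_le _ _).trans (Nat.add_le_add (hc y) (hc' y)))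
  intro j hj
  simp only [Finset.mem_union, Finset.mem_filter, Finset.mem_univ, true_and] at hj ⊢
  by_contra! hcon
  obtain ⟨⟨i, hi⟩, i', hi'⟩ := hcon
  exact hj (i, i') ⟨hi, hi'⟩

lemma hasColoring_biInter {Y : Type u} [TopologicalSpace Y] {κ : Type*} (s : Finset κ)
    {𝒮 : κ → Set (Set Y)} {f : κ → Y → ℕ} (h : ∀ i ∈ s, HasColoring (𝒮 i) (f i))
    (h𝒮 : ∀ i, IsLowerSet (𝒮 i)) :
    HasColoring (⋂ i ∈ s, 𝒮 i) (fun y => ∑ i ∈ s, f i y) := by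
  induction s using Finset.induction_on with
  | empty => simpa using hasColoring_univ
  | insert a s ha ih =>
    simp only [Finset.set_biInter_insert, Finset.sum_insert ha]
    exact (h a (Finset.mem_insert_self a s)).inter
      (ih fun i hi => h i (Finset.mem_insert_of_mem hi)) (h𝒮 a)
      (isLowerSet_iInter₂ fun i _ => h𝒮 i)

lemma HasColoring.comap {Y Z : Type u} [TopologicalSpace Y] [TopologicalSpace Z]
    {𝒰 : Set (Set Z)} {f : Z → ℕ} (h : HasColoring (subordinateSets 𝒰) f) {g : Y → Z}
    (hg : Continuous g) : HasColoring {V | ∃ U ∈ 𝒰, V ⊆ g ⁻¹' U} (fun y => f (g y)) := by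
  intro k
  obtain ⟨ι, hι, V, ho, hs, hd, hc⟩ := h k
  refine ⟨ι, hι, fun j i => g ⁻¹' V j i, fun j i => (ho j i).preimage hg, fun j i => ?_,
    fun j i i' y => hd j i i' (g y), fun y => hc (g y)⟩
  obtain ⟨U, hU, hVU⟩ := hs j i
  exact ⟨U, hU, Set.preimage_mono hVU⟩

/-- A colouring may be neglected where a continuous function is small. -/
lemma HasColoring.threshold {Y : Type u} [TopologicalSpace Y] {𝒮 : Set (Set Y)} {f : Y → ℕ}
    (h : HasColoring 𝒮 f) (h𝒮 : IsLowerSet 𝒮) {t : Y → ℝ} (ht : Continuous t) {τ : ℝ}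
    (hτ : 0 < τ) :
    HasColoring {V | (∀ y ∈ V, t y < τ) ∨ V ∈ 𝒮} (fun y => if t y < τ / 2 then 0 else f y + 1) := by
  intro k
  obtain ⟨ι, hι, V, ho, hs, hd, hc⟩ := h k
  set θ : Fin k → ℝ := fun j => τ - τ / ((j : ℕ) + 2) with hθ
  have hθτ (j) : θ j < τ := by
    have : 0 < τ / ((j : ℕ) + 2 : ℝ) := by positivity
    simp only [hθ]; linarith
  have hτθ (j) : τ / 2 ≤ θ j := by
    have : τ / ((j : ℕ) + 2 : ℝ) ≤ τ / 2 := by gcongr; linarith [Nat.cast_nonneg (α := ℝ) (j : ℕ)]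
    simp only [hθ]; linarith
  have hinj : Function.Injective θ := by
    intro i j hij
    have h1 : τ / ((i : ℕ) + 2 : ℝ) = τ / ((j : ℕ) + 2) := by simp only [hθ] at hij; linarith
    rw [div_eq_div_iff (by positivity) (by positivity)] at h1
    have h2 := mul_left_cancel₀ hτ.ne' h1
    exact Fin.ext (by exact_mod_cast (add_right_cancel h2).symm)
  refine ⟨Option ι, inferInstance,
    fun j o => o.elim {y | t y < θ j} (fun i => {y | θ j < t y} ∩ V j i), ?_, ?_, ?_, ?_⟩
  · rintro j (_ | i)
    · exact isOpen_lt ht continuous_const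
    · exact (isOpen_lt continuous_const ht).inter (ho j i)
  · rintro j (_ | i)
    · exact Or.inl fun y (hy : t y < θ j) => hy.trans (hθτ j)
    · exact Or.inr (h𝒮 Set.inter_subset_right (hs j i))
  · rintro j (_ | i) (_ | i') y hy hy'
    · rfl
    · exact absurd (show θ j < t y from hy'.1) (lt_asymm (show t y < θ j from hy))
    · exact absurd (show θ j < t y from hy.1) (lt_asymm (show t y < θ j from hy'))
    · exact congrArg some (hd j i i' y hy.2 hy'.2)
  · intro y
    beta_reduce
    split_ifs with hy
    · rw [Nat.le_zero, Finset.card_eq_zero, Finset.filter_eq_empty_iff]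
      exact fun j _ hj => hj none (hy.trans_le (hτθ j))
    · have h1 : (Finset.univ.filter fun j => t y = θ j).card ≤ 1 := by
        refine Finset.card_le_one.2 fun i hi j hj => hinj ?_
        simp only [Finset.mem_filter, Finset.mem_univ, true_and] at hi hj
        rw [← hi, ← hj]
      refine le_trans (Finset.card_le_card ?_)
        ((Finset.card_union_le _ _).trans (Nat.add_le_add (hc y) h1))
      intro j hj
      simp only [Finset.mem_union, Finset.mem_filter, Finset.mem_univ, true_and] at hj ⊢
      by_contra! hcon
      obtain ⟨⟨i, hi⟩, hne⟩ := hcon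
      rcases hne.lt_or_gt with hlt | hgt
      · exact hj none hlt
      · exact hj (some i) ⟨hgt, hi⟩

lemma exists_isClosed_subset_card_le {Y : Type*} [TopologicalSpace Y] [NormalSpace Y] {k n : ℕ}
    {U : Fin k → Set Y} (hU : ∀ j, IsOpen (U j))
    (hc : ∀ y, (Finset.univ.filter fun j => y ∉ U j).card ≤ n) :
    ∃ E : Fin k → Set Y, (∀ j, IsClosed (E j)) ∧ (∀ j, E j ⊆ U j) ∧
      ∀ y, (Finset.univ.filter fun j => y ∉ E j).card ≤ n := by
  have key (T : Finset (Fin k)) : ∃ F : Fin k → Set Y, (∀ j, IsClosed (F j)) ∧ (∀ j, F j ⊆ U j) ∧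
      (n < T.card → ∀ y, ∃ j ∈ T, y ∈ F j) := by
    by_cases hT : n < T.card
    · obtain ⟨F, hF, hFc, hFU⟩ := exists_subset_iUnion_closed_subset
        (u := fun j => if j ∈ T then U j else ∅) isClosed_univ
        (fun j => by split_ifs; exacts [hU j, isOpen_empty]) (fun _ _ => Set.toFinite _)
        (fun y _ => by
          obtain ⟨j, hjT, hj⟩ := Finset.exists_mem_notMem_of_card_lt_card ((hc y).trans_lt hT)
          refine Set.mem_iUnion.2 ⟨j, ?_⟩
          simpa [hjT] using hj)
      refine ⟨F, hFc, fun j => (hFU j).trans ?_, fun _ y => ?_⟩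
      · split_ifs
        exacts [subset_rfl, Set.empty_subset _]
      · obtain ⟨j, hj⟩ := Set.mem_iUnion.1 (hF (Set.mem_univ y))
        refine ⟨j, ?_, hj⟩
        by_contra hjT
        simpa [hjT] using hFU j hj
    · exact ⟨fun _ => ∅, fun _ => isClosed_empty, fun _ => Set.empty_subset _, fun h => absurd h hT⟩
  choose F hFc hFU hF using key
  refine ⟨fun j => ⋃ T, F T j, fun j => isClosed_iUnion_of_finite fun T => hFc T j,
    fun j => Set.iUnion_subset fun T => hFU T j, fun y => ?_⟩
  by_contra! hlt
  obtain ⟨j, hj, hjF⟩ := hF _ hlt y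
  exact (Finset.mem_filter.1 hj).2 (Set.mem_iUnion.2 ⟨_, hjF⟩)

lemma HasColoringOf.succ {Y : Type u} [TopologicalSpace Y] [NormalSpace Y] {𝒮 : Set (Set Y)}
    (h𝒮 : IsLowerSet 𝒮) (hempty : ∅ ∈ 𝒮) {n k : ℕ} (hnk : n < k) (h : HasColoringOf 𝒮 (fun _ => n) k) :
    HasColoringOf 𝒮 (fun _ => n) (k + 1) := by
  obtain ⟨ι, hι, V, ho, hs, hd, hc⟩ := h
  obtain ⟨E, hEc, hEV, hE⟩ := exists_isClosed_subset_card_le (U := fun j => ⋃ i, V j i)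
    (fun j => isOpen_iUnion (ho j)) (by simpa using hc)
  have hcompl (P : Fin k → Prop) : (Finset.univ.filter P).card +
      (Finset.univ.filter fun j => ¬ P j).card = k := by
    simpa using Finset.card_filter_add_card_filter_not (s := (Finset.univ : Finset (Fin k))) P
  set W : (Fin k → Option ι) → Set Y := fun p =>
    {y | (Finset.univ.filter fun j => p j ≠ none).card = k - n ∧
      ∀ j, (p j = none → y ∉ E j) ∧ ∀ i, p j = some i → y ∈ V j i} with hW
  have hWE {p y} (hy : y ∈ W p) (j) : p j ≠ none ↔ y ∈ E j := by
    have hsub : (Finset.univ.filter fun j => y ∈ E j) ⊆ Finset.univ.filter fun j => p j ≠ none := by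
      intro j hj
      simp only [Finset.mem_filter, Finset.mem_univ, true_and] at hj ⊢
      exact fun h0 => (hy.2 j).1 h0 hj
    have heq := Finset.eq_of_subset_of_card_le hsub (by
      have h1 := hcompl fun j => y ∈ E j
      have h2 := hE y
      have h3 := hy.1
      omega)
    have := Finset.ext_iff.1 heq j
    simpa using this.symm
  have hWo (p) : IsOpen (W p) := by
    refine isOpen_const.inter ?_
    have : {y | ∀ j, (p j = none → y ∉ E j) ∧ ∀ i, p j = some i → y ∈ V j i} =
        ⋂ j, {y | (p j = none → y ∉ E j) ∧ ∀ i, p j = some i → y ∈ V j i} := by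
      ext; simp
    change IsOpen {y | ∀ j, (p j = none → y ∉ E j) ∧ ∀ i, p j = some i → y ∈ V j i}
    rw [this]
    refine isOpen_iInter_of_finite fun j => ?_
    cases hp : p j with
    | none => simpa [Set.compl_def] using (hEc j).isOpen_compl
    | some i => simpa using ho j i
  have hW𝒮 (p) : W p ∈ 𝒮 := by
    by_cases hp : (Finset.univ.filter fun j => p j ≠ none).card = k - n
    · obtain ⟨j, hj⟩ := Finset.card_pos.1 (hp ▸ Nat.sub_pos_of_lt hnk)
      obtain ⟨i, hi⟩ := Option.ne_none_iff_exists'.1 (Finset.mem_filter.1 hj).2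
      exact h𝒮 (fun y hy => (hy.2 j).2 i hi) (hs j i)
    · exact h𝒮 (fun y hy => absurd hy.1 hp) hempty
  refine ⟨ι ⊕ (Fin k → Option ι), inferInstance,
    Fin.cons (Sum.elim (fun _ => ∅) W) (fun j => Sum.elim (V j) (fun _ => ∅)), ?_, ?_, ?_, ?_⟩
  · intro j
    cases j using Fin.cases with
    | zero => rintro (i | p); exacts [isOpen_empty, hWo p]
    | succ j => rintro (i | p); exacts [ho j i, isOpen_empty]
  · intro j
    cases j using Fin.cases with
    | zero => rintro (i | p); exacts [hempty, hW𝒮 p]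
    | succ j => rintro (i | p); exacts [hs j i, hempty]
  · intro j
    cases j using Fin.cases with
    | zero =>
      rintro (i | p) (i' | q) y hy hy'
      · exact hy.elim
      · exact hy.elim
      · exact hy'.elim
      · refine congrArg Sum.inr (funext fun j => ?_)
        have hp := hWE (p := p) hy j
        have hq := hWE (p := q) hy' j
        cases hpj : p j with
        | none =>
          cases hqj : q j with
          | none => rfl
          | some i => simp_all
        | some i =>
          cases hqj : q j with
          | none => simp_all
          | some i' => exact congrArg some (hd j i i' y ((hy.2 j).2 i hpj) ((hy'.2 j).2 i' hqj))
    | succ j =>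
      rintro (i | p) (i' | q) y hy hy'
      · exact congrArg Sum.inl (hd j i i' y hy hy')
      · exact hy'.elim
      · exact hy.elim
      · exact hy.elim
  · intro y
    have hsucc : (Finset.univ.filter fun j : Fin k => ∀ i, y ∉ (Fin.cons
        (Sum.elim (fun _ => ∅) W) (fun j => Sum.elim (V j) (fun _ => ∅)) :
          Fin (k + 1) → ι ⊕ (Fin k → Option ι) → Set Y) j.succ i) =
        Finset.univ.filter fun j => ∀ i, y ∉ V j i := by
      ext j; simp
    rw [Fin.card_filter_univ_succ, hsucc]
    split_ifs with h0
    · by_contra! hlt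
      have hEq : ∀ j, (∃ i, y ∈ V j i) ↔ y ∈ E j := by
        have hsub : (Finset.univ.filter fun j => ∀ i, y ∉ V j i) ⊆
            Finset.univ.filter fun j => y ∉ E j := by
          intro j hj
          simp only [Finset.mem_filter, Finset.mem_univ, true_and] at hj ⊢
          intro hy
          obtain ⟨i, hi⟩ := Set.mem_iUnion.1 (hEV j hy)
          exact hj i hi
        have heq := Finset.eq_of_subset_of_card_le hsub (by have := hE y; omega)
        intro j
        have := Finset.ext_iff.1 heq j
        simp only [Finset.mem_filter, Finset.mem_univ, true_and] at this
        rw [← not_iff_not, ← this]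
        simp
      have hp (j) : ∃ o : Option ι, (o = none ↔ y ∉ E j) ∧ ∀ i, o = some i → y ∈ V j i := by
        by_cases hj : y ∈ E j
        · obtain ⟨i, hi⟩ := (hEq j).2 hj
          exact ⟨some i, by simp [hj], by rintro i' ⟨⟩; exact hi⟩
        · exact ⟨none, by simp [hj], by simp⟩
      choose p hp hpV using hp
      refine h0 (Sum.inr p) ⟨?_, fun j => ⟨(hp j).1, hpV j⟩⟩
      have h1 := hcompl fun j => ∀ i, y ∉ V j i
      have h2 : (Finset.univ.filter fun j => p j ≠ none) =
          Finset.univ.filter fun j => ¬ ∀ i, y ∉ V j i := by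
        ext j
        simp [hp, hEq]
      have h3 : _ ≤ n := hc y
      rw [h2]
      omega
    · exact hc y

lemma hasColoringOf_of_card_le {Y : Type u} [TopologicalSpace Y] [NormalSpace Y]
    [ParacompactSpace Y] {𝒮 : Set (Set Y)} (h𝒮 : IsLowerSet 𝒮) (hempty : ∅ ∈ 𝒮) {n : ℕ}
    {𝒱 : Finset (Set Y)} (h𝒱 : IsFinOpenCover 𝒱) (hs : ∀ V ∈ 𝒱, V ∈ 𝒮)
    (hc : ∀ y, (𝒱.filter fun V => y ∈ V).card ≤ n + 1) :
    HasColoringOf 𝒮 (fun _ => n) (n + 1) := by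
  obtain ⟨f, hf⟩ := PartitionOfUnity.exists_isSubordinate (isClosed_univ (X := Y))
    (fun V : 𝒱 => (V : Set Y)) (fun V => h𝒱.1 V V.2) (by rw [← h𝒱.2]; simp [Set.subset_def])
  have hfV {V : 𝒱} {y} (h : 0 < f V y) : y ∈ (V : Set Y) :=
    hf V (subset_tsupport _ (Function.mem_support.2 h.ne'))
  refine ⟨Finset 𝒱, inferInstance, fun j S => {y | S.card = j + 1 ∧
    ∀ V ∈ S, 0 < f V y ∧ ∀ V' ∉ S, f V' y < f V y}, fun j S => ?_, fun j S => ?_, ?_, fun y => ?_⟩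
  · refine isOpen_const.inter ?_
    have : {y | ∀ V ∈ S, 0 < f V y ∧ ∀ V' ∉ S, f V' y < f V y} =
        ⋂ V ∈ S, ({y | 0 < f V y} ∩ ⋂ V' ∈ Sᶜ, {y | f V' y < f V y}) := by
      ext; simp
    change IsOpen {y | ∀ V ∈ S, 0 < f V y ∧ ∀ V' ∉ S, f V' y < f V y}
    rw [this]
    exact isOpen_biInter_finset fun V _ => (isOpen_lt continuous_const (f V).continuous).inter
      (isOpen_biInter_finset fun V' _ => isOpen_lt (f V').continuous (f V).continuous)
  · by_cases hS : S.card = j + 1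
    · obtain ⟨V, hV⟩ := Finset.card_pos.1 (show 0 < S.card by omega)
      exact h𝒮 (fun y hy => hfV (hy.2 V hV).1) (hs V V.2)
    · exact h𝒮 (fun y hy => absurd hy.1 hS) hempty
  · rintro j S T y ⟨hS, hS'⟩ ⟨hT, hT'⟩
    by_contra hne
    have hcard : S.card = T.card := hS.trans hT.symm
    obtain ⟨V, hVS, hVT⟩ := Finset.not_subset.1
      fun h => hne (Finset.eq_of_subset_of_card_le h hcard.ge)
    obtain ⟨W, hWT, hWS⟩ := Finset.not_subset.1
      fun h => hne (Finset.eq_of_subset_of_card_le h hcard.le).symm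
    exact lt_asymm ((hS' V hVS).2 W hWS) ((hT' W hWT).2 V hVT)
  · set S : Finset 𝒱 := Finset.univ.filter fun V => 0 < f V y with hS
    have hpos : 0 < S.card := by
      obtain ⟨V, hV⟩ := f.exists_pos (Set.mem_univ y)
      exact Finset.card_pos.2 ⟨V, by simp [hS, hV]⟩
    have hle : S.card ≤ n + 1 := by
      refine le_trans ?_ (hc y)
      rw [← Finset.card_map (Function.Embedding.subtype _)]
      refine Finset.card_le_card fun V hV => ?_
      simp only [hS, Finset.mem_map, Finset.mem_filter, Finset.mem_univ, true_and] at hV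
      obtain ⟨V, hV, rfl⟩ := hV
      exact Finset.mem_filter.2 ⟨V.2, hfV hV⟩
    have hlt : (Finset.univ.filter fun j : Fin (n + 1) => ∀ T : Finset 𝒱, y ∉ {y | T.card = j + 1 ∧
        ∀ V ∈ T, 0 < f V y ∧ ∀ V' ∉ T, f V' y < f V y}).card < Fintype.card (Fin (n + 1)) := by
      refine Finset.card_lt_univ_of_notMem (x := ⟨S.card - 1, by omega⟩) fun hmem => ?_
      refine (Finset.mem_filter.1 hmem).2 S ⟨by simp; omega, fun V hV => ?_⟩
      have hV0 : 0 < f V y := by simpa [hS] using hV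
      refine ⟨hV0, fun V' hV' => lt_of_le_of_lt ?_ hV0⟩
      simpa [hS] using hV'
    rw [Fintype.card_fin] at hlt
    exact Nat.lt_succ_iff.1 hlt

/-- Every finite open cover of a normal space of covering dimension `n` is refined by colourings
of order `n` with arbitrarily many colours. -/
lemma hasColoring_of_covDim_eq {Y : Type u} [TopologicalSpace Y] [NormalSpace Y]
    [ParacompactSpace Y] {n : ℕ} (hn : covDim Y = n) {𝒰 : Finset (Set Y)}
    (h𝒰 : IsFinOpenCover 𝒰) : HasColoring (subordinateSets (𝒰 : Set (Set Y))) (fun _ => n) := by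
  have hmem := csInf_mem (s := {n : ℕ∞ | ∀ 𝒰 : Finset (Set Y), IsFinOpenCover 𝒰 →
    ∃ 𝒱 : Finset (Set Y), IsFinOpenCover 𝒱 ∧ Refines 𝒱 𝒰 ∧
      ∀ y : Y, (((𝒱.filter fun V => y ∈ V).card : ℕ∞)) ≤ n + 1})
    ⟨⊤, fun 𝒰 h => ⟨𝒰, h, fun V hV => ⟨V, hV, subset_rfl⟩, fun y => by simp⟩⟩
  change covDim Y ∈ _ at hmem
  rw [hn] at hmem
  obtain ⟨𝒱, h𝒱, href, hc⟩ := hmem 𝒰 h𝒰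
  rcases 𝒰.eq_empty_or_nonempty with rfl | ⟨U, hU⟩
  · have hY : IsEmpty Y := by
      rw [← Set.univ_eq_empty_iff, ← h𝒰.2]; simp
    exact fun k => ⟨PEmpty, inferInstance, fun _ => PEmpty.elim, fun _ => nofun, fun _ => nofun,
      fun _ => nofun, isEmptyElim⟩
  have hlow := isLowerSet_subordinateSets (𝒰 : Set (Set Y))
  have hempty : ∅ ∈ subordinateSets (𝒰 : Set (Set Y)) := ⟨U, hU, Set.empty_subset U⟩
  have hbase := hasColoringOf_of_card_le hlow hempty h𝒱 href (n := n)
    (fun y => by exact_mod_cast hc y)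
  intro k
  rcases le_or_gt k n with hk | hk
  · refine ⟨PEmpty, inferInstance, fun _ => PEmpty.elim, fun _ => nofun, fun _ => nofun,
      fun _ => nofun, fun y => (Finset.card_le_univ _).trans (by simpa using hk)⟩
  · induction k, hk using Nat.le_induction with
    | base => exact hbase
    | succ k hk ih => exact ih.succ hlow hempty hk

lemma coverD_le_of_hasColoring {Y : Type u} [TopologicalSpace Y] {𝒰 : Finset (Set Y)} {n : ℕ}
    (h : HasColoring (subordinateSets (𝒰 : Set (Set Y))) (fun _ => n)) :
    coverD 𝒰 ≤ ((n : ℝ) : EReal) := by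
  obtain ⟨ι, hι, V, ho, hs, hd, hc⟩ := h (n + 1)
  have hcov (y) : ∃ j i, y ∈ V j i := by
    by_contra! hy
    have hle : _ ≤ n := hc y
    rw [Finset.filter_true_of_mem fun j _ => hy j, Finset.card_univ, Fintype.card_fin] at hle
    omega
  have := Fintype.ofFinite ι
  set 𝒱 : Finset (Set Y) := Finset.univ.image fun p : Fin (n + 1) × ι => V p.1 p.2 with h𝒱
  refine iInf₂_le_of_le 𝒱 ⟨⟨?_, ?_⟩, ?_⟩ ?_
  · simp only [h𝒱, Finset.mem_image, Finset.mem_univ, true_and]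
    rintro _ ⟨p, rfl⟩
    exact ho _ _
  · refine Set.eq_univ_of_forall fun y => ?_
    obtain ⟨j, i, hi⟩ := hcov y
    exact Set.mem_biUnion (Finset.mem_image_of_mem _ (Finset.mem_univ (j, i))) hi
  · intro W hW
    simp only [h𝒱, Finset.mem_image, Finset.mem_univ, true_and] at hW
    obtain ⟨p, rfl⟩ := hW
    exact hs _ _
  · have hsup : (⨆ y : Y, (((𝒱.filter fun U => y ∈ U).card : ℝ) : EReal)) ≤ ((n + 1 : ℝ) : EReal) := by
      refine iSup_le fun y => EReal.coe_le_coe_iff.2 ?_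
      have hsub : (𝒱.filter fun U => y ∈ U) ⊆
          (Finset.univ.filter fun p : Fin (n + 1) × ι => y ∈ V p.1 p.2).image
            fun p => V p.1 p.2 := by
        intro W hW
        simp only [h𝒱, Finset.mem_filter, Finset.mem_image, Finset.mem_univ, true_and] at hW ⊢
        obtain ⟨⟨p, rfl⟩, hy⟩ := hW
        exact ⟨p, hy, rfl⟩
      have hcard : (Finset.univ.filter fun p : Fin (n + 1) × ι => y ∈ V p.1 p.2).card ≤
          (Finset.univ : Finset (Fin (n + 1))).card := by
        refine Finset.card_le_card_of_injOn Prod.fst (fun _ _ => Finset.mem_coe.2 (Finset.mem_univ _)) ?_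
        rintro ⟨j, i⟩ hp ⟨j', i'⟩ hq (rfl : j = j')
        simp only [Finset.coe_filter, Finset.mem_univ, true_and, Set.mem_ofPred_eq] at hp hq
        rw [hd j i i' y hp hq]
      have := ((Finset.card_le_card hsub).trans Finset.card_image_le).trans hcard
      rw [Finset.card_univ, Fintype.card_fin] at this
      exact_mod_cast this
    calc coverOrd 𝒱 ≤ ((n + 1 : ℝ) : EReal) - 1 := EReal.sub_le_sub hsup le_rfl
      _ = ((n : ℝ) : EReal) := by
        rw [← EReal.coe_one, ← EReal.coe_sub, add_sub_cancel_right]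

lemma ContPseudoMetric.exists_ball_subset {X : Type*} [TopologicalSpace X] [CompactSpace X]
    {ρ : ContPseudoMetric X} (hρ : ρ.IsCompatMetric) {U : Set X} (hU : IsOpen U) {x : X}
    (hx : x ∈ U) : ∃ r > 0, ∀ y, ρ.d y x < r → y ∈ U := by
  rcases Uᶜ.eq_empty_or_nonempty with h | h
  · exact ⟨1, one_pos, fun y _ => by simp [Set.compl_empty_iff.1 h]⟩
  have hcont : Continuous fun y => ρ.d y x :=
    ρ.continuous'.comp (continuous_id.prodMk continuous_const)
  obtain ⟨z, hz, hmin⟩ := hU.isClosed_compl.isCompact.exists_isMinOn h hcont.continuousOn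
  refine ⟨ρ.d z x, lt_of_le_of_ne (ρ.nonneg z x) fun h0 => hz (hρ z x h0.symm ▸ hx), fun y hy => ?_⟩
  by_contra hyU
  exact not_lt.2 (hmin hyU) hy

lemma exists_isFinOpenCover_smul {G : Type*} [Group G] [Fintype G] {X : Type*} [TopologicalSpace X]
    [CompactSpace X] [MulAction G X] [ContinuousConstSMul G X] {ρ : ContPseudoMetric X}
    (hρ : ρ.IsCompatMetric) {𝒰 : Finset (Set X)} (h𝒰 : IsFinOpenCover 𝒰) :
    ∃ τ > 0, ∃ 𝒱 : Finset (Set X), IsFinOpenCover 𝒱 ∧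
      ∀ V ∈ 𝒱, ∀ s : G, ∃ U ∈ 𝒰, ∀ x ∈ V, ∀ y, ρ.d y (s • x) < τ → y ∈ U := by
  have hloc (x : X) : ∃ r > 0, ∀ s : G, ∃ U ∈ 𝒰, ∀ y, ρ.d y (s • x) < r + r → y ∈ U := by
    have hs (s : G) : ∃ r > 0, ∃ U ∈ 𝒰, ∀ y, ρ.d y (s • x) < r → y ∈ U := by
      obtain ⟨U, hU, hx⟩ := Set.mem_iUnion₂.1 (h𝒰.2.symm ▸ Set.mem_univ (s • x))
      obtain ⟨r, hr, h⟩ := ContPseudoMetric.exists_ball_subset hρ (h𝒰.1 U hU) hx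
      exact ⟨r, hr, U, hU, h⟩
    choose r hr U hU h using hs
    have hev : ∀ᶠ t in 𝓝[>] (0 : ℝ), ∀ s, t < r s / 2 :=
      eventually_all.2 fun s => nhdsWithin_le_nhds (eventually_lt_nhds (half_pos (hr s)))
    obtain ⟨t, ht, ht0⟩ := (hev.and self_mem_nhdsWithin).exists
    exact ⟨t, ht0, fun s => ⟨U s, hU s, fun y hy => h s y (by linarith [ht s])⟩⟩
  choose r hr hloc using hloc
  have hopen (x : X) : IsOpen {x' | ∀ s : G, ρ.d (s • x') (s • x) < r x} := by
    simp only [Set.ofPred_forall]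
    exact isOpen_iInter_of_finite fun s => isOpen_lt
      (ρ.continuous'.comp ((continuous_const_smul s).prodMk continuous_const)) continuous_const
  obtain ⟨t, ht⟩ := isCompact_univ.elim_finite_subcover _ hopen
    (fun x _ => Set.mem_iUnion.2 ⟨x, fun s => by rw [ρ.refl]; exact hr x⟩)
  have hev : ∀ᶠ τ in 𝓝[>] (0 : ℝ), ∀ x ∈ t, τ < r x :=
    (Finset.eventually_all t).2 fun x _ => nhdsWithin_le_nhds (eventually_lt_nhds (hr x))
  obtain ⟨τ, hτ, hτ0⟩ := (hev.and self_mem_nhdsWithin).exists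
  refine ⟨τ, hτ0, t.image fun x => {x' | ∀ s : G, ρ.d (s • x') (s • x) < r x}, ⟨?_, ?_⟩, ?_⟩
  · simp only [Finset.mem_image]
    rintro _ ⟨x, -, rfl⟩
    exact hopen x
  · rw [Finset.set_biUnion_finset_image]
    exact Set.univ_subset_iff.1 ht
  · simp only [Finset.mem_image]
    rintro _ ⟨x, hx, rfl⟩ s
    obtain ⟨U, hU, h⟩ := hloc x s
    refine ⟨U, hU, fun x' hx' y hy => h y ?_⟩
    have h1 := hx' s
    have h2 := ρ.triangle y (s • x') (s • x)
    have h3 := hτ x hx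
    linarith

/-- The points at which `σ` fails to be a free action. -/
noncomputable def badPoints {G : Type*} [Group G] {d : ℕ} (σ : G → Equiv.Perm (Fin d)) :
    Finset (Fin d) :=
  Finset.univ.filter fun a => ¬ ((∀ s t, σ s (σ t a) = σ (s * t) a) ∧ ∀ s t, σ s a = σ t a → s = t)

lemma exists_transversal {G : Type*} [Group G] [Fintype G] {d : ℕ} (σ : G → Equiv.Perm (Fin d)) :
    ∃ A : Finset (Fin d), A.card * Fintype.card G ≤ d ∧
      ∀ b ∉ badPoints σ, ∃ a ∈ A, ∃ s, σ s a = b := by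
  have hone {b} (hb : b ∉ badPoints σ) : σ 1 b = b := by
    simp only [badPoints, Finset.mem_filter, Finset.mem_univ, true_and, not_not] at hb
    simpa using hb.1 1 1
  set A := Finset.univ.filter fun a => a ∉ badPoints σ ∧ ∀ s, a ≤ σ s a with hA
  refine ⟨A, ?_, fun b hb => ?_⟩
  · have hcard : (A ×ˢ (Finset.univ : Finset G)).card ≤ (Finset.univ : Finset (Fin d)).card := by
      refine Finset.card_le_card_of_injOn (fun p => σ p.2 p.1)
        (fun _ _ => Finset.mem_coe.2 (Finset.mem_univ _)) ?_
      have key {a a' : Fin d} {s t : G} (ha : a ∈ A) (ha' : a' ∈ A) (h : σ s a = σ t a') :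
          a ≤ a' := by
        simp only [hA, Finset.mem_filter, Finset.mem_univ, true_and] at ha ha'
        have hb := ha.1
        have hb' := ha'.1
        simp only [badPoints, Finset.mem_filter, Finset.mem_univ, true_and, not_not] at hb hb'
        have h1 := congrArg (σ t⁻¹) h
        rw [hb.1, hb'.1, inv_mul_cancel, hone ha'.1] at h1
        exact h1 ▸ ha.2 _
      rintro ⟨a, s⟩ h ⟨a', t⟩ h' (heq : σ s a = σ t a')
      have ha : a ∈ A := (Finset.mem_product.1 h).1
      have ha' : a' ∈ A := (Finset.mem_product.1 h').1
      obtain rfl := le_antisymm (key ha ha' heq) (key ha' ha heq.symm)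
      simp only [hA, badPoints, Finset.mem_filter, Finset.mem_univ, true_and, not_not] at ha
      rw [ha.1.2 s t heq]
    simpa using hcard
  · have hb' := hb
    simp only [badPoints, Finset.mem_filter, Finset.mem_univ, true_and, not_not] at hb'
    obtain ⟨s, hs⟩ := Finite.exists_min fun s => σ s b
    refine ⟨σ s b, ?_, s⁻¹, by rw [hb'.1, inv_mul_cancel, hone hb]⟩
    simp only [hA, badPoints, Finset.mem_filter, Finset.mem_univ, true_and, not_not]
    refine ⟨⟨fun t u => ?_, fun t u h => ?_⟩, fun t => ?_⟩
    · rw [hb'.1, hb'.1, hb'.1, mul_assoc]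
    · rw [hb'.1, hb'.1] at h
      exact mul_right_cancel (hb'.2 _ _ h)
    · rw [hb'.1]
      exact hs _

lemma SoficApprox.tendsto_badPoints {G : Type*} [Group G] [Fintype G] (Sap : SoficApprox G) :
    Tendsto (fun i => ((badPoints (Sap.σ i)).card : ℝ) / Sap.d i) atTop (𝓝 0) := by
  set u : G × G → ℕ → ℝ := fun p i => ((Finset.univ.filter fun a : Fin (Sap.d i) =>
    ¬ Sap.σ i p.1 (Sap.σ i p.2 a) = Sap.σ i (p.1 * p.2) a).card : ℝ) / (Sap.d i : ℝ) with hu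
  set v : G × G → ℕ → ℝ := fun p i => ((Finset.univ.filter fun a : Fin (Sap.d i) =>
    p.1 ≠ p.2 ∧ Sap.σ i p.1 a = Sap.σ i p.2 a).card : ℝ) / (Sap.d i : ℝ) with hv
  have hu0 (p) : Tendsto (u p) atTop (𝓝 0) := by
    have h := (Sap.approx_mul p.1 p.2).const_sub 1
    rw [sub_self] at h
    refine h.congr' ?_
    filter_upwards [Sap.d_tendsto.eventually_gt_atTop 0] with i hi
    have hc := Finset.card_filter_add_card_filter_not (s := (Finset.univ : Finset (Fin (Sap.d i))))
      fun a => Sap.σ i p.1 (Sap.σ i p.2 a) = Sap.σ i (p.1 * p.2) a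
    rw [Finset.card_univ, Fintype.card_fin] at hc
    have hd : (Sap.d i : ℝ) ≠ 0 := by positivity
    simp only [hu]
    rw [eq_div_iff hd, sub_mul, div_mul_cancel₀ _ hd, one_mul, sub_eq_iff_eq_add, add_comm]
    exact_mod_cast hc.symm
  have hv0 (p) : Tendsto (v p) atTop (𝓝 0) := by
    by_cases hp : p.1 = p.2
    · simp [hv, hp]
    · simpa [hv, hp] using Sap.approx_sep p.1 p.2 hp
  have hsum : Tendsto (fun i => ∑ p, (u p i + v p i)) atTop (𝓝 0) := by
    simpa using tendsto_finsetSum Finset.univ fun p _ => (hu0 p).add (hv0 p)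
  refine squeeze_zero (fun i => by positivity) (fun i => ?_) hsum
  simp only [hu, hv, ← add_div, ← Finset.sum_div]
  refine div_le_div_of_nonneg_right ?_ (by positivity)
  have hsub : badPoints (Sap.σ i) ⊆ Finset.univ.biUnion fun p : G × G =>
      (Finset.univ.filter fun a => ¬ Sap.σ i p.1 (Sap.σ i p.2 a) = Sap.σ i (p.1 * p.2) a) ∪
      Finset.univ.filter fun a => p.1 ≠ p.2 ∧ Sap.σ i p.1 a = Sap.σ i p.2 a := by
    intro a ha
    simp only [badPoints, Finset.mem_filter, Finset.mem_univ, true_and, not_and_or, not_forall] at ha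
    simp only [Finset.mem_biUnion, Finset.mem_union, Finset.mem_filter, Finset.mem_univ, true_and]
    rcases ha with ⟨s, t, h⟩ | ⟨s, t, h, hne⟩
    · exact ⟨(s, t), Or.inl h⟩
    · exact ⟨(s, t), Or.inr ⟨hne, h⟩⟩
  have := (Finset.card_le_card hsub).trans (Finset.card_biUnion_le.trans
    (Finset.sum_le_sum fun p _ => Finset.card_union_le _ _))
  exact_mod_cast this

lemma card_filter_le_of_mem_mapSpace {G X : Type*} [Group G] [TopologicalSpace X] [MulAction G X]
    {ρ : ContPseudoMetric X} {F : Finset G} {δ : ℝ} (hδ : 0 ≤ δ) {d : ℕ}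
    {σ : G → Equiv.Perm (Fin d)} {φ : Fin d → X} (hφ : φ ∈ MapSpace ρ F δ σ) {s : G} (hs : s ∈ F)
    {τ : ℝ} (hτ : 0 < τ) :
    ((Finset.univ.filter fun a => τ ≤ ρ.d (φ (σ s a)) (s • φ a)).card : ℝ) ≤ δ ^ 2 * d / τ ^ 2 := by
  have h := (Real.sqrt_le_left hδ).1 (hφ s hs)
  rw [le_div_iff₀ (by positivity)]
  rcases Nat.eq_zero_or_pos d with rfl | hd
  · simp
  have hd' : (0 : ℝ) < d := by exact_mod_cast hd
  rw [one_div, inv_mul_le_iff₀ hd'] at h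
  rw [mul_comm (δ ^ 2)]
  refine le_trans ?_ h
  rw [← nsmul_eq_mul]
  refine le_trans (Finset.card_nsmul_le_sum _ (fun a => ρ.d (φ (σ s a)) (s • φ a) ^ 2) _ ?_)
    (Finset.sum_le_sum_of_subset_of_nonneg (Finset.filter_subset _ _) fun _ _ _ => sq_nonneg _)
  intro a ha
  exact pow_le_pow_left₀ hτ.le (Finset.mem_filter.1 ha).2 2

lemma isFinOpenCover_prodCover {X : Type*} [TopologicalSpace X] {𝒰 : Finset (Set X)}
    (h𝒰 : IsFinOpenCover 𝒰) (d : ℕ) : IsFinOpenCover (prodCover 𝒰 d) := by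
  refine ⟨fun W hW => ?_, Set.eq_univ_of_forall fun φ => ?_⟩
  · obtain ⟨U, hU, rfl⟩ := Finset.mem_image.1 hW
    simp only [Set.ofPred_forall]
    exact isOpen_iInter_of_finite fun a =>
      (h𝒰.1 _ (Fintype.mem_piFinset.1 hU a)).preimage (continuous_apply a)
  · have h (a) : ∃ U ∈ 𝒰, φ a ∈ U := by
      simpa using (h𝒰.2.symm ▸ Set.mem_univ (φ a) : φ a ∈ ⋃ U ∈ 𝒰, U)
    choose U hU hφ using h
    exact Set.mem_biUnion (Finset.mem_image_of_mem _ (Fintype.mem_piFinset.2 hU)) hφ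

lemma hasColoring_coordinates {Y X : Type u} [TopologicalSpace Y] [TopologicalSpace X]
    [CompactSpace X] [T2Space X] {κ : Type*} {g : Y → κ → X} (hg : Continuous g)
    {𝒰 : Finset (Set X)} (h𝒰 : IsFinOpenCover 𝒰) {n N m : ℕ} (hm : 0 < m) (hn : covDim X = n)
    (hN : covDim (Fin m → X) = N) (A : Finset κ) :
    ∃ q r, q * m + r = A.card ∧ r < m ∧
      HasColoring {V | ∀ a ∈ A, ∃ U ∈ 𝒰, V ⊆ {y | g y a ∈ U}} (fun _ => q * N + r * n) := by
  induction hA : A.card using Nat.strong_induction_on generalizing A with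
  | _ c ih =>
  have hlow (B : Finset κ) : IsLowerSet {V | ∀ a ∈ B, ∃ U ∈ 𝒰, V ⊆ {y | g y a ∈ U}} := by
    intro V W hWV hV a ha
    obtain ⟨U, hU, h⟩ := hV a ha
    exact ⟨U, hU, Set.Subset.trans hWV h⟩
  rcases lt_or_ge c m with hlt | hge
  · refine ⟨0, c, by simp, hlt, ?_⟩
    have h1 (a : κ) : HasColoring {V | ∃ U ∈ 𝒰, V ⊆ {y | g y a ∈ U}} (fun _ => n) :=
      (hasColoring_of_covDim_eq hn h𝒰).comap ((continuous_apply a).comp hg)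
    refine (hasColoring_biInter A (fun a _ => h1 a) fun a V W hWV ⟨U, hU, h⟩ =>
      ⟨U, hU, Set.Subset.trans hWV h⟩).mono ?_ ?_
    · intro V hV a ha
      exact Set.mem_iInter₂.1 hV a ha
    · intro y
      simp [hA]
  · obtain ⟨S, hSA, hS⟩ := Finset.exists_subset_card_eq (hA ▸ hge)
    have hcard := Finset.card_sdiff_add_card_eq_card hSA
    obtain ⟨q, r, hqr, hr, hcol⟩ := ih (A \ S).card (by omega) (A \ S) rfl
    refine ⟨q + 1, r, by rw [add_mul]; omega, hr, ?_⟩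
    set e := S.equivFinOfCardEq hS with he
    have hcont : Continuous fun y => fun j : Fin m => g y (e.symm j) :=
      continuous_pi fun j => (continuous_apply _).comp hg
    have h2 := (hasColoring_of_covDim_eq hN (isFinOpenCover_prodCover h𝒰 m)).comap hcont
    refine (h2.mono (𝒯 := {V | ∀ a ∈ S, ∃ U ∈ 𝒰, V ⊆ {y | g y a ∈ U}}) ?_
      (fun _ => le_rfl)).inter hcol (hlow _) (hlow _) |>.mono ?_ ?_
    · rintro V ⟨W, hW, hVW⟩ a ha
      obtain ⟨U, hU, rfl⟩ := Finset.mem_image.1 hW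
      refine ⟨U (e ⟨a, ha⟩), Fintype.mem_piFinset.1 hU _, fun y hy => ?_⟩
      simpa using hVW hy (e ⟨a, ha⟩)
    · rintro V ⟨hV, hV'⟩ a ha
      by_cases haS : a ∈ S
      · exact hV a haS
      · exact hV' a (Finset.mem_sdiff.2 ⟨ha, haS⟩)
    · intro y
      exact (by ring : N + (q * N + r * n) = (q + 1) * N + r * n).le

lemma coverDMap_le {G : Type*} [Group G] [Fintype G] {X : Type u} [TopologicalSpace X]
    [CompactSpace X] [T2Space X] [MulAction G X] [ContinuousConstSMul G X]
    {ρ : ContPseudoMetric X} {𝒰 𝒱 : Finset (Set X)} (h𝒰 : IsFinOpenCover 𝒰)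
    (h𝒱 : IsFinOpenCover 𝒱) {τ : ℝ} (hτ : 0 < τ)
    (h𝒱𝒰 : ∀ V ∈ 𝒱, ∀ s : G, ∃ U ∈ 𝒰, ∀ x ∈ V, ∀ y, ρ.d y (s • x) < τ → y ∈ U)
    {n N m : ℕ} (hm : 0 < m) (hn : covDim X = n) (hN : covDim (Fin m → X) = N)
    {δ : ℝ} (hδ : 0 ≤ δ) {d : ℕ} (σ : G → Equiv.Perm (Fin d)) :
    coverDMap 𝒰 ρ Finset.univ δ σ ≤
      (((d : ℝ) * (N / (m * Fintype.card G)) + m * n +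
        (n + 1) * (Fintype.card G * (δ ^ 2 * d / (τ / 2) ^ 2)) +
        n * (badPoints σ).card : ℝ) : EReal) := by
  obtain ⟨A, hAcard, hA⟩ := exists_transversal σ
  set Y := MapSpace ρ (Finset.univ : Finset G) δ σ
  have hrep (b : Fin d) : ∃ p : Fin d × G, b ∉ badPoints σ → p.1 ∈ A ∧ σ p.2 p.1 = b := by
    by_cases hb : b ∈ badPoints σ
    · exact ⟨(b, 1), fun h => absurd hb h⟩
    · obtain ⟨a, ha, s, hs⟩ := hA b hb
      exact ⟨(a, s), fun _ => ⟨ha, hs⟩⟩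
  choose p hp using hrep
  set t : Fin d → Y → ℝ := fun b φ => ρ.d (φ.1 b) ((p b).2 • φ.1 (p b).1) with ht
  have heval (b : Fin d) : Continuous fun φ : Y => φ.1 b :=
    (continuous_apply b).comp continuous_subtype_val
  have htc (b) : Continuous (t b) :=
    ρ.continuous'.comp ((heval b).prodMk ((heval (p b).1).const_smul (p b).2))
  set 𝒮 : Fin d → Set (Set Y) := fun b => {V | ∃ U ∈ 𝒰, V ⊆ {φ : Y | φ.1 b ∈ U}} with h𝒮
  have h𝒮low (b) : IsLowerSet (𝒮 b) := fun V W hWV ⟨U, hU, h⟩ =>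
    ⟨U, hU, Set.Subset.trans hWV h⟩
  have hcol (b) : HasColoring (𝒮 b) (fun _ => n) :=
    (hasColoring_of_covDim_eq hn h𝒰).comap (heval b)
  have hcol' (b) : HasColoring {V | (b ∉ badPoints σ ∧ ∀ φ ∈ V, t b φ < τ) ∨ V ∈ 𝒮 b}
      (fun φ => if b ∈ badPoints σ then n else if t b φ < τ / 2 then 0 else n + 1) := by
    by_cases hb : b ∈ badPoints σ
    · simpa [hb] using hcol b
    · simpa [hb] using (hcol b).threshold (h𝒮low b) (htc b) hτ
  have hlow' (b) : IsLowerSet {V | (b ∉ badPoints σ ∧ ∀ φ ∈ V, t b φ < τ) ∨ V ∈ 𝒮 b} := by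
    rintro V W hWV (⟨hb, h⟩ | h)
    · exact Or.inl ⟨hb, fun φ hφ => h φ (hWV hφ)⟩
    · exact Or.inr (h𝒮low b hWV h)
  obtain ⟨q, r, hqr, hr, hcolA⟩ := hasColoring_coordinates
    (g := fun φ : Y => φ.1) continuous_subtype_val h𝒱 hm hn hN A
  have hlowA : IsLowerSet {V | ∀ a ∈ A, ∃ U ∈ 𝒱, V ⊆ {φ : Y | φ.1 a ∈ U}} := by
    intro V W hWV hV a ha
    obtain ⟨U, hU, h⟩ := hV a ha
    exact ⟨U, hU, Set.Subset.trans hWV h⟩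
  set M : ℕ := ⌊Fintype.card G * (δ ^ 2 * d / (τ / 2) ^ 2)⌋₊ with hM
  have hcount (φ : Y) :
      (Finset.univ.filter fun b => b ∉ badPoints σ ∧ τ / 2 ≤ t b φ).card ≤ M := by
    refine Nat.le_floor ?_
    have hsub : (Finset.univ.filter fun b => b ∉ badPoints σ ∧ τ / 2 ≤ t b φ) ⊆
        Finset.univ.biUnion fun s : G => (Finset.univ.filter fun a =>
          τ / 2 ≤ ρ.d (φ.1 (σ s a)) (s • φ.1 a)).image (σ s) := by
      intro b hb
      obtain ⟨hb, hbt⟩ := (Finset.mem_filter.1 hb).2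
      refine Finset.mem_biUnion.2 ⟨(p b).2, Finset.mem_univ _, Finset.mem_image.2
        ⟨(p b).1, Finset.mem_filter.2 ⟨Finset.mem_univ _, ?_⟩, (hp b hb).2⟩⟩
      rw [(hp b hb).2]
      exact hbt
    have hle := (Finset.card_le_card hsub).trans (Finset.card_biUnion_le.trans
      (Finset.sum_le_sum fun s _ => Finset.card_image_le))
    calc _ ≤ ((∑ s : G, (Finset.univ.filter fun a =>
          τ / 2 ≤ ρ.d (φ.1 (σ s a)) (s • φ.1 a)).card : ℕ) : ℝ) := by exact_mod_cast hle
      _ ≤ ∑ s : G, δ ^ 2 * d / (τ / 2) ^ 2 := by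
        rw [Nat.cast_sum]
        exact Finset.sum_le_sum fun s hs =>
          card_filter_le_of_mem_mapSpace hδ φ.2 hs (half_pos hτ)
      _ = _ := by simp
  have hsum (φ : Y) : (∑ b, if b ∈ badPoints σ then n else if t b φ < τ / 2 then 0 else n + 1) ≤
      n * (badPoints σ).card + (n + 1) * M := by
    calc _ ≤ ∑ b, ((if b ∈ badPoints σ then n else 0) +
          if b ∉ badPoints σ ∧ τ / 2 ≤ t b φ then n + 1 else 0) := by
          refine Finset.sum_le_sum fun b _ => ?_
          by_cases hb : b ∈ badPoints σ
          · simp [hb]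
          · by_cases hbt : t b φ < τ / 2
            · simp [hb, hbt]
            · simp [hb, hbt, not_lt.1 hbt]
      _ = n * (badPoints σ).card + (n + 1) *
          (Finset.univ.filter fun b => b ∉ badPoints σ ∧ τ / 2 ≤ t b φ).card := by
          rw [Finset.sum_add_distrib, ← Finset.sum_filter, ← Finset.sum_filter, Finset.sum_const,
            Finset.sum_const, smul_eq_mul, smul_eq_mul, Finset.filter_univ_mem, mul_comm,
            mul_comm (n + 1)]
      _ ≤ _ := by gcongr; exact hcount φ
  have htotal : HasColoring (subordinateSets
      (restrictCover (prodCover 𝒰 d) Y : Set (Set Y)))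
      (fun _ => n * (badPoints σ).card + (n + 1) * M + (q * N + r * n)) := by
    refine ((hasColoring_biInter Finset.univ (fun b _ => hcol' b) hlow').inter hcolA
      (isLowerSet_iInter₂ fun b _ => hlow' b) hlowA).mono ?_
      (fun φ => Nat.add_le_add_right (hsum φ) _)
    rintro V ⟨hV, hVA⟩
    have hU (b) : ∃ U ∈ 𝒰, ∀ φ ∈ V, φ.1 b ∈ U := by
      rcases Set.mem_iInter₂.1 hV b (Finset.mem_univ b) with ⟨hb, h⟩ | ⟨U, hU, h⟩
      · obtain ⟨W, hW, hVW⟩ := hVA _ (hp b hb).1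
        obtain ⟨U, hU, hWU⟩ := h𝒱𝒰 W hW (p b).2
        exact ⟨U, hU, fun φ hφ => hWU _ (hVW hφ) _ (h φ hφ)⟩
      · exact ⟨U, hU, fun φ hφ => h hφ⟩
    choose U hU hVU using hU
    exact ⟨_, Finset.mem_coe.2 (Finset.mem_image_of_mem _ (Finset.mem_image_of_mem _
      (Fintype.mem_piFinset.2 hU))), fun φ hφ b => hVU b φ hφ⟩
  refine (coverD_le_of_hasColoring htotal).trans (EReal.coe_le_coe_iff.2 ?_)
  have hG : (0 : ℝ) < Fintype.card G := by exact_mod_cast Fintype.card_pos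
  have hm' : (0 : ℝ) < m := by exact_mod_cast hm
  have hMle : (M : ℝ) ≤ Fintype.card G * (δ ^ 2 * d / (τ / 2) ^ 2) := Nat.floor_le (by positivity)
  have hq : (q : ℝ) * N ≤ d * (N / (m * Fintype.card G)) := by
    rw [mul_div_assoc', le_div_iff₀ (by positivity)]
    have : q * m * Fintype.card G ≤ d :=
      (Nat.mul_le_mul_right _ (by omega : q * m ≤ A.card)).trans hAcard
    have h' : (q : ℝ) * m * Fintype.card G ≤ d := by exact_mod_cast this
    calc (q : ℝ) * N * (m * Fintype.card G) = q * m * Fintype.card G * N := by ring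
      _ ≤ d * N := by gcongr
  have hrn : (r : ℝ) * n ≤ m * n := by gcongr
  have hMn : ((n : ℝ) + 1) * M ≤ (n + 1) * (Fintype.card G * (δ ^ 2 * d / (τ / 2) ^ 2)) := by gcongr
  push_cast
  linarith

lemma mdimSigma_le_div {G : Type*} [Group G] [Fintype G] (Sap : SoficApprox G)
    {X : Type u} [TopologicalSpace X] [CompactSpace X] [T2Space X]
    [MulAction G X] [ContinuousConstSMul G X] {ρ : ContPseudoMetric X} (hρ : ρ.IsCompatMetric)
    {n N m : ℕ} (hm : 0 < m) (hn : covDim X = n) (hN : covDim (Fin m → X) = N) :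
    mdimSigma Sap ρ ≤ ((N / (m * Fintype.card G) : ℝ) : EReal) := by
  refine iSup₂_le fun 𝒰 (h𝒰 : IsFinOpenCover 𝒰) => ?_
  refine EReal.le_of_forall_lt_iff_le.1 fun z hz => ?_
  rw [EReal.coe_lt_coe_iff] at hz
  obtain ⟨τ, hτ, 𝒱, h𝒱, h𝒱𝒰⟩ := exists_isFinOpenCover_smul (G := G) hρ h𝒰
  set K : ℝ := N / (m * Fintype.card G) with hK
  have hδ : ∃ δ > 0, (n + 1) * (Fintype.card G * (δ ^ 2 / (τ / 2) ^ 2)) < (z - K) / 2 := by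
    have hcont : Continuous fun δ : ℝ =>
      ((n : ℝ) + 1) * (Fintype.card G * (δ ^ 2 / (τ / 2) ^ 2)) := by fun_prop
    have hev : ∀ᶠ δ in 𝓝[>] (0 : ℝ),
        ((n : ℝ) + 1) * (Fintype.card G * (δ ^ 2 / (τ / 2) ^ 2)) < (z - K) / 2 :=
      nhdsWithin_le_nhds ((hcont.tendsto 0).eventually_lt_const (by simp; linarith))
    obtain ⟨δ, h, hδ⟩ := (hev.and self_mem_nhdsWithin).exists
    exact ⟨δ, hδ, h⟩
  obtain ⟨δ, hδ0, hδ⟩ := hδ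
  refine iInf_le_of_le ⟨Finset.univ, Finset.univ_nonempty⟩ (iInf_le_of_le ⟨δ, hδ0⟩ ?_)
  refine limsup_le_of_le (h := ?_)
  have hlim : Tendsto (fun i => (m * n : ℝ) / Sap.d i +
      n * (((badPoints (Sap.σ i)).card : ℝ) / Sap.d i)) atTop (𝓝 0) := by
    have h1 := (tendsto_natCast_atTop_atTop (R := ℝ)).comp Sap.d_tendsto
    simpa using (h1.const_div_atTop (m * n : ℝ)).add (Sap.tendsto_badPoints.const_mul (n : ℝ))
  filter_upwards [Sap.d_tendsto.eventually_gt_atTop 0,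
    hlim.eventually_lt_const (half_pos (sub_pos.2 hz))] with i hi hlt
  have hd : (0 : ℝ) < Sap.d i := by exact_mod_cast hi
  have hle := coverDMap_le h𝒰 h𝒱 hτ h𝒱𝒰 hm hn hN hδ0.le (Sap.σ i)
  refine (mul_le_mul_of_nonneg_right hle (EReal.coe_nonneg.2 (inv_nonneg.2 hd.le))).trans ?_
  rw [← EReal.coe_mul, EReal.coe_le_coe_iff]
  rw [mul_inv_le_iff₀ hd]
  have h1 : (m * n : ℝ) + n * (badPoints (Sap.σ i)).card ≤ (z - K) / 2 * Sap.d i := by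
    rw [mul_div_assoc', ← add_div, div_lt_iff₀ hd] at hlt
    exact hlt.le
  have h2 := mul_le_mul_of_nonneg_right hδ.le hd.le
  have h3 : ((n : ℝ) + 1) * (Fintype.card G * (δ ^ 2 / (τ / 2) ^ 2)) * Sap.d i =
    (n + 1) * (Fintype.card G * (δ ^ 2 * Sap.d i / (τ / 2) ^ 2)) := by ring
  linarith

/-- For a continuous action of a finite group `G` on a compact metrizable space `X`
of finite covering dimension, `mdim_Σ(X) ≤ (1/|G|) · inf_m dim(X^m)/m`. -/
theorem mdimSigma_le_of_finite_group {G : Type*} [Group G] [Fintype G] (Sap : SoficApprox G)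
    {X : Type*} [TopologicalSpace X] [CompactSpace X] [MetrizableSpace X]
    [MulAction G X] [ContinuousConstSMul G X]
    (hdim : covDim X ≠ ⊤)
    (ρ : ContPseudoMetric X) (hρ : ρ.IsCompatMetric) :
    mdimSigma Sap ρ ≤ ((Fintype.card G : ℝ)⁻¹ : EReal) *
      ⨅ m : {m : ℕ // 0 < m}, enatToEReal (covDim (Fin m.1 → X)) * ((m.1 : ℝ)⁻¹ : EReal) := by
  lift covDim X to ℕ using hdim with n hn
  have hG : (0 : ℝ) < Fintype.card G := by exact_mod_cast Fintype.card_pos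
  have hscale : ((Fintype.card G : ℝ) : EReal) * mdimSigma Sap ρ ≤
      ⨅ m : {m : ℕ // 0 < m}, enatToEReal (covDim (Fin m.1 → X)) * ((m.1 : ℝ)⁻¹ : EReal) := by
    refine le_iInf fun ⟨m, hm⟩ => ?_
    have hm' : (0 : ℝ) < m := by exact_mod_cast hm
    by_cases hN : covDim (Fin m → X) = ⊤
    · simp only [hN, enatToEReal, if_true]
      rw [← EReal.coe_inv, EReal.top_mul_coe_of_pos (inv_pos.2 hm')]
      exact le_top
    · obtain ⟨N, hN'⟩ := ENat.ne_top_iff_exists.1 hN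
      refine (mul_le_mul_of_nonneg_left (mdimSigma_le_div Sap hρ hm hn.symm hN'.symm)
        (EReal.coe_nonneg.2 hG.le)).trans (le_of_eq ?_)
      simp only [← hN', enatToEReal, ENat.natCast_ne_top, if_false, ENat.toNat_natCast]
      rw [← EReal.coe_inv, ← EReal.coe_mul, ← EReal.coe_mul]
      congr 1
      field_simp
  calc mdimSigma Sap ρ
      = ((Fintype.card G : ℝ)⁻¹ : EReal) * (((Fintype.card G : ℝ) : EReal) * mdimSigma Sap ρ) := by
        rw [← mul_assoc, ← EReal.coe_inv, ← EReal.coe_mul, inv_mul_cancel₀ hG.ne', EReal.coe_one,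
          one_mul]
    _ ≤ _ := mul_le_mul_of_nonneg_left hscale (by
        rw [← EReal.coe_inv]
        exact EReal.coe_nonneg.2 (inv_nonneg.2 hG.le))

end SoficMD
end

section
/- Let a countable sofic group G, with fixed sofic approximation sequence Σ, act continuously on a compact metrizable space X, let ρ be a dynamically generating continuous pseudometric on X, and let s_1, s_2, … be an enumeration of the elements of G. Define ρ'(x,y) = ∑_{n≥1} 2^{−n} ρ(s_n x, s_n y). Then ρ' is a compatible metric on X; moreover, if e_G = s_m, then for every ε > 0 one has h^{4ε}_{Σ,∞}(ρ') ≤ h^ε_{Σ,∞}(ρ) ≤ h^{ε/2^m}_{Σ,∞}(ρ'). In particular mdim_{Σ,M}(X,ρ) = mdim_{Σ,M}(X,ρ'). -/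
open Filter Topology TopologicalSpace
open scoped ENat
open scoped Classical Pointwise

open Filter Topology TopologicalSpace
open scoped ENat
open scoped Classical Pointwise

namespace SoficMD


section Counting

theorem elog_le_add {a N : ℕ∞} {k : ℕ} {c : ℝ} (h : a ≤ N * k) (hk : (k : ℝ) ≤ Real.exp c) :
    elog a ≤ elog N + (c : EReal) := by
  induction N using ENat.recTopCoe with
  | top => simp [elog]
  | coe n =>
    have ha : a ≠ ⊤ := by
      intro ha
      rw [ha, top_le_iff] at h
      exact ENat.natCast_ne_top (n * k) (by exact_mod_cast h)
    lift a to ℕ using ha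
    have h' : a ≤ n * k := by exact_mod_cast h
    rcases Nat.eq_zero_or_pos a with rfl | hpos
    · simp [elog]
    have hn : n ≠ 0 := by rintro rfl; omega
    have hk0 : k ≠ 0 := by rintro rfl; omega
    have key : Real.log a ≤ Real.log n + c := by
      have hk' : Real.log k ≤ c := by
        rw [← Real.log_exp c]
        exact Real.log_le_log (by positivity) hk
      calc Real.log a ≤ Real.log (n * k : ℝ) :=
            Real.log_le_log (by positivity) (by exact_mod_cast h')
        _ = Real.log n + Real.log k := Real.log_mul (by positivity) (by positivity)
        _ ≤ _ := by linarith
    have ha0 : (a : ℕ∞) ≠ 0 := by exact_mod_cast hpos.ne'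
    have hn0 : (n : ℕ∞) ≠ 0 := by exact_mod_cast hn
    simp only [elog, ENat.natCast_ne_top, if_false, ha0, hn0, ENat.toNat_natCast]
    exact_mod_cast key

theorem elog_mono {a b : ℕ∞} (h : a ≤ b) : elog a ≤ elog b := by
  simpa using elog_le_add (k := 1) (c := 0) (by simpa using h) (by simp)

theorem exists_separated_net {Y : Type*} (ρ : Y → Y → ℝ) (ε : ℝ)
    (hsymm : ∀ x y, ρ x y = ρ y x) (hrefl : ∀ x, ρ x x < ε) :
    ∃ B : Set Y, (∀ x ∈ B, ∀ y ∈ B, x ≠ y → ε ≤ ρ x y) ∧ ∀ y, ∃ b ∈ B, ρ y b < ε := by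
  obtain ⟨B, hB⟩ := zorn_subset {E : Set Y | ∀ x ∈ E, ∀ y ∈ E, x ≠ y → ε ≤ ρ x y} (by
    intro c hc hchain
    refine ⟨⋃₀ c, ?_, fun s hs => Set.subset_sUnion_of_mem hs⟩
    rintro x ⟨s, hs, hxs⟩ y ⟨t, ht, hyt⟩ hxy
    rcases hchain.total hs ht with h | h
    · exact hc ht x (h hxs) y hyt hxy
    · exact hc hs x hxs y (h hyt) hxy)
  refine ⟨B, hB.prop, fun y => ?_⟩
  by_contra! hcon
  have hins : insert y B ∈ {E : Set Y | ∀ x ∈ E, ∀ y ∈ E, x ≠ y → ε ≤ ρ x y} := by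
    rintro u (rfl | hu) v (rfl | hv) huv
    · exact absurd rfl huv
    · exact hcon v hv
    · rw [hsymm]; exact hcon u hu
    · exact hB.prop u hu v hv huv
  have hy : y ∈ B := hB.le_of_ge hins (Set.subset_insert y B) (Set.mem_insert y B)
  exact absurd (hrefl y) (not_lt.2 (hcon y hy))

theorem sepNum_le_mul_card {Y Z W : Type*} [Fintype W] (ρ : Y → Y → ℝ) (r : Z → Z → ℝ)
    {ε ε' : ℝ} (hsymm : ∀ x y, ρ x y = ρ y x) (hrefl : ∀ x, ρ x x < ε)
    (f : Z → Y) (g : Z → W)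
    (h : ∀ z z' y, ρ (f z) y < ε → ρ (f z') y < ε → g z = g z' → r z z' < ε') :
    sepNum r ε' ≤ sepNum ρ ε * (Fintype.card W : ℕ∞) := by
  obtain ⟨B, hB, hnet⟩ := exists_separated_net ρ ε hsymm hrefl
  choose b hbB hb using hnet
  refine iSup₂_le fun E hE => ?_
  have hinj : Set.InjOn (fun z => (b (f z), g z)) E := by
    intro z hz z' hz' hzz
    by_contra hne
    simp only [Prod.mk.injEq] at hzz
    have h1 := hb (f z')
    rw [← hzz.1] at h1
    exact absurd (h z z' _ (hb _) h1 hzz.2) (not_lt.2 (hE z hz z' hz' hne))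
  have hmaps : (fun z => (b (f z), g z)) '' E ⊆ B ×ˢ (Set.univ : Set W) := by
    rintro _ ⟨z, -, rfl⟩
    exact ⟨hbB _, trivial⟩
  calc E.encard = ((fun z => (b (f z), g z)) '' E).encard := hinj.encard_image.symm
    _ ≤ (B ×ˢ (Set.univ : Set W)).encard := Set.encard_le_encard hmaps
    _ = B.encard * (Fintype.card W : ℕ∞) := by
        rw [Set.encard_prod, Set.encard_univ, ENat.card_eq_coe_fintype_card]
    _ ≤ _ := by
        gcongr
        exact le_iSup₂_of_le (f := fun (E : Set Y) (_ : E ∈ _) => E.encard) B hB le_rfl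

theorem sepNum_le_of_injective {Y Z : Type*} (ρ : Y → Y → ℝ) (r : Z → Z → ℝ) {ε ε' : ℝ}
    (f : Z → Y) (hf : Function.Injective f) (h : ∀ z z', ε' ≤ r z z' → ε ≤ ρ (f z) (f z')) :
    sepNum r ε' ≤ sepNum ρ ε := by
  refine iSup₂_le fun E hE => ?_
  rw [← hf.encard_image E]
  refine le_iSup₂_of_le (f := fun (E : Set Y) (_ : E ∈ _) => E.encard) (f '' E) ?_ le_rfl
  rintro _ ⟨z, hz, rfl⟩ _ ⟨z', hz', rfl⟩ hne
  exact h z z' (hE z hz z' hz' fun h => hne (by rw [h]))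

/-- Words over `Option T` whose proportion of letters from `T` is small are exponentially few. -/
theorem exists_card_sparse_le (T : Type*) [Fintype T] {γ : ℝ} (hγ : 0 < γ) :
    ∃ η : ℝ, 0 < η ∧ ∀ d : ℕ,
      (Fintype.card {g : Fin d → Option T //
        ((Finset.univ.filter fun a => g a ≠ none).card : ℝ) ≤ η * d} : ℝ) ≤
        Real.exp (γ * d) := by
  obtain ⟨L, hL0, hL⟩ : ∃ L : ℝ, 0 ≤ L ∧ Real.exp (-L) * Fintype.card T ≤ γ / 2 := by
    have h1 : Tendsto (fun L : ℝ => Real.exp (-L) * Fintype.card T) atTop (𝓝 0) := by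
      simpa using Real.tendsto_exp_neg_atTop_nhds_zero.mul_const (Fintype.card T : ℝ)
    obtain ⟨L, h2, h3⟩ :=
      ((eventually_ge_atTop 0).and (h1.eventually_le_const (half_pos hγ))).exists
    exact ⟨L, h2, h3⟩
  refine ⟨γ / (2 * (L + 1)), by positivity, fun d => ?_⟩
  set η := γ / (2 * (L + 1)) with hη
  have hLη : L * η ≤ γ / 2 := by
    rw [hη, mul_div_assoc', div_le_div_iff₀ (by positivity) (by positivity)]
    nlinarith
  let w : Option T → ℝ := fun o => if o ≠ none then Real.exp (-L) else 1
  have hw : ∀ o, 0 ≤ w o := fun o => by dsimp only [w]; split_ifs <;> positivity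
  let S : Finset (Fin d → Option T) :=
    Finset.univ.filter fun g => ((Finset.univ.filter fun a => g a ≠ none).card : ℝ) ≤ η * d
  have hcard : Fintype.card {g : Fin d → Option T //
      ((Finset.univ.filter fun a => g a ≠ none).card : ℝ) ≤ η * d} = S.card :=
    Fintype.card_subtype _
  have hlow : ∀ g ∈ S, Real.exp (-(γ / 2 * d)) ≤ ∏ a, w (g a) := by
    intro g hg
    have hg' := (Finset.mem_filter.1 hg).2
    have : ∏ a, w (g a) = Real.exp (-L) ^ (Finset.univ.filter fun a => g a ≠ none).card := by
      simp only [w, Finset.prod_ite, Finset.prod_const, one_pow, mul_one]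
    rw [this, ← Real.exp_nat_mul]
    apply Real.exp_le_exp.2
    have h1 := mul_le_mul_of_nonneg_left hg' hL0
    have h2 := mul_le_mul_of_nonneg_right hLη (Nat.cast_nonneg (α := ℝ) d)
    linarith
  have hsum : ∑ g : Fin d → Option T, ∏ a, w (g a) ≤ Real.exp (γ / 2 * d) := by
    have h1 : ∑ g : Fin d → Option T, ∏ a, w (g a) = (∑ o, w o) ^ d := by
      rw [← Fintype.piFinset_univ, ← Finset.prod_univ_sum]
      simp
    have h2 : ∑ o, w o ≤ Real.exp (γ / 2) := by
      have : ∑ o, w o = Fintype.card T * Real.exp (-L) + 1 := by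
        rw [Fintype.sum_option]
        simp [w, add_comm]
      rw [this]
      linarith [Real.add_one_le_exp (γ / 2)]
    rw [h1, mul_comm, Real.exp_nat_mul]
    exact pow_le_pow_left₀ (Finset.sum_nonneg fun o _ => hw o) h2 d
  have hmain : (S.card : ℝ) * Real.exp (-(γ / 2 * d)) ≤ Real.exp (γ / 2 * d) := by
    calc (S.card : ℝ) * Real.exp (-(γ / 2 * d)) = ∑ g ∈ S, Real.exp (-(γ / 2 * d)) := by simp
      _ ≤ ∑ g ∈ S, ∏ a, w (g a) := Finset.sum_le_sum hlow
      _ ≤ ∑ g : Fin d → Option T, ∏ a, w (g a) :=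
          Finset.sum_le_sum_of_subset_of_nonneg (Finset.subset_univ _)
            fun g _ _ => Finset.prod_nonneg fun a _ => hw _
      _ ≤ _ := hsum
  rw [hcard, show γ * d = γ / 2 * d + γ / 2 * d by ring, Real.exp_add]
  rw [Real.exp_neg, ← div_eq_mul_inv, div_le_iff₀ (Real.exp_pos _)] at hmain
  exact hmain

end Counting

section Pseudometric

variable {X : Type*} [TopologicalSpace X]

theorem ContPseudoMetric.exists_bound [CompactSpace X] (ρ : ContPseudoMetric X) :
    ∃ C : ℝ, 0 < C ∧ ∀ x y, ρ.d x y ≤ C := by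
  obtain ⟨C, hC⟩ := isCompact_univ.exists_bound_of_continuousOn ρ.continuous'.continuousOn
  refine ⟨max C 1, by positivity, fun x y => ?_⟩
  exact (le_abs_self _).trans ((hC (x, y) trivial).trans (le_max_left _ _))

/-- A compact space has a finite partition into pieces of small diameter. -/
theorem ContPseudoMetric.exists_finite_coding [CompactSpace X] (ρ : ContPseudoMetric X)
    {ε : ℝ} (hε : 0 < ε) :
    ∃ (t : Finset X) (p : X → t), ∀ x y, p x = p y → ρ.d x y < ε := by
  obtain ⟨t, ht⟩ := isCompact_univ.elim_finite_subcover
    (fun x : X => {y | ρ.d x y < ε / 2})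
    (fun x => isOpen_lt (ρ.continuous'.comp (Continuous.prodMk_right x)) continuous_const)
    (fun x _ => Set.mem_iUnion.2 ⟨x, by simpa [ρ.refl x] using hε⟩)
  have hp : ∀ x, ∃ z : t, ρ.d z x < ε / 2 := fun x => by
    have := ht (Set.mem_univ x)
    simp only [Set.mem_iUnion, Set.mem_ofPred_eq] at this
    obtain ⟨z, hz, h⟩ := this
    exact ⟨⟨z, hz⟩, h⟩
  choose p hp using hp
  refine ⟨t, p, fun x y hxy => ?_⟩
  have h1 := hp x
  have h2 := hp y
  rw [← hxy] at h2
  have h3 := ρ.triangle x (p x) y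
  rw [ρ.symm x (p x)] at h3
  linarith

theorem sum_le_of_rho2_le (ρ : ContPseudoMetric X) {d : ℕ} {φ ψ : Fin d → X} {δ : ℝ}
    (hd : 0 < d) (h : rho2 ρ φ ψ ≤ δ) : ∑ a, ρ.d (φ a) (ψ a) ≤ d * δ := by
  have hδ : 0 ≤ δ := (Real.sqrt_nonneg _).trans h
  have h1 := (Real.sqrt_le_left hδ).1 h
  have h2 := sq_sum_le_card_mul_sum_sq (s := Finset.univ) (f := fun a => ρ.d (φ a) (ψ a))
  simp only [Finset.card_univ, Fintype.card_fin] at h2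
  have hd' : (0 : ℝ) < d := by exact_mod_cast hd
  rw [one_div, inv_mul_le_iff₀ hd'] at h1
  refine le_of_sq_le_sq ?_ (by positivity)
  nlinarith

theorem rho2_le_of_sum_le (ρ : ContPseudoMetric X) {d : ℕ} {φ ψ : Fin d → X} {C κ δ : ℝ}
    (hd : 0 < d) (hC0 : 0 ≤ C) (hC : ∀ x y, ρ.d x y ≤ C) (hδ : 0 ≤ δ) (hκ : C * κ ≤ δ ^ 2)
    (h : ∑ a, ρ.d (φ a) (ψ a) ≤ d * κ) : rho2 ρ φ ψ ≤ δ := by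
  have hd' : (0 : ℝ) < d := by exact_mod_cast hd
  refine (Real.sqrt_le_left hδ).2 ?_
  rw [one_div, inv_mul_le_iff₀ hd']
  calc ∑ a, ρ.d (φ a) (ψ a) ^ 2 ≤ ∑ a, C * ρ.d (φ a) (ψ a) :=
        Finset.sum_le_sum fun a _ => by
          rw [sq]; exact mul_le_mul_of_nonneg_right (hC _ _) (ρ.nonneg _ _)
    _ = C * ∑ a, ρ.d (φ a) (ψ a) := by rw [Finset.mul_sum]
    _ ≤ C * (d * κ) := by gcongr
    _ = d * (C * κ) := by ring
    _ ≤ _ := by gcongr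

theorem mul_rho2_le (ρ ρ' : ContPseudoMetric X) {c : ℝ} (hc : 0 ≤ c)
    (h : ∀ x y, c * ρ.d x y ≤ ρ'.d x y) {d : ℕ} (φ ψ : Fin d → X) :
    c * rho2 ρ φ ψ ≤ rho2 ρ' φ ψ := by
  unfold rho2
  rw [← Real.sqrt_sq hc, ← Real.sqrt_mul (sq_nonneg c)]
  apply Real.sqrt_le_sqrt
  rw [mul_left_comm, Finset.mul_sum]
  gcongr with a
  rw [← mul_pow]
  exact pow_le_pow_left₀ (mul_nonneg hc (ρ.nonneg _ _)) (h _ _) 2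

theorem mul_rhoInfty_le (ρ ρ' : ContPseudoMetric X) {c : ℝ} (hc : 0 ≤ c)
    (h : ∀ x y, c * ρ.d x y ≤ ρ'.d x y) {d : ℕ} (φ ψ : Fin d → X) :
    c * rhoInfty ρ φ ψ ≤ rhoInfty ρ' φ ψ := by
  unfold rhoInfty
  rw [Real.mul_iSup_of_nonneg hc]
  exact ciSup_mono (Set.finite_range _).bddAbove fun a => h _ _

theorem le_rhoInfty (ρ : ContPseudoMetric X) {d : ℕ} (φ ψ : Fin d → X) (a : Fin d) :
    ρ.d (φ a) (ψ a) ≤ rhoInfty ρ φ ψ :=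
  le_ciSup (f := fun a => ρ.d (φ a) (ψ a)) (Set.finite_range _).bddAbove a

theorem rhoInfty_lt (ρ : ContPseudoMetric X) {d : ℕ} {φ ψ : Fin d → X} {c : ℝ} (hc : 0 < c)
    (h : ∀ a, ρ.d (φ a) (ψ a) < c) : rhoInfty ρ φ ψ < c := by
  rcases isEmpty_or_nonempty (Fin d) with hd | hd
  · simpa [rhoInfty] using hc
  · obtain ⟨a, ha⟩ := exists_eq_ciSup_of_finite (f := fun a => ρ.d (φ a) (ψ a))
    rw [rhoInfty, ← ha]
    exact h a

theorem rhoInfty_comm (ρ : ContPseudoMetric X) {d : ℕ} (φ ψ : Fin d → X) :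
    rhoInfty ρ φ ψ = rhoInfty ρ ψ φ := by
  simp only [rhoInfty, ρ.symm]

theorem rhoInfty_self (ρ : ContPseudoMetric X) {d : ℕ} (φ : Fin d → X) :
    rhoInfty ρ φ φ = 0 := by
  simp [rhoInfty, ρ.refl]

theorem MapSpace_mono {G : Type*} [Group G] [MulAction G X] (ρ : ContPseudoMetric X)
    {F F' : Finset G} {δ δ' : ℝ} (hF : F ⊆ F') (hδ : δ' ≤ δ) {d : ℕ}
    (σ : G → Equiv.Perm (Fin d)) : MapSpace ρ F' δ' σ ⊆ MapSpace ρ F δ σ :=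
  fun _ hφ s hs => (hφ s (hF hs)).trans hδ

/-- An approximately equivariant map fails to be pointwise equivariant only rarely. -/
theorem card_filter_exists_lt_le {G : Type*} [Group G] [MulAction G X]
    (ρ : ContPseudoMetric X) (e : ℕ → G) {F : Finset G} {δ τ η : ℝ} {d : ℕ} (hd : 0 < d) (hτ : 0 < τ)
    {σ : G → Equiv.Perm (Fin d)} {φ : Fin d → X} (hφ : φ ∈ MapSpace ρ F δ σ) {M : ℕ}
    (hM : ∀ n < M, e n ∈ F) (hη : M * δ ≤ η * τ) :
    ((Finset.univ.filter fun a =>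
      ∃ n < M, τ < ρ.d (φ (σ (e n) a)) (e n • φ a)).card : ℝ) ≤ η * d := by
  have hone : ∀ n ∈ Finset.range M,
      ((Finset.univ.filter fun a => τ < ρ.d (φ (σ (e n) a)) (e n • φ a)).card : ℝ) * τ ≤
        d * δ := by
    intro n hn
    refine le_trans ?_ (sum_le_of_rho2_le ρ hd (hφ _ (hM n (Finset.mem_range.1 hn))))
    rw [← nsmul_eq_mul]
    refine (Finset.card_nsmul_le_sum _ (fun a => ρ.d (φ (σ (e n) a)) (e n • φ a)) _
      fun a ha => (Finset.mem_filter.1 ha).2.le).trans ?_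
    exact Finset.sum_le_sum_of_subset_of_nonneg (Finset.subset_univ _) fun _ _ _ => ρ.nonneg _ _
  have hsub : (Finset.univ.filter fun a => ∃ n < M, τ < ρ.d (φ (σ (e n) a)) (e n • φ a)) ⊆
      (Finset.range M).biUnion fun n =>
        Finset.univ.filter fun a => τ < ρ.d (φ (σ (e n) a)) (e n • φ a) := by
    intro a ha
    obtain ⟨n, hn, h⟩ := (Finset.mem_filter.1 ha).2
    exact Finset.mem_biUnion.2
      ⟨n, Finset.mem_range.2 hn, Finset.mem_filter.2 ⟨Finset.mem_univ _, h⟩⟩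
  have hcard := (Finset.card_le_card hsub).trans Finset.card_biUnion_le
  have hcard' := (Nat.cast_le (α := ℝ)).2 hcard
  push_cast at hcard'
  refine le_of_mul_le_mul_right ?_ hτ
  calc _ ≤ (∑ n ∈ Finset.range M,
        ((Finset.univ.filter fun a => τ < ρ.d (φ (σ (e n) a)) (e n • φ a)).card : ℝ)) * τ := by
        gcongr
    _ ≤ ∑ n ∈ Finset.range M, d * δ := by
        rw [Finset.sum_mul]
        exact Finset.sum_le_sum hone
    _ = d * (M * δ) := by rw [Finset.sum_const, Finset.card_range, nsmul_eq_mul]; ring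
    _ ≤ d * (η * τ) := by gcongr
    _ = _ := by ring

end Pseudometric

section OrbitSum

variable {G : Type*} [Group G] {X : Type*} [TopologicalSpace X] [CompactSpace X]
  [MulAction G X]

theorem summable_orbit (ρ : ContPseudoMetric X) (e : ℕ → G) (x y : X) :
    Summable fun n : ℕ => ((1 : ℝ) / 2) ^ (n + 1) * ρ.d (e n • x) (e n • y) := by
  obtain ⟨C, -, hC⟩ := ρ.exists_bound
  have hs : Summable fun n : ℕ => ((1 : ℝ) / 2) ^ (n + 1) * C :=
    ((summable_nat_add_iff 1).2 summable_geometric_two).mul_right C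
  refine hs.of_nonneg_of_le (fun n => mul_nonneg (by positivity) (ρ.nonneg _ _)) fun n => ?_
  exact mul_le_mul_of_nonneg_left (hC _ _) (by positivity)

/-- The pseudometric `∑ 2^{-(n+1)} ρ(e_n x, e_n y)`. -/
noncomputable def orbitSum [ContinuousConstSMul G X] (ρ : ContPseudoMetric X) (e : ℕ → G) :
    ContPseudoMetric X where
  d x y := ∑' n : ℕ, ((1 : ℝ) / 2) ^ (n + 1) * ρ.d (e n • x) (e n • y)
  continuous' := by
    obtain ⟨C, -, hC⟩ := ρ.exists_bound
    have hs : Summable fun n : ℕ => ((1 : ℝ) / 2) ^ (n + 1) * C :=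
      ((summable_nat_add_iff 1).2 summable_geometric_two).mul_right C
    refine continuous_tsum (fun n => ?_) hs fun n p => ?_
    · exact continuous_const.mul (ρ.continuous'.comp
        ((continuous_fst.const_smul (e n)).prodMk (continuous_snd.const_smul (e n))))
    · rw [Real.norm_of_nonneg (mul_nonneg (by positivity) (ρ.nonneg _ _))]
      exact mul_le_mul_of_nonneg_left (hC _ _) (by positivity)
  nonneg x y := tsum_nonneg fun n => mul_nonneg (by positivity) (ρ.nonneg _ _)
  symm x y := by simp only [ρ.symm]
  refl x := by simp [ρ.refl]
  triangle x y z := by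
    rw [← (summable_orbit ρ e x y).tsum_add (summable_orbit ρ e y z)]
    refine (summable_orbit ρ e x z).tsum_le_tsum (fun n => ?_)
      ((summable_orbit ρ e x y).add (summable_orbit ρ e y z))
    rw [← mul_add]
    exact mul_le_mul_of_nonneg_left (ρ.triangle _ _ _) (by positivity)

variable [ContinuousConstSMul G X] (ρ : ContPseudoMetric X) (e : ℕ → G)

theorem term_le_orbitSum (n : ℕ) (x y : X) :
    ((1 : ℝ) / 2) ^ (n + 1) * ρ.d (e n • x) (e n • y) ≤ (orbitSum ρ e).d x y :=
  (summable_orbit ρ e x y).le_tsum n fun _ _ => mul_nonneg (by positivity) (ρ.nonneg _ _)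

theorem mul_le_orbitSum {m : ℕ} (hm : e m = 1) (x y : X) :
    ((1 : ℝ) / 2) ^ (m + 1) * ρ.d x y ≤ (orbitSum ρ e).d x y := by
  simpa [hm] using term_le_orbitSum ρ e m x y

theorem orbitSum_isCompatMetric (hgen : DynGenerating G ρ) (he : Function.Surjective e) :
    (orbitSum ρ e).IsCompatMetric := by
  intro x y h
  by_contra hne
  obtain ⟨s, hs⟩ := hgen x y hne
  obtain ⟨n, rfl⟩ := he s
  have h1 := term_le_orbitSum ρ e n x y
  rw [h] at h1
  exact absurd h1 (not_le.2 (by positivity))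

theorem orbitSum_le_sum_add {C : ℝ} (hC : ∀ x y, ρ.d x y ≤ C) (M : ℕ) (x y : X) :
    (orbitSum ρ e).d x y ≤
      ∑ n ∈ Finset.range M, ((1 : ℝ) / 2) ^ (n + 1) * ρ.d (e n • x) (e n • y) +
        C * (1 / 2) ^ M := by
  have hs := summable_orbit ρ e x y
  have hgeo : HasSum (fun n : ℕ => ((1 : ℝ) / 2) ^ (n + M + 1) * C) (C * (1 / 2) ^ M) := by
    have h := hasSum_geometric_two.mul_left (C * (1 / 2) ^ M * (1 / 2))
    rw [show C * (1 / 2) ^ M * (1 / 2) * 2 = C * (1 / 2) ^ M by ring] at h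
    have hf : (fun n : ℕ => ((1 : ℝ) / 2) ^ (n + M + 1) * C) =
        fun n => C * (1 / 2) ^ M * (1 / 2) * (1 / 2) ^ n := by
      funext n
      ring
    rwa [hf]
  change ∑' n : ℕ, ((1 : ℝ) / 2) ^ (n + 1) * ρ.d (e n • x) (e n • y) ≤ _
  rw [← hs.sum_add_tsum_nat_add M, ← hgeo.tsum_eq]
  refine add_le_add_right ?_ _
  refine ((summable_nat_add_iff M).2 hs).tsum_le_tsum (fun n => ?_) hgeo.summable
  exact mul_le_mul_of_nonneg_left (hC _ _) (by positivity)

theorem orbitSum_le_of_forall_le {C A : ℝ} (hC : ∀ x y, ρ.d x y ≤ C) (hA : 0 ≤ A) (M : ℕ)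
    {x y : X} (h : ∀ n < M, ρ.d (e n • x) (e n • y) ≤ A) :
    (orbitSum ρ e).d x y ≤ A + C * (1 / 2) ^ M := by
  refine (orbitSum_le_sum_add ρ e hC M x y).trans ?_
  gcongr
  have hsum : ∑ n ∈ Finset.range M, ((1 : ℝ) / 2) ^ (n + 1) ≤ 1 := by
    have hg : HasSum (fun n : ℕ => ((1 : ℝ) / 2) ^ (n + 1)) 1 := by
      have h := hasSum_geometric_two.mul_left ((1 : ℝ) / 2)
      rw [show (1 : ℝ) / 2 * 2 = 1 by norm_num] at h
      simpa only [pow_succ'] using h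
    exact sum_le_hasSum _ (fun _ _ => by positivity) hg
  calc ∑ n ∈ Finset.range M, ((1 : ℝ) / 2) ^ (n + 1) * ρ.d (e n • x) (e n • y)
      ≤ ∑ n ∈ Finset.range M, ((1 : ℝ) / 2) ^ (n + 1) * A :=
        Finset.sum_le_sum fun n hn =>
          mul_le_mul_of_nonneg_left (h n (Finset.mem_range.1 hn)) (by positivity)
    _ = (∑ n ∈ Finset.range M, ((1 : ℝ) / 2) ^ (n + 1)) * A := by rw [Finset.sum_mul]
    _ ≤ 1 * A := by gcongr
    _ = A := one_mul A

end OrbitSum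


section Comparison

variable {G : Type*} [Group G] {X : Type*} [TopologicalSpace X] [CompactSpace X]
  [MulAction G X] [ContinuousConstSMul G X] (ρ : ContPseudoMetric X) (e : ℕ → G)

theorem SoficApprox.eventually_card_ne_le (Sap : SoficApprox G) (s t : G) {η : ℝ} (hη : 0 < η) :
    ∀ᶠ i in atTop, ((Finset.univ.filter fun a : Fin (Sap.d i) =>
      ¬ Sap.σ i s (Sap.σ i t a) = Sap.σ i (s * t) a).card : ℝ) ≤ η * Sap.d i := by
  filter_upwards [(Sap.approx_mul s t).eventually_const_le (show 1 - η < 1 by linarith),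
    Sap.d_tendsto.eventually_gt_atTop 0] with i hi hd
  have hd' : (0 : ℝ) < Sap.d i := by exact_mod_cast hd
  rw [le_div_iff₀ hd'] at hi
  have h := Finset.card_filter_add_card_filter_not (s := (Finset.univ : Finset (Fin (Sap.d i))))
    (fun a => Sap.σ i s (Sap.σ i t a) = Sap.σ i (s * t) a)
  rw [Finset.card_univ, Fintype.card_fin] at h
  have h' := congrArg (Nat.cast (R := ℝ)) h
  push_cast at h'
  linarith

/-- Approximate equivariance for `ρ` forces approximate equivariance for `orbitSum ρ e`. -/
theorem eventually_mapSpace_subset (Sap : SoficApprox G) (F' : Finset G) {δ' : ℝ}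
    (hδ' : 0 < δ') : ∃ F : Finset G, F.Nonempty ∧ ∃ δ : ℝ, 0 < δ ∧ ∀ᶠ i in atTop,
      MapSpace ρ F δ (Sap.σ i) ⊆ MapSpace (orbitSum ρ e) F' δ' (Sap.σ i) := by
  obtain ⟨C, hC0, hC⟩ := ρ.exists_bound
  have hC' : ∀ x y, (orbitSum ρ e).d x y ≤ C := fun x y => by
    simpa using orbitSum_le_of_forall_le ρ e hC le_rfl 0 (x := x) (y := y) (by simp)
  obtain ⟨κ, hκ0, hκ⟩ : ∃ κ : ℝ, 0 < κ ∧ C * κ ≤ δ' ^ 2 :=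
    ⟨δ' ^ 2 / C, by positivity, (mul_div_cancel₀ _ hC0.ne').le⟩
  obtain ⟨M, hM⟩ : ∃ M : ℕ, C * (1 / 2) ^ M ≤ κ / 2 := by
    have h : Tendsto (fun M : ℕ => C * ((1 : ℝ) / 2) ^ M) atTop (𝓝 0) := by
      simpa using (tendsto_pow_atTop_nhds_zero_of_lt_one (r := (1 : ℝ) / 2) (by norm_num)
        (by norm_num)).const_mul C
    exact (h.eventually_le_const (half_pos hκ0)).exists
  set δ : ℝ := κ / (8 * (M + 1)) with hδ
  have hδ0 : 0 < δ := by positivity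
  set η : ℝ := δ / C with hη
  have hη0 : 0 < η := by positivity
  set P : Finset G := (Finset.range (M + 1)).image e
  have heP : ∀ n < M, e n ∈ P := fun n hn =>
    Finset.mem_image_of_mem e (Finset.mem_range.2 (by omega))
  refine ⟨P ∪ P * F', ?_, δ, hδ0, ?_⟩
  · exact (Finset.Nonempty.image ⟨0, by simp⟩ e).mono Finset.subset_union_left
  have hev : ∀ᶠ i in atTop, ∀ n ∈ Finset.range M, ∀ s ∈ F',
      ((Finset.univ.filter fun a : Fin (Sap.d i) =>
        ¬ Sap.σ i (e n) (Sap.σ i s a) = Sap.σ i (e n * s) a).card : ℝ) ≤ η * Sap.d i :=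
    (Finset.eventually_all _).2 fun n _ => (Finset.eventually_all _).2 fun s _ =>
      Sap.eventually_card_ne_le (e n) s hη0
  filter_upwards [hev, Sap.d_tendsto.eventually_gt_atTop 0] with i hi hd φ hφ s hs
  refine rho2_le_of_sum_le _ hd hC0.le hC' hδ'.le hκ ?_
  set σ := Sap.σ i
  have hd' : (0 : ℝ) < Sap.d i := by exact_mod_cast hd
  have hpt : ∀ a, (orbitSum ρ e).d (φ (σ s a)) (s • φ a) ≤
      ∑ n ∈ Finset.range M, (ρ.d (φ (σ (e n) (σ s a))) (e n • φ (σ s a)) +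
        (if ¬ σ (e n) (σ s a) = σ (e n * s) a then C else 0) +
        ρ.d (φ (σ (e n * s) a)) ((e n * s) • φ a)) + C * (1 / 2) ^ M := by
    intro a
    refine (orbitSum_le_sum_add ρ e hC M _ _).trans ?_
    gcongr with n hn
    have h1 : ((1 : ℝ) / 2) ^ (n + 1) ≤ 1 := pow_le_one₀ (by norm_num) (by norm_num)
    refine (mul_le_of_le_one_left (ρ.nonneg _ _) h1).trans ?_
    rw [smul_smul]
    have h2 := ρ.triangle (e n • φ (σ s a)) (φ (σ (e n) (σ s a))) ((e n * s) • φ a)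
    have h3 := ρ.triangle (φ (σ (e n) (σ s a))) (φ (σ (e n * s) a)) ((e n * s) • φ a)
    rw [ρ.symm (e n • φ (σ s a)) (φ (σ (e n) (σ s a)))] at h2
    have h4 : ρ.d (φ (σ (e n) (σ s a))) (φ (σ (e n * s) a)) ≤
        if ¬ σ (e n) (σ s a) = σ (e n * s) a then C else 0 := by
      split_ifs with h
      · rw [h, ρ.refl]
      · exact hC _ _
    linarith
  have hterm : ∀ n ∈ Finset.range M,
      ∑ a, (ρ.d (φ (σ (e n) (σ s a))) (e n • φ (σ s a)) +
        (if ¬ σ (e n) (σ s a) = σ (e n * s) a then C else 0) +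
        ρ.d (φ (σ (e n * s) a)) ((e n * s) • φ a)) ≤ Sap.d i * (3 * δ) := by
    intro n hn
    have hnP := heP n (Finset.mem_range.1 hn)
    rw [Finset.sum_add_distrib, Finset.sum_add_distrib]
    have h1 : ∑ a, ρ.d (φ (σ (e n) (σ s a))) (e n • φ (σ s a)) ≤ Sap.d i * δ := by
      rw [Equiv.sum_comp (σ s) fun a => ρ.d (φ (σ (e n) a)) (e n • φ a)]
      exact sum_le_of_rho2_le ρ hd (hφ _ (Finset.mem_union_left _ hnP))
    have h2 : ∑ a, (if ¬ σ (e n) (σ s a) = σ (e n * s) a then C else 0) ≤ Sap.d i * δ := by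
      rw [← Finset.sum_filter, Finset.sum_const, nsmul_eq_mul]
      calc _ ≤ η * Sap.d i * C := mul_le_mul_of_nonneg_right (hi n hn s hs) hC0.le
        _ = _ := by rw [hη]; field_simp
    have h3 : ∑ a, ρ.d (φ (σ (e n * s) a)) ((e n * s) • φ a) ≤ Sap.d i * δ :=
      sum_le_of_rho2_le ρ hd (hφ _ (Finset.mem_union_right _ (Finset.mul_mem_mul hnP hs)))
    linarith
  have hMδ : M * (3 * δ) ≤ κ / 2 := by
    rw [hδ, ← mul_div_assoc, ← mul_div_assoc, div_le_div_iff₀ (by positivity) (by positivity)]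
    nlinarith [mul_nonneg (Nat.cast_nonneg (α := ℝ) M) hκ0.le]
  calc ∑ a, (orbitSum ρ e).d (φ (σ s a)) (s • φ a)
      ≤ _ := Finset.sum_le_sum fun a _ => hpt a
    _ = ∑ n ∈ Finset.range M, ∑ a, (ρ.d (φ (σ (e n) (σ s a))) (e n • φ (σ s a)) +
        (if ¬ σ (e n) (σ s a) = σ (e n * s) a then C else 0) +
        ρ.d (φ (σ (e n * s) a)) ((e n * s) • φ a)) + Sap.d i * (C * (1 / 2) ^ M) := by
        rw [Finset.sum_add_distrib, Finset.sum_comm]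
        simp
    _ ≤ ∑ n ∈ Finset.range M, Sap.d i * (3 * δ) + Sap.d i * (κ / 2) := by
        gcongr with n hn
        exact hterm n hn
    _ = Sap.d i * (M * (3 * δ) + κ / 2) := by
        rw [Finset.sum_const, Finset.card_range, nsmul_eq_mul]; ring
    _ ≤ Sap.d i * κ := by
        gcongr
        linarith

theorem exists_hCnt_orbitSum_le {m : ℕ} (hm : e m = 1) {ε : ℝ} (hε : 0 < ε) (F : Finset G)
    {δ γ : ℝ} (hδ : 0 < δ) (hγ : 0 < γ) :
    ∃ F' : Finset G, F'.Nonempty ∧ ∃ δ' : ℝ, 0 < δ' ∧ ∀ d : ℕ, 0 < d →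
      ∀ σ : G → Equiv.Perm (Fin d),
        hCnt (orbitSum ρ e) F' δ' σ (4 * ε) ≤
          hCnt ρ F δ σ ε + ((γ * d : ℝ) : EReal) := by
  obtain ⟨C, hC0, hC⟩ := ρ.exists_bound
  obtain ⟨t, p, hp⟩ := (orbitSum ρ e).exists_finite_coding (show 0 < 4 * ε by positivity)
  obtain ⟨η, hη0, hη⟩ := exists_card_sparse_le t hγ
  obtain ⟨M, hM⟩ : ∃ M : ℕ, C * (1 / 2) ^ M ≤ ε / 2 := by
    have h : Tendsto (fun M : ℕ => C * ((1 : ℝ) / 2) ^ M) atTop (𝓝 0) := by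
      simpa using (tendsto_pow_atTop_nhds_zero_of_lt_one (r := (1 : ℝ) / 2) (by norm_num)
        (by norm_num)).const_mul C
    exact (h.eventually_le_const (half_pos hε)).exists
  obtain ⟨τ, hτ⟩ : ∃ τ : ℝ, τ = ε / 4 := ⟨_, rfl⟩
  have hτ0 : 0 < τ := by rw [hτ]; positivity
  obtain ⟨κ, hκ0, hκδ, hκη⟩ : ∃ κ : ℝ, 0 < κ ∧ κ ≤ δ ∧ M * κ ≤ η * τ := by
    refine ⟨min δ (η * τ / (M + 1)), by positivity, min_le_left _ _, ?_⟩
    have h1 : min δ (η * τ / (M + 1)) * (M + 1) ≤ η * τ :=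
      (le_div_iff₀ (by positivity)).1 (min_le_right _ _)
    have h2 : 0 ≤ min δ (η * τ / (M + 1)) := by positivity
    linarith
  set P : Finset G := F ∪ (Finset.range (M + 1)).image e
  have heP : ∀ n < M, e n ∈ P := fun n hn => Finset.mem_union_right _
    (Finset.mem_image_of_mem e (Finset.mem_range.2 (by omega)))
  have hpos : (0 : ℝ) < (1 / 2) ^ (m + 1) := by positivity
  refine ⟨P, (Finset.Nonempty.image ⟨0, by simp⟩ e).mono Finset.subset_union_right,
    (1 / 2) ^ (m + 1) * κ, by positivity, fun d hd σ => ?_⟩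
  have hsub : MapSpace (orbitSum ρ e) P ((1 / 2) ^ (m + 1) * κ) σ ⊆ MapSpace ρ P κ σ :=
    fun φ hφ s hs => le_of_mul_le_mul_left
      ((mul_rho2_le ρ _ hpos.le (mul_le_orbitSum ρ e hm) _ _).trans (hφ s hs)) hpos
  have hsub' : MapSpace ρ P κ σ ⊆ MapSpace ρ F δ σ :=
    MapSpace_mono ρ Finset.subset_union_left hκδ σ
  let bad : (Fin d → X) → Fin d → Prop := fun φ a =>
    ∃ n < M, τ < ρ.d (φ (σ (e n) a)) (e n • φ a)
  let code : (Fin d → X) → Fin d → Option t := fun φ a =>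
    if bad φ a then some (p (φ a)) else none
  have hcode : ∀ φ : MapSpace (orbitSum ρ e) P ((1 / 2) ^ (m + 1) * κ) σ,
      ((Finset.univ.filter fun a => code φ.1 a ≠ none).card : ℝ) ≤ η * d := by
    intro φ
    have h : ∀ a, code φ.1 a ≠ none ↔ bad φ.1 a := fun a => by simp [code]
    simp only [h]
    exact card_filter_exists_lt_le ρ e hd hτ0 (hsub φ.2) heP hκη
  refine elog_le_add (sepNum_le_mul_card _ _ (fun x y => rhoInfty_comm ρ _ _)
    (fun x => by rw [rhoInfty_self]; exact hε) (fun φ => ⟨φ.1, hsub' (hsub φ.2)⟩)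
    (fun φ => (⟨code φ.1, hcode φ⟩ : {g : Fin d → Option t //
        ((Finset.univ.filter fun a => g a ≠ none).card : ℝ) ≤ η * d})) ?_) (hη d)
  intro φ ψ χ h1 h2 h3
  have h3' : code φ.1 = code ψ.1 := congrArg Subtype.val h3
  refine rhoInfty_lt _ (by positivity) fun a => ?_
  have ha := congrFun h3' a
  by_cases hφ : bad φ.1 a <;> by_cases hψ : bad ψ.1 a
  · exact hp _ _ (by simpa [code, hφ, hψ] using ha)
  · simp [code, hφ, hψ] at ha
  · simp [code, hφ, hψ] at ha
  · simp only [bad, not_exists, not_and, not_lt] at hφ hψ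
    have hle := orbitSum_le_of_forall_le ρ e (A := 2 * ε + 2 * τ) hC (by positivity) M
      (x := φ.1 a) (y := ψ.1 a) (fun n hn => by
        have i1 := hφ n hn
        have i2 := hψ n hn
        have i3 := (le_rhoInfty ρ _ _ (σ (e n) a)).trans_lt h1
        have i4 := (le_rhoInfty ρ _ _ (σ (e n) a)).trans_lt h2
        dsimp only at i3 i4
        have j1 := ρ.triangle (e n • φ.1 a) (φ.1 (σ (e n) a)) (e n • ψ.1 a)
        have j2 := ρ.triangle (φ.1 (σ (e n) a)) (χ.1 (σ (e n) a)) (e n • ψ.1 a)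
        have j3 := ρ.triangle (χ.1 (σ (e n) a)) (ψ.1 (σ (e n) a)) (e n • ψ.1 a)
        rw [ρ.symm (e n • φ.1 a) (φ.1 (σ (e n) a))] at j1
        rw [ρ.symm (χ.1 (σ (e n) a)) (ψ.1 (σ (e n) a))] at j3
        linarith)
    linarith

theorem hEps_orbitSum_le (Sap : SoficApprox G) {m : ℕ} (hm : e m = 1) {ε : ℝ} (hε : 0 < ε) :
    hEps Sap (orbitSum ρ e) (4 * ε) ≤ hEps Sap ρ ε := by
  refine le_iInf fun F => le_iInf fun δ => EReal.le_of_forall_lt_iff_le.1 fun z hz => ?_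
  obtain ⟨c, hc, hcz⟩ := EReal.lt_iff_exists_real_btwn.1 hz
  have hcz' : 0 < z - c := sub_pos.2 (EReal.coe_lt_coe_iff.1 hcz)
  obtain ⟨F', hF', δ', hδ', h⟩ := exists_hCnt_orbitSum_le ρ e hm hε F.1 δ.2 hcz'
  refine iInf_le_of_le ⟨F', hF'⟩ (iInf_le_of_le ⟨δ', hδ'⟩ ?_)
  refine limsup_le_of_le (by isBoundedDefault) ?_
  filter_upwards [eventually_lt_of_limsup_lt hc, Sap.d_tendsto.eventually_gt_atTop 0] with i hi hd
  have hd' : (0 : ℝ) < Sap.d i := by exact_mod_cast hd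
  rw [← EReal.coe_inv] at hi ⊢
  have hinv : (0 : EReal) ≤ (((Sap.d i : ℝ)⁻¹ : ℝ) : EReal) := by
    exact_mod_cast (inv_pos.2 hd').le
  refine (mul_le_mul_of_nonneg_right (h _ hd (Sap.σ i)) hinv).trans ?_
  rw [EReal.right_distrib_of_nonneg_of_ne_top hinv (EReal.coe_ne_top _), ← EReal.coe_mul,
    mul_inv_cancel_right₀ hd'.ne']
  calc _ ≤ (c : EReal) + ((z - c : ℝ) : EReal) := add_le_add_left hi.le _
    _ = z := by rw [← EReal.coe_add]; simp

theorem hEps_le_orbitSum (Sap : SoficApprox G) {m : ℕ} (hm : e m = 1) (ε : ℝ) :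
    hEps Sap ρ ε ≤ hEps Sap (orbitSum ρ e) (ε * ((1 : ℝ) / 2) ^ (m + 1)) := by
  refine le_iInf fun F' => le_iInf fun δ' => ?_
  obtain ⟨F, hF, δ, hδ, h⟩ := eventually_mapSpace_subset ρ e Sap F'.1 δ'.2
  refine iInf_le_of_le ⟨F, hF⟩ (iInf_le_of_le ⟨δ, hδ⟩ ?_)
  refine limsup_le_limsup ?_
  filter_upwards [h] with i hi
  have hinv : (0 : EReal) ≤ ((Sap.d i : ℝ) : EReal)⁻¹ :=
    EReal.inv_nonneg_of_nonneg (by exact_mod_cast Nat.cast_nonneg (α := ℝ) _)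
  refine mul_le_mul_of_nonneg_right (elog_mono ?_) hinv
  refine sepNum_le_of_injective _ _ (fun φ => ⟨φ.1, hi φ.2⟩)
    (fun _ _ h => Subtype.ext (Subtype.mk.inj h)) fun φ ψ h => ?_
  rw [mul_comm]
  exact (mul_le_mul_of_nonneg_left h (by positivity)).trans
    (mul_rhoInfty_le ρ _ (by positivity) (mul_le_orbitSum ρ e hm) _ _)

end Comparison

section Rescaling

theorem liminf_mul_le_of_tendsto_one {α : Type*} {l : Filter α} {u : α → EReal} {r : α → ℝ}
    (hr : Tendsto r l (𝓝 1)) : liminf (fun x => u x * (r x : EReal)) l ≤ liminf u l := by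
  refine EReal.le_of_forall_lt_iff_le.1 fun z hz => ?_
  obtain ⟨c, hc, hcz⟩ := EReal.lt_iff_exists_real_btwn.1 hz
  have hcz' : c * 1 < z := by simpa using EReal.coe_lt_coe_iff.1 hcz
  refine liminf_le_of_frequently_le' ?_
  refine ((frequently_lt_of_liminf_lt (by isBoundedDefault) hc).and_eventually
    ((hr.eventually_const_le zero_lt_one).and
      ((hr.const_mul c).eventually_le_const hcz'))).mono ?_
  rintro x ⟨hx, hr0, hrz⟩
  calc u x * (r x : EReal) ≤ (c : EReal) * (r x : EReal) :=
        mul_le_mul_of_nonneg_right hx.le (by exact_mod_cast hr0)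
    _ ≤ z := by exact_mod_cast hrz

theorem tendsto_abs_log_mul_inv {c : ℝ} (hc : 0 < c) :
    Tendsto (fun ε : ℝ => |Real.log ε| * |Real.log (c * ε)|⁻¹) (𝓝[>] 0) (𝓝 1) := by
  have h1 : Tendsto (fun ε : ℝ => Real.log c + Real.log ε) (𝓝[>] 0) atBot :=
    tendsto_atBot_add_const_left _ _ Real.tendsto_log_nhdsGT_zero
  have h2 : Tendsto (fun ε : ℝ => |1 - Real.log c * (Real.log c + Real.log ε)⁻¹|)
      (𝓝[>] 0) (𝓝 1) := by
    simpa using ((h1.inv_tendsto_atBot.const_mul (Real.log c)).const_sub 1).abs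
  refine h2.congr' ?_
  filter_upwards [self_mem_nhdsWithin, h1.eventually_lt_atBot 0] with ε hε hlog
  rw [Real.log_mul hc.ne' (ne_of_gt hε), ← abs_inv, ← abs_mul]
  congr 1
  have := hlog.ne
  field_simp
  ring

theorem liminf_div_abs_log_le {f g : ℝ → EReal} {c : ℝ} (hc : 0 < c)
    (h : ∀ ε, 0 < ε → f (c * ε) ≤ g ε) :
    liminf (fun ε : ℝ => f ε * ((|Real.log ε|⁻¹ : ℝ) : EReal)) (𝓝[>] 0) ≤
      liminf (fun ε : ℝ => g ε * ((|Real.log ε|⁻¹ : ℝ) : EReal)) (𝓝[>] 0) := by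
  have hmap : Tendsto (fun ε : ℝ => c * ε) (𝓝[>] 0) (𝓝[>] 0) := by
    refine tendsto_nhdsWithin_iff.2 ⟨?_, ?_⟩
    · simpa using (tendsto_nhdsWithin_of_tendsto_nhds (tendsto_id (x := 𝓝 (0 : ℝ)))).const_mul c
    · filter_upwards [self_mem_nhdsWithin] with ε hε
      exact mul_pos hc hε
  refine le_trans ?_ (liminf_mul_le_of_tendsto_one (tendsto_abs_log_mul_inv hc))
  refine (liminf_le_liminf_of_le hmap).trans ?_
  rw [← liminf_comp]
  refine liminf_le_liminf ?_
  filter_upwards [self_mem_nhdsWithin,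
    Real.tendsto_log_nhdsGT_zero.eventually_lt_atBot 0] with ε hε hlog
  have hne : |Real.log ε| ≠ 0 := abs_ne_zero.2 hlog.ne
  rw [mul_assoc, ← EReal.coe_mul, inv_mul_cancel_left₀ hne]
  exact mul_le_mul_of_nonneg_right (h ε hε) (by exact_mod_cast inv_nonneg.2 (abs_nonneg _))

end Rescaling

/-- Let `ρ` be a dynamically generating continuous pseudometric on `X` and let
`e : ℕ → G` be an enumeration of `G`.  Then `ρ'(x,y) = ∑_n 2^{-(n+1)} ρ(e_n x, e_n y)` is a
compatible metric on `X`; if `e_m = e_G` then for every `ε > 0` one has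
`h^{4ε}_{Σ,∞}(ρ') ≤ h^ε_{Σ,∞}(ρ) ≤ h^{ε·2^{-(m+1)}}_{Σ,∞}(ρ')`; in particular
`mdim_{Σ,M}(X,ρ) = mdim_{Σ,M}(X,ρ')`. -/
theorem dynGenerating_metric_hEps {G : Type*} [Group G] [Countable G] (Sap : SoficApprox G)
    {X : Type*} [TopologicalSpace X] [CompactSpace X] [MetrizableSpace X]
    [MulAction G X] [ContinuousConstSMul G X]
    (ρ : ContPseudoMetric X) (hgen : DynGenerating G ρ)
    (e : ℕ → G) (he : Function.Surjective e) :
    ∃ ρ' : ContPseudoMetric X,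
      (∀ x y : X, ρ'.d x y = ∑' n : ℕ, ((1 : ℝ) / 2) ^ (n + 1) * ρ.d (e n • x) (e n • y)) ∧
      ρ'.IsCompatMetric ∧
      (∀ m : ℕ, e m = 1 → ∀ ε : ℝ, 0 < ε →
        hEps Sap ρ' (4 * ε) ≤ hEps Sap ρ ε ∧
        hEps Sap ρ ε ≤ hEps Sap ρ' (ε * ((1 : ℝ) / 2) ^ (m + 1))) ∧
      mdimSigmaM Sap ρ = mdimSigmaM Sap ρ' := by
  obtain ⟨m, hm⟩ := he 1
  have hpos : (0 : ℝ) < (1 / 2) ^ (m + 1) := by positivity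
  refine ⟨orbitSum ρ e, fun _ _ => rfl, orbitSum_isCompatMetric ρ e hgen he,
    fun m hm ε hε => ⟨hEps_orbitSum_le ρ e Sap hm hε, hEps_le_orbitSum ρ e Sap hm ε⟩,
    le_antisymm ?_ ?_⟩
  · refine liminf_div_abs_log_le (inv_pos.2 hpos) fun ε _ => ?_
    have h := hEps_le_orbitSum ρ e Sap hm (((1 / 2) ^ (m + 1))⁻¹ * ε)
    rwa [mul_right_comm, inv_mul_cancel₀ hpos.ne', one_mul] at h
  · exact liminf_div_abs_log_le four_pos fun ε hε => hEps_orbitSum_le ρ e Sap hm hε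

end SoficMD
end
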